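/- arXiv:2007.11169 — 2 statements merged into one kernel-verified Lean document; each statement's English description precedes it below -/
import Mathlib

section
/- Let q be a prime power. There exists a primitive 2-normal element in F_{q^4} over F_q if and only if q ≡ 1 (mod 4). -/
open Polynomial

noncomputable section

/-- An element of a finite field is *primitive* if it generates the cyclic multiplicative
group, i.e. its multiplicative order is `card E - 1`. -/
def IsPrimitiveElem {E : Type*} [Field E] [Fintype E] (α : E) : Prop :=
  orderOf α = Fintype.card E - 1

/-- The polynomial `g_α(x) = Σ_{i=0}^{n-1} α^{q^i} x^{n-1-i} ∈ F_{q^n}[x]`. -/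
def gPoly {E : Type*} [Field E] (q n : ℕ) (α : E) : Polynomial E :=
  ∑ i ∈ Finset.range n, C (α ^ q ^ i) * X ^ (n - 1 - i)

/-- `α ∈ F_{q^n}` is `k`-normal over `F_q` if `gcd(x^n - 1, g_α(x))` in `F_{q^n}[x]`
has degree `k`. -/
def IsKNormal {E : Type*} [Field E] (q n k : ℕ) (α : E) : Prop :=
  (@EuclideanDomain.gcd (Polynomial E) _ (Classical.decEq _)
    ((X : Polynomial E) ^ n - 1) (gPoly q n α)).natDegree = k

section Stepanov

theorem pow_dvd_hasseDeriv_mul_pow {R : Type*} [CommRing R] (c f : R[X]) (N l : ℕ) :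
    f ^ (N - l) ∣ hasseDeriv l (c * f ^ N) := by
  induction N generalizing l with
  | zero => simp
  | succ N ih =>
    have h : c * f ^ (N + 1) = f * (c * f ^ N) := by ring
    rw [h, hasseDeriv_mul]
    refine Finset.dvd_sum fun x hx => ?_
    obtain ⟨i, j⟩ := x
    rw [Finset.HasAntidiagonal.mem_antidiagonal] at hx
    simp only at hx ⊢
    rcases Nat.eq_zero_or_pos i with rfl | hi
    · obtain rfl : j = l := by omega
      rw [hasseDeriv_zero']
      refine (pow_dvd_pow f (show N + 1 - j ≤ N - j + 1 by omega)).trans ?_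
      rw [pow_succ']
      exact mul_dvd_mul_left f (ih j)
    · exact ((pow_dvd_pow f (show N + 1 - l ≤ N - j by omega)).trans (ih j)).mul_left _

theorem exists_linearMap_hasseDeriv_mul_pow {K : Type*} [Field K] {f : K[X]} (hf : f ≠ 0)
    (N l : ℕ) :
    ∃ φ : K[X] →ₗ[K] K[X], ∀ c, f ^ (N - l) * φ c = hasseDeriv l (c * f ^ N) := by
  have hinj : Function.Injective (LinearMap.mulLeft K (f ^ (N - l))) :=
    fun a b h => mul_left_cancel₀ (pow_ne_zero _ hf) h
  obtain ⟨g, hg⟩ := LinearMap.exists_leftInverse_of_injective _ (LinearMap.ker_eq_bot.mpr hinj)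
  refine ⟨g ∘ₗ hasseDeriv l ∘ₗ LinearMap.mulRight K (f ^ N), fun c => ?_⟩
  obtain ⟨r, hr⟩ := pow_dvd_hasseDeriv_mul_pow c f N l
  simp only [LinearMap.comp_apply, LinearMap.mulRight_apply, hr]
  rw [show g (f ^ (N - l) * r) = r from LinearMap.congr_fun hg r]

theorem mem_degreeLT_of_pow_mul_eq_hasseDeriv {K : Type*} [Field K] {f c r : K[X]} {N l e D : ℕ}
    (hf : f ≠ 0) (hD : f.natDegree ≤ D) (hl : l ≤ N) (hc : c ∈ degreeLT K e)
    (h : f ^ (N - l) * r = hasseDeriv l (c * f ^ N)) : r ∈ degreeLT K (e + l * D) := by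
  by_cases hr : r = 0
  · simp [hr]
  by_cases hc0 : c = 0
  · simp only [hc0, zero_mul, map_zero, mul_eq_zero, hr, or_false] at h
    exact absurd h (pow_ne_zero _ hf)
  have h1 : (f ^ (N - l) * r).natDegree = (N - l) * f.natDegree + r.natDegree := by
    rw [natDegree_mul (pow_ne_zero _ hf) hr, natDegree_pow]
  have h2 : (c * f ^ N).natDegree = c.natDegree + N * f.natDegree := by
    rw [natDegree_mul hc0 (pow_ne_zero _ hf), natDegree_pow]
  have h3 := natDegree_hasseDeriv_le (c * f ^ N) l
  rw [← h, h1, h2] at h3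
  rw [mem_degreeLT, degree_eq_natDegree hc0, Nat.cast_lt] at hc
  rw [mem_degreeLT, degree_eq_natDegree hr, Nat.cast_lt]
  have h4 : N * f.natDegree = (N - l) * f.natDegree + l * f.natDegree := by
    rw [← add_mul, Nat.sub_add_cancel hl]
  have h5 : l * f.natDegree ≤ l * D := Nat.mul_le_mul_left _ hD
  omega

theorem X_sub_C_pow_dvd_of_hasseDeriv_eval {R : Type*} [CommRing R] {p : R[X]} {x : R} {M : ℕ}
    (h : ∀ l < M, (hasseDeriv l p).eval x = 0) : (X - C x) ^ M ∣ p := by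
  rw [X_sub_C_pow_dvd_iff, X_pow_dvd_iff]
  intro d hd
  rw [← taylor_apply, taylor_coeff, h d hd]

theorem eq_zero_of_sum_mul_X_pow_eq_zero {K : Type*} [Field K] {e n : ℕ} {t : ℕ → ℕ}
    (ht : ∀ i j, i < j → t i + e ≤ t j) {c u : ℕ → K[X]} (hc : ∀ i, c i ∈ degreeLT K e)
    (hu : ∀ i, (u i).coeff 0 ≠ 0) (h : ∑ i ∈ Finset.range n, c i * u i * X ^ t i = 0) :
    ∀ i < n, c i = 0 := by
  intro i
  induction i using Nat.strong_induction_on with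
  | _ i ih =>
    intro hi
    have hdvd : X ^ (t i + e) ∣ c i * u i * X ^ t i := by
      rw [← Finset.add_sum_erase _ _ (Finset.mem_range.mpr hi)] at h
      rw [eq_neg_of_add_eq_zero_left h, dvd_neg]
      refine Finset.dvd_sum fun j hj => ?_
      rw [Finset.mem_erase, Finset.mem_range] at hj
      rcases lt_or_gt_of_ne hj.1 with hlt | hgt
      · rw [ih j hlt hj.2]; simp
      · exact (pow_dvd_pow X (ht i j hgt)).mul_left _
    rw [pow_add, mul_comm] at hdvd
    have h1 : X ^ e ∣ c i * u i := (mul_dvd_mul_iff_right (pow_ne_zero _ X_ne_zero)).mp hdvd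
    have hcop : IsCoprime (X ^ e : K[X]) (u i) := by
      refine IsCoprime.pow_left ?_
      rw [(prime_X (R := K)).irreducible.coprime_iff_not_dvd, X_dvd_iff]
      exact hu i
    have h2 : X ^ e ∣ c i := hcop.dvd_of_dvd_mul_right h1
    by_contra hne
    have h3 := degree_le_of_dvd h2 hne
    rw [degree_X_pow] at h3
    exact absurd (mem_degreeLT.mp (hc i)) (not_lt.mpr h3)

theorem finrank_degreeLT' (K : Type*) [Field K] (n : ℕ) :
    Module.finrank K (degreeLT K n) = n := by
  rw [(degreeLTEquiv K n).finrank_eq, Module.finrank_fin_fun]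

theorem exists_ne_zero_sum_linearMap_eq_zero {K : Type*} [Field K] {n M e b : ℕ}
    (φ : Fin M → Fin n → K[X] →ₗ[K] K[X])
    (hφ : ∀ l i, ∀ c ∈ degreeLT K e, φ l i c ∈ degreeLT K b) (hlt : M * b < n * e) :
    ∃ c : Fin n → K[X], (∃ i, c i ≠ 0) ∧ (∀ i, c i ∈ degreeLT K e) ∧
      ∀ l, ∑ i, φ l i (c i) = 0 := by
  let ψ : Fin M → Fin n → degreeLT K e →ₗ[K] degreeLT K b := fun l i => (φ l i).restrict (hφ l i)
  let Φ : (Fin n → degreeLT K e) →ₗ[K] (Fin M → degreeLT K b) :=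
    LinearMap.pi fun l => ∑ i, ψ l i ∘ₗ LinearMap.proj i
  have : ∀ k, FiniteDimensional K (degreeLT K k) := fun k =>
    (degreeLTEquiv K k).symm.finiteDimensional
  have hker : LinearMap.ker Φ ≠ ⊥ := by
    refine LinearMap.ker_ne_bot_of_finrank_lt ?_
    rw [Module.finrank_pi_fintype, Module.finrank_pi_fintype]
    simpa [finrank_degreeLT'] using hlt
  obtain ⟨c, hc, hc0⟩ := (Submodule.ne_bot_iff _).mp hker
  refine ⟨fun i => (c i : K[X]), ?_, fun i => (c i).2, fun l => ?_⟩
  · by_contra! hcon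
    exact hc0 (funext fun i => Subtype.ext (hcon i))
  · have h1 : (Φ c l : K[X]) = 0 := by rw [LinearMap.mem_ker.mp hc]; rfl
    simpa [Φ, ψ, LinearMap.pi_apply, LinearMap.sum_apply, LinearMap.restrict_apply] using h1

end Stepanov

section Stepanov

theorem card_mul_le_natDegree_of_X_sub_C_pow_dvd {K : Type*} [Field K] {F : K[X]} (hF : F ≠ 0)
    {M : ℕ} (s : Finset K) (h : ∀ x ∈ s, (X - C x) ^ M ∣ F) : s.card * M ≤ F.natDegree := by
  have h1 : ∏ x ∈ s, (X - C x) ^ M ∣ F := by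
    refine Finset.prod_dvd_of_coprime (fun x _ y _ hxy => ?_) h
    exact (isCoprime_X_sub_C_of_isUnit_sub (sub_ne_zero.mpr hxy).isUnit).pow
  have h2 := natDegree_le_of_dvd h1 hF
  rw [natDegree_prod _ _ (fun x _ => pow_ne_zero _ (X_sub_C_ne_zero x))] at h2
  simpa using h2

theorem X_sub_C_pow_card_dvd {K : Type*} [Field K] [Fintype K] (x : K) (k : ℕ) :
    (X - C x) ^ Fintype.card K ∣ X ^ (k * Fintype.card K) - C (x ^ k) := by
  obtain ⟨p, hp⟩ := CharP.exists K
  obtain ⟨n, hpr, hn⟩ := FiniteField.card K p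
  have : Fact p.Prime := ⟨hpr⟩
  have h1 : (X - C x) ^ Fintype.card K = X ^ Fintype.card K - C x := by
    rw [hn, sub_pow_char_pow, ← hn, ← C_pow, FiniteField.pow_card]
  rw [h1, mul_comm, pow_mul, C_pow]
  exact sub_dvd_pow_sub_pow _ _ k

theorem stepanov_card_mul_le {K : Type*} [Field K] [Fintype K] [DecidableEq K] {f g : K[X]}
    (hfg : f = X * g)
    (hg : g.coeff 0 ≠ 0) {D d e M k : ℕ} (hD : f.natDegree ≤ D) (hd : 0 < d)
    (hde : d * e + 1 = Fintype.card K) (hMQ : M ≤ Fintype.card K)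
    (hM : M * (e + M * D + k) < k * d * e) (ζ : K) :
    (Finset.univ.filter fun x : K => f.eval x ^ e = ζ).card * M ≤
      M * D + Fintype.card K * D + k * Fintype.card K := by
  set Q := Fintype.card K with hQ
  have hg0 : g ≠ 0 := by rintro rfl; simp at hg
  have hf0 : f ≠ 0 := by rw [hfg]; exact mul_ne_zero X_ne_zero hg0
  have hD1 : 1 ≤ D := by
    refine le_trans ?_ hD
    rw [hfg, natDegree_mul X_ne_zero hg0, natDegree_X]; omega
  choose φ hφ using fun N l => exists_linearMap_hasseDeriv_mul_pow hf0 N l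
  obtain ⟨c', ⟨i0, hi0⟩, hcdeg', hcsum⟩ := exists_ne_zero_sum_linearMap_eq_zero
    (n := k * d) (M := M) (e := e) (b := e + M * D + k)
    (fun l i => LinearMap.mulLeft K (C (ζ ^ (i.val % d)) * X ^ (i.val / d)) ∘ₗ
      φ (M + (i.val % d) * e) l.val) (by
      intro l i c hc
      have h1 := mem_degreeLT_of_pow_mul_eq_hasseDeriv hf0 hD
        (show l.val ≤ M + (i.val % d) * e by have := l.2; omega) hc
        (hφ (M + (i.val % d) * e) l.val c)
      simp only [LinearMap.comp_apply, LinearMap.mulLeft_apply]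
      rw [mul_assoc, ← smul_eq_C_mul]
      refine Submodule.smul_mem _ _ ?_
      set r := φ (M + (i.val % d) * e) l.val c
      by_cases hr : r = 0
      · simp [hr]
      rw [mem_degreeLT, degree_eq_natDegree hr, Nat.cast_lt] at h1
      rw [mem_degreeLT, degree_mul, degree_X_pow, degree_eq_natDegree hr]
      have h2 : i.val / d < k := Nat.div_lt_of_lt_mul (i.2.trans_eq (mul_comm _ _))
      have h3 : l.val * D ≤ M * D := Nat.mul_le_mul_right _ l.2.le
      norm_cast
      omega) (by simpa [mul_assoc] using hM)
  let c : ℕ → K[X] := fun n => if h : n < k * d then c' ⟨n, h⟩ else 0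
  have hc_eq : ∀ i : Fin (k * d), c i.val = c' i := fun i => by simp [c]
  have hcdeg : ∀ n, c n ∈ degreeLT K e := by
    intro n
    by_cases h : n < k * d
    · simp only [c, h, dif_pos]; exact hcdeg' _
    · simp [c, h]
  let F : K[X] := ∑ n ∈ Finset.range (k * d), c n * f ^ (M + (n % d) * e) * X ^ ((n / d) * Q)
  have hF0 : F ≠ 0 := by
    intro hF
    have h1 : F = f ^ M * ∑ n ∈ Finset.range (k * d),
        c n * g ^ ((n % d) * e) * X ^ ((n / d) * Q + (n % d) * e) := by
      simp only [F]
      rw [Finset.mul_sum]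
      refine Finset.sum_congr rfl fun n _ => ?_
      rw [pow_add f, hfg, mul_pow X g (n % d * e)]
      ring
    rw [h1] at hF
    have h2 := (mul_eq_zero.mp hF).resolve_left (pow_ne_zero _ hf0)
    have h3 := eq_zero_of_sum_mul_X_pow_eq_zero (e := e)
      (t := fun n => (n / d) * Q + (n % d) * e) (by
        intro i j hij
        have hi := Nat.div_add_mod i d
        have hj := Nat.div_add_mod j d
        have hi' := Nat.mod_lt i hd
        have hle : i / d ≤ j / d := Nat.div_le_div_right hij.le
        rcases hle.eq_or_lt with heq | hlt
        · rw [heq] at hi ⊢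
          have : i % d + 1 ≤ j % d := by omega
          have := Nat.mul_le_mul_right e this
          rw [add_mul] at this
          omega
        · have h4 : (i / d + 1) * Q ≤ (j / d) * Q := Nat.mul_le_mul_right _ hlt
          have h5 : (i % d + 1) * e ≤ d * e := Nat.mul_le_mul_right _ hi'
          rw [add_mul] at h4 h5
          omega) hcdeg (u := fun n => g ^ ((n % d) * e)) (by
        intro n
        rw [coeff_zero_eq_eval_zero, eval_pow, ← coeff_zero_eq_eval_zero]
        exact pow_ne_zero _ hg) h2 i0.val i0.2
    rw [hc_eq] at h3
    exact hi0 h3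
  have hdvd : ∀ x ∈ (Finset.univ.filter fun x : K => f.eval x ^ e = ζ), (X - C x) ^ M ∣ F := by
    intro x hx
    have hx' : f.eval x ^ e = ζ := (Finset.mem_filter.mp hx).2
    let G : K[X] := ∑ n ∈ Finset.range (k * d),
      c n * f ^ (M + (n % d) * e) * C (x ^ (n / d))
    have h1 : (X - C x) ^ M ∣ F - G := by
      simp only [F, G]
      rw [← Finset.sum_sub_distrib]
      refine Finset.dvd_sum fun n _ => ?_
      rw [← mul_sub]
      exact ((pow_dvd_pow _ hMQ).trans (X_sub_C_pow_card_dvd x (n / d))).mul_left _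
    have h2 : (X - C x) ^ M ∣ G := by
      refine X_sub_C_pow_dvd_of_hasseDeriv_eval fun l hl => ?_
      have h3 := congrArg (eval x) (hcsum ⟨l, hl⟩)
      simp only [LinearMap.comp_apply, LinearMap.mulLeft_apply, eval_finsetSum, eval_mul, eval_C,
        eval_pow, eval_X, eval_zero] at h3
      simp only [G, map_sum, eval_finsetSum]
      rw [Finset.sum_range]
      have h4 : ∀ i : Fin (k * d), eval x (hasseDeriv l
          (c i.val * f ^ (M + (i.val % d) * e) * C (x ^ (i.val / d)))) =
          eval x f ^ (M - l) * (ζ ^ (i.val % d) * x ^ (i.val / d) *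
            eval x (φ (M + (i.val % d) * e) l (c' i))) := by
        intro i
        rw [hc_eq, mul_comm _ (C _), ← smul_eq_C_mul, map_smul, ← hφ, eval_smul, eval_mul,
          eval_pow, smul_eq_mul, show M + (i.val % d) * e - l = (M - l) + e * (i.val % d) by
            rw [mul_comm e]; omega, pow_add, pow_mul, hx']
        ring
      rw [Finset.sum_congr rfl fun i _ => h4 i, ← Finset.mul_sum, h3, mul_zero]
    simpa using dvd_add h1 h2
  refine (card_mul_le_natDegree_of_X_sub_C_pow_dvd hF0 _ hdvd).trans ?_
  refine natDegree_sum_le_of_forall_le _ _ fun n hn => ?_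
  have hn' : n / d < k := Nat.div_lt_of_lt_mul (by rw [mul_comm]; exact Finset.mem_range.mp hn)
  have hc1 : (c n).natDegree ≤ e := by
    by_cases hc : c n = 0
    · simp [hc]
    · have := hcdeg n
      rw [mem_degreeLT, degree_eq_natDegree hc, Nat.cast_lt] at this
      exact this.le
  have h1 : (c n * f ^ (M + (n % d) * e) * X ^ ((n / d) * Q)).natDegree ≤
      e + (M + (n % d) * e) * D + (n / d) * Q := by
    refine natDegree_mul_le.trans (add_le_add (natDegree_mul_le.trans (add_le_add hc1 ?_)) ?_)
    · exact natDegree_pow_le.trans (Nat.mul_le_mul_left _ hD)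
    · exact natDegree_X_pow_le _
  refine h1.trans ?_
  have h2 : (n % d + 1) * e ≤ d * e := Nat.mul_le_mul_right _ (Nat.mod_lt n hd)
  have h3 : (n % d + 1) * e * D ≤ Q * D := Nat.mul_le_mul_right _ (by omega)
  have h4 : (n / d) * Q ≤ k * Q := Nat.mul_le_mul_right _ hn'.le
  have h5 : e ≤ e * D := Nat.le_mul_of_pos_right _ hD1
  nlinarith

/-- An admissible constant for `stepanov_bound`. -/
def stepanovConst (d D : ℕ) : ℕ :=
  4 * (2 * (d + d ^ 2 * D) + D) + 2 * d * D + 2 * d * (2 * (d + d ^ 2 * D))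

theorem stepanov_bound {K : Type*} [Field K] [Fintype K] [DecidableEq K] {f g : K[X]}
    (hfg : f = X * g) (hg : g.coeff 0 ≠ 0) {D d R : ℕ} (hD : f.natDegree ≤ D) (hd : 0 < d)
    (hdQ : d ∣ Fintype.card K - 1) (hR : R ^ 2 = Fintype.card K) (ζ : K) :
    d * (Finset.univ.filter fun x : K => f.eval x ^ ((Fintype.card K - 1) / d) = ζ).card ≤
      Fintype.card K + stepanovConst d D * R := by
  obtain ⟨e, he⟩ := hdQ
  have hQ1 : 1 < Fintype.card K := Fintype.one_lt_card
  rw [he, Nat.mul_div_cancel_left _ hd]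
  set N := (Finset.univ.filter fun x : K => f.eval x ^ e = ζ).card with hN
  have hNQ : N ≤ Fintype.card K := Finset.card_le_univ _
  rw [← hR] at he hQ1 hNQ ⊢
  set c := 2 * (d + d ^ 2 * D) with hc
  rcases le_or_gt R (2 * c) with hle | hgt
  · calc d * N ≤ d * R ^ 2 := Nat.mul_le_mul_left _ hNQ
      _ = d * R * R := by ring
      _ ≤ stepanovConst d D * R := by
          refine Nat.mul_le_mul_right _ ?_
          unfold stepanovConst
          rw [← hc]
          nlinarith [Nat.mul_le_mul_left d hle]
      _ ≤ _ := Nat.le_add_left _ _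
  · obtain ⟨t, rfl⟩ : ∃ t, R = t + c := ⟨R - c, by omega⟩
    have ht : c < t := by omega
    have hdc : 2 * d ≤ c := by rw [hc]; nlinarith [Nat.zero_le (d ^ 2 * D)]
    have hR3 : 3 ≤ t + c := by omega
    have hde : d * e + 1 = (t + c) ^ 2 := by omega
    have hM : d * t * (e + d * t * D + (t + c)) < (t + c) * d * e := by
      have h1 : c * (d * e) > d * (t + c) ^ 2 * (1 + d * D) := by
        have h2 : c * (d * e) = d * (1 + d * D) * (2 * (d * e)) := by rw [hc]; ring
        have h3 : (t + c) ^ 2 < 2 * (d * e) := by nlinarith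
        have h4 : 0 < d * (1 + d * D) := by positivity
        have := Nat.mul_lt_mul_of_pos_left h3 h4
        rw [h2]; linarith
      have h5 : d * t * (d * t * D + (t + c)) ≤ d * (t + c) ^ 2 * (1 + d * D) := by
        have h6 : d * t * D + (t + c) ≤ (t + c) * (1 + d * D) := by nlinarith [Nat.zero_le (c * (d * D))]
        calc d * t * (d * t * D + (t + c)) ≤ d * (t + c) * ((t + c) * (1 + d * D)) := by
              gcongr; omega
          _ = _ := by ring
      nlinarith
    have hMQ : d * t ≤ Fintype.card K := by rw [← hR]; nlinarith
    have key := stepanov_card_mul_le hfg hg hD hd (hR ▸ hde) hMQ hM ζ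
    rw [← hN, ← hR] at key
    have ht0 : 0 < t := by omega
    refine Nat.le_of_mul_le_mul_right (c := t) ?_ ht0
    have h7 : stepanovConst d D ≥ 4 * (c + D) + 2 * d * D := by
      unfold stepanovConst; rw [← hc]; omega
    have h8 : (4 * (c + D) + 2 * d * D) * ((t + c) * t) ≤ stepanovConst d D * ((t + c) * t) :=
      Nat.mul_le_mul_right _ h7
    have h9 : (t + c) * (t + c) ≤ 2 * ((t + c) * t) := by nlinarith
    have h10 : (c + D) * ((t + c) * (t + c)) ≤ (c + D) * (2 * ((t + c) * t)) :=
      Nat.mul_le_mul_left _ h9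
    have h11 : d * D * t ≤ d * D * ((t + c) * t) := by
      refine Nat.mul_le_mul_left _ ?_
      nlinarith
    generalize stepanovConst d D = S at h8
    have h12 : (4 * (c + D) + 2 * d * D) * ((t + c) * t) =
        2 * ((c + D) * (2 * ((t + c) * t))) + 2 * (d * D * ((t + c) * t)) := by ring
    have h13 : 0 ≤ (c + D) * ((t + c) * (t + c)) := Nat.zero_le _
    have h14 : 0 ≤ d * D * t := Nat.zero_le _
    linarith

end Stepanov

section LFunction

theorem finite_natDegree_le (K : Type*) [Field K] [Finite K] (n : ℕ) :
    {f : K[X] | f.natDegree ≤ n}.Finite := by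
  have : Finite (degreeLT K (n + 1)) := Module.finite_of_finite K
  refine (Set.toFinite (degreeLT K (n + 1) : Set K[X])).subset fun f hf => ?_
  rw [SetLike.mem_coe, mem_degreeLT]
  exact lt_of_le_of_lt degree_le_natDegree (by exact_mod_cast Nat.lt_succ_of_le hf)

/-- The monic polynomials of degree `n` over a finite field. -/
def monics (K : Type*) [Field K] [Finite K] (n : ℕ) : Finset K[X] :=
  ((finite_natDegree_le K n).subset
    (fun f (hf : f.Monic ∧ f.natDegree = n) => hf.2.le)).toFinset

/-- The monic irreducible polynomials of degree at most `n` over a finite field. -/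
def irreducibles (K : Type*) [Field K] [Finite K] (n : ℕ) : Finset K[X] :=
  ((finite_natDegree_le K n).subset
    (fun f (hf : f.Monic ∧ Irreducible f ∧ f.natDegree ≤ n) => hf.2.2)).toFinset

variable {K : Type*} [Field K] [Finite K]

@[simp] theorem mem_monics {n : ℕ} {f : K[X]} : f ∈ monics K n ↔ f.Monic ∧ f.natDegree = n := by
  exact Set.Finite.mem_toFinset _

@[simp] theorem mem_irreducibles {n : ℕ} {f : K[X]} :
    f ∈ irreducibles K n ↔ f.Monic ∧ Irreducible f ∧ f.natDegree ≤ n := by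
  exact Set.Finite.mem_toFinset _

/-- The coefficients of the `L`-function of a multiplicative function on polynomials. -/
def lCoeff (Ψ : K[X] →* ℂ) (n : ℕ) : ℂ := ∑ f ∈ monics K n, Ψ f

/-- The coefficients of the logarithmic derivative of the `L`-function of a multiplicative
function on polynomials. -/
def logCoeff (Ψ : K[X] →* ℂ) (k : ℕ) : ℂ :=
  ∑ P ∈ irreducibles K k, ∑ j ∈ Finset.Icc 1 k,
    if P.natDegree * j = k then P.natDegree * Ψ P ^ j else 0

theorem logCoeff_eq_of_le (Ψ : K[X] →* ℂ) {k n : ℕ} (hk : 1 ≤ k) (hkn : k ≤ n) :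
    logCoeff Ψ k = ∑ P ∈ irreducibles K n, ∑ j ∈ Finset.Icc 1 n,
      if P.natDegree * j = k then P.natDegree * Ψ P ^ j else 0 := by
  have h1 : ∀ P : K[X], (∑ j ∈ Finset.Icc 1 k,
      if P.natDegree * j = k then P.natDegree * Ψ P ^ j else 0) = ∑ j ∈ Finset.Icc 1 n,
      if P.natDegree * j = k then P.natDegree * Ψ P ^ j else 0 := by
    intro P
    refine Finset.sum_subset (Finset.Icc_subset_Icc_right hkn) fun j hj hj' => if_neg fun h => ?_
    simp only [Finset.mem_Icc] at hj hj'
    rcases Nat.eq_zero_or_pos P.natDegree with h0 | h0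
    · simp [h0] at h; omega
    · exact hj' ⟨hj.1, by nlinarith⟩
  unfold logCoeff
  simp only [h1]
  refine Finset.sum_subset (fun P hP => ?_) fun P hP hP' => Finset.sum_eq_zero fun j hj =>
    if_neg fun h => ?_
  · simp only [mem_irreducibles] at hP ⊢
    exact ⟨hP.1, hP.2.1, hP.2.2.trans hkn⟩
  · simp only [mem_irreducibles, Finset.mem_Icc] at hP hP' hj
    exact hP' ⟨hP.1, hP.2.1, by nlinarith⟩

open UniqueFactorizationMonoid in
theorem natDegree_eq_sum_pow_dvd {f : K[X]} (hf : f.Monic) {n : ℕ} (hn : f.natDegree = n) :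
    n = ∑ P ∈ irreducibles K n, ∑ j ∈ Finset.Icc 1 n,
      open Classical in if P ^ j ∣ f then P.natDegree else 0 := by
  classical
  have hf0 := hf.ne_zero
  have hprod : (normalizedFactors f).prod = f := by
    have h := prod_normalizedFactors_eq hf0
    rwa [hf.normalize_eq_self] at h
  have hmon : ∀ P ∈ normalizedFactors f, P.Monic := fun P hP => by
    have := normalize_normalized_factor P hP
    rw [← this]
    exact monic_normalize (irreducible_of_normalized_factor P hP).ne_zero
  have hdeg : n = ((normalizedFactors f).map natDegree).sum := by
    rw [← natDegree_multiset_prod _ (zero_notMem_normalizedFactors f), hprod, hn]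
  rw [Finset.sum_multiset_map_count] at hdeg
  refine hdeg.trans ?_
  have hsub : (normalizedFactors f).toFinset ⊆ irreducibles K n := by
    intro P hP
    rw [Multiset.mem_toFinset] at hP
    rw [mem_irreducibles]
    exact ⟨hmon P hP, irreducible_of_normalized_factor P hP,
      hn ▸ natDegree_le_of_dvd (dvd_of_mem_normalizedFactors hP) hf0⟩
  rw [Finset.sum_subset hsub]
  · refine Finset.sum_congr rfl fun P hP => ?_
    rw [mem_irreducibles] at hP
    have key : ∀ j, P ^ j ∣ f ↔ j ≤ (normalizedFactors f).count P := fun j => by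
      rw [pow_dvd_iff_le_emultiplicity,
        emultiplicity_eq_count_normalizedFactors hP.2.1 hf0, hP.1.normalize_eq_self]
      exact_mod_cast Iff.rfl
    have hle : (normalizedFactors f).count P ≤ n := by
      have h1 := natDegree_le_of_dvd ((key _).2 le_rfl) hf0
      rw [natDegree_pow, hn] at h1
      have := hP.2.1.natDegree_pos
      nlinarith
    rw [← Finset.sum_filter, Finset.sum_const]
    congr 1
    simp only [key]
    have : (Finset.Icc 1 n).filter (· ≤ (normalizedFactors f).count P) =
        Finset.Icc 1 ((normalizedFactors f).count P) := by
      ext j; simp only [Finset.mem_filter, Finset.mem_Icc]; omega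
    rw [this]; simp
  · intro P _ hP
    rw [Multiset.mem_toFinset] at hP
    simp [Multiset.count_eq_zero_of_notMem hP]

theorem sum_monics_dvd (Ψ : K[X] →* ℂ) {P : K[X]} (hP : P.Monic) (n : ℕ) :
    ∑ f ∈ monics K n, (open Classical in if P ∣ f then Ψ f else 0) =
      if P.natDegree ≤ n then Ψ P * lCoeff Ψ (n - P.natDegree) else 0 := by
  classical
  rw [← Finset.sum_filter]
  split_ifs with h
  · rw [lCoeff, Finset.mul_sum]
    symm
    refine Finset.sum_bij (fun g _ => P * g) (fun g hg => ?_) (fun g _ g' _ hgg => ?_)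
      (fun f hf => ?_) (fun g _ => (map_mul Ψ _ _).symm)
    · rw [mem_monics] at hg
      simp only [Finset.mem_filter, mem_monics, dvd_mul_right, and_true]
      exact ⟨hP.mul hg.1, by rw [hP.natDegree_mul hg.1]; omega⟩
    · exact mul_left_cancel₀ hP.ne_zero hgg
    · simp only [Finset.mem_filter, mem_monics] at hf
      obtain ⟨⟨hm, hd⟩, g, rfl⟩ := hf
      have hg := hP.of_mul_monic_left hm
      refine ⟨g, ?_, rfl⟩
      rw [mem_monics]
      rw [hP.natDegree_mul hg] at hd
      exact ⟨hg, by omega⟩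
  · refine Finset.sum_eq_zero fun f hf => absurd ?_ h
    simp only [Finset.mem_filter, mem_monics] at hf
    exact hf.1.2 ▸ natDegree_le_of_dvd hf.2 hf.1.1.ne_zero

theorem natCast_mul_lCoeff (Ψ : K[X] →* ℂ) (n : ℕ) :
    n * lCoeff Ψ n = ∑ k ∈ Finset.Icc 1 n, logCoeff Ψ k * lCoeff Ψ (n - k) := by
  classical
  have h1 : n * lCoeff Ψ n = ∑ P ∈ irreducibles K n, ∑ j ∈ Finset.Icc 1 n,
      P.natDegree * ∑ f ∈ monics K n, if P ^ j ∣ f then Ψ f else 0 := by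
    rw [lCoeff, Finset.mul_sum]
    simp only [Finset.mul_sum]
    conv_rhs =>
      enter [2, P]
      rw [Finset.sum_comm]
    rw [Finset.sum_comm]
    refine Finset.sum_congr rfl fun f hf => ?_
    rw [mem_monics] at hf
    have h := congrArg (Nat.cast : ℕ → ℂ) (natDegree_eq_sum_pow_dvd hf.1 hf.2)
    calc (n : ℂ) * Ψ f = _ := by rw [h, Nat.cast_sum, Finset.sum_mul]
      _ = _ := ?_
    refine Finset.sum_congr rfl fun P _ => ?_
    rw [Nat.cast_sum, Finset.sum_mul]
    refine Finset.sum_congr rfl fun j _ => ?_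
    split_ifs <;> simp
  rw [h1]
  have h2 : ∀ k ∈ Finset.Icc 1 n, logCoeff Ψ k * lCoeff Ψ (n - k) =
      ∑ P ∈ irreducibles K n, ∑ j ∈ Finset.Icc 1 n,
      if P.natDegree * j = k then P.natDegree * Ψ P ^ j * lCoeff Ψ (n - k) else 0 := by
    intro k hk
    rw [Finset.mem_Icc] at hk
    rw [logCoeff_eq_of_le Ψ hk.1 hk.2, Finset.sum_mul]
    refine Finset.sum_congr rfl fun P _ => ?_
    rw [Finset.sum_mul]
    refine Finset.sum_congr rfl fun j _ => ?_
    split_ifs <;> simp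
  rw [Finset.sum_congr rfl h2]
  conv_rhs => rw [Finset.sum_comm]
  refine Finset.sum_congr rfl fun P hP => ?_
  conv_rhs => rw [Finset.sum_comm]
  refine Finset.sum_congr rfl fun j hj => ?_
  rw [mem_irreducibles] at hP
  rw [Finset.mem_Icc] at hj
  rw [sum_monics_dvd Ψ (hP.1.pow j) n, natDegree_pow, Finset.sum_ite_eq, mul_comm j]
  have hpos : 1 ≤ P.natDegree * j := Nat.mul_pos hP.2.1.natDegree_pos hj.1
  simp only [Finset.mem_Icc, hpos, true_and, map_pow]
  split_ifs <;> ring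

end LFunction

section Roots

theorem exists_add_mul_eq (s p : ℂ) : ∃ α β : ℂ, α + β = s ∧ α * β = p := by
  obtain ⟨r, hr⟩ := IsAlgClosed.exists_pow_nat_eq (s ^ 2 - 4 * p) two_pos
  exact ⟨(s + r) / 2, (s - r) / 2, by ring, by linear_combination -hr / 4⟩

theorem le_one_of_pow_le {x C : ℝ} (h : ∀ j : ℕ, 1 ≤ j → x ^ j ≤ C) : x ≤ 1 := by
  by_contra! hx
  obtain ⟨n, hn⟩ := pow_unbounded_of_one_lt C hx
  have h1 := h (n + 1) (by omega)
  have h2 : x ^ n ≤ x ^ (n + 1) := pow_le_pow_right₀ hx.le (by omega)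
  linarith

theorem norm_le_one_of_norm_pow_add_pow_le {a b : ℂ} {C : ℝ}
    (h : ∀ j : ℕ, 1 ≤ j → ‖a ^ j + b ^ j‖ ≤ C) : ‖a‖ ≤ 1 := by
  have hC : 0 ≤ C := (norm_nonneg _).trans (h 1 le_rfl)
  have hab : ‖a * b‖ ≤ 1 := by
    refine le_one_of_pow_le (C := (C ^ 2 + C) / 2) fun j hj => ?_
    have h1 : 2 * (a * b) ^ j = (a ^ j + b ^ j) ^ 2 - (a ^ (2 * j) + b ^ (2 * j)) := by
      rw [mul_pow]; ring
    have h2 : 2 * ‖a * b‖ ^ j ≤ ‖a ^ j + b ^ j‖ ^ 2 + ‖a ^ (2 * j) + b ^ (2 * j)‖ := by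
      calc 2 * ‖a * b‖ ^ j = ‖2 * (a * b) ^ j‖ := by simp
        _ ≤ _ := by rw [h1, ← norm_pow]; exact norm_sub_le _ _
    have h3 : ‖a ^ j + b ^ j‖ ^ 2 ≤ C ^ 2 := pow_le_pow_left₀ (norm_nonneg _) (h j hj) 2
    linarith [h (2 * j) (by omega)]
  by_contra! ha
  rw [norm_mul] at hab
  have hb : ‖b‖ ≤ 1 := by
    by_contra! hb
    nlinarith
  refine absurd (le_one_of_pow_le (x := ‖a‖) (C := C + 1) fun j hj => ?_) (not_le.2 ha)
  have h1 : ‖b‖ ^ j ≤ 1 := pow_le_one₀ (norm_nonneg _) hb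
  have h2 : ‖a ^ j‖ ≤ ‖a ^ j + b ^ j‖ + ‖b ^ j‖ := by
    simpa using norm_sub_le (a ^ j + b ^ j) (b ^ j)
  rw [norm_pow, norm_pow] at h2
  linarith [h j hj]

theorem norm_le_of_norm_pow_add_pow_le {a b : ℂ} {C R : ℝ} (hR : 0 < R) {m : ℕ} (hm : m ≠ 0)
    (h : ∀ j : ℕ, 1 ≤ j → ‖a ^ (m * j) + b ^ (m * j)‖ ≤ C * R ^ (m * j)) : ‖a‖ ≤ R := by
  have h1 : ‖(a / R) ^ m‖ ≤ 1 := by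
    refine norm_le_one_of_norm_pow_add_pow_le (b := (b / R) ^ m) (C := C) fun j hj => ?_
    rw [← pow_mul, ← pow_mul, div_pow, div_pow, ← add_div, norm_div, norm_pow, Complex.norm_real,
      Real.norm_of_nonneg hR.le, div_le_iff₀ (by positivity)]
    exact h j hj
  rw [norm_pow, pow_le_one_iff_of_nonneg (norm_nonneg _) hm, norm_div, Complex.norm_real,
    Real.norm_of_nonneg hR.le, div_le_one hR] at h1
  exact h1

variable {K : Type*} [Field K] [Finite K]

theorem lCoeff_zero (Ψ : K[X] →* ℂ) : lCoeff Ψ 0 = 1 := by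
  have : monics K 0 = {1} := by
    ext f
    rw [mem_monics, Finset.mem_singleton]
    refine ⟨fun h => h.1.natDegree_eq_zero.1 h.2, ?_⟩
    rintro rfl
    exact ⟨monic_one, natDegree_one⟩
  rw [lCoeff, this, Finset.sum_singleton, map_one]

theorem exists_logCoeff_eq (Ψ : K[X] →* ℂ) (h4 : ∀ n, 4 ≤ n → lCoeff Ψ n = 0)
    (hs : 1 + lCoeff Ψ 1 + lCoeff Ψ 2 + lCoeff Ψ 3 = 0) :
    ∃ α β : ℂ, α + β = -(1 + lCoeff Ψ 1) ∧
      ∀ k, 1 ≤ k → logCoeff Ψ k = -(1 + α ^ k + β ^ k) := by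
  obtain ⟨α, β, h1, h2⟩ := exists_add_mul_eq (-(1 + lCoeff Ψ 1)) (-lCoeff Ψ 3)
  refine ⟨α, β, h1, fun k => ?_⟩
  have e1 : lCoeff Ψ 1 = -(1 + α + β) := by linear_combination h1
  have e3 : lCoeff Ψ 3 = -(α * β) := by linear_combination h2
  have e2 : lCoeff Ψ 2 = α + β + α * β := by linear_combination hs - h1 - h2
  induction k using Nat.strong_induction_on with
  | _ k ih =>
    intro hk
    have hN := natCast_mul_lCoeff Ψ k
    obtain ⟨m, rfl⟩ : ∃ m, k = m + 1 := ⟨k - 1, by omega⟩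
    rw [Finset.sum_Icc_succ_top (by omega), Nat.sub_self, lCoeff_zero, mul_one] at hN
    rcases lt_or_ge m 3 with hm | hm
    · interval_cases m
      · simp at hN
        rw [zero_add, ← hN, e1]; ring
      · simp at hN
        have i1 := ih 1 (by norm_num) le_rfl
        norm_num at hN i1 ⊢
        rw [i1, e1, e2] at hN
        linear_combination -hN
      · have i1 := ih 1 (by norm_num) le_rfl
        have i2 := ih 2 (by norm_num) (by norm_num)
        rw [Finset.sum_Icc_succ_top (by omega)] at hN
        norm_num at hN i1 i2 ⊢
        rw [i1, i2, e1, e2, e3] at hN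
        linear_combination -hN
    · obtain ⟨m, rfl⟩ : ∃ n, m = n + 3 := ⟨m - 3, by omega⟩
      rw [Finset.sum_Icc_succ_top (by omega), Finset.sum_Icc_succ_top (by omega),
        Finset.sum_Icc_succ_top (by omega), h4 _ (by omega)] at hN
      rw [Finset.sum_eq_zero fun i hi => by
        rw [Finset.mem_Icc] at hi; rw [h4 _ (by omega), mul_zero]] at hN
      rw [ih (m + 1) (by omega) (by omega), ih (m + 1 + 1) (by omega) (by omega),
        ih (m + 2 + 1) (by omega) (by omega),
        show m + 3 + 1 - (m + 1) = 3 by omega, show m + 3 + 1 - (m + 1 + 1) = 2 by omega,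
        show m + 3 + 1 - (m + 2 + 1) = 1 by omega, e1, e2, e3] at hN
      linear_combination -hN

end Roots

section Character

variable {K : Type*} [Field K] {E : Type*} [Field E] [Algebra K E]

/-- A multiplicative character of an extension field, evaluated at the values of polynomials at a
given point. -/
def evalChar (ψ : MulChar E ℂ) (b : E) : K[X] →* ℂ :=
  (ψ : E →* ℂ).comp (aeval b : K[X] →ₐ[K] E)

@[simp] theorem evalChar_apply (ψ : MulChar E ℂ) (b : E) (f : K[X]) :
    evalChar ψ b f = ψ (aeval b f) := rfl

theorem aeval_bijective_degreeLT [Finite E] {b : E}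
    (hE : Module.finrank K E = 4) (hb : (minpoly K b).natDegree = 4) :
    Function.Bijective fun f : degreeLT K 4 => aeval b (f : K[X]) := by
  let φ : degreeLT K 4 →ₗ[K] E := (aeval b : K[X] →ₐ[K] E).toLinearMap ∘ₗ (degreeLT K 4).subtype
  have hinj : Function.Injective φ := by
    rw [← LinearMap.ker_eq_bot, LinearMap.ker_eq_bot']
    rintro ⟨f, hf⟩ h
    have h : aeval b f = 0 := h
    rw [Subtype.ext_iff]
    by_contra hf0
    have h1 := minpoly.degree_le_of_ne_zero K b hf0 h
    rw [degree_eq_natDegree (fun h0 => by simp [h0] at hb), hb] at h1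
    exact absurd (mem_degreeLT.1 hf) (not_lt.2 h1)
  have hfin : Module.finrank K (degreeLT K 4) = Module.finrank K E := by
    rw [hE, finrank_degreeLT']
  have : Module.Finite K E := Module.finite_of_finrank_pos (by omega)
  have : Module.Finite K (degreeLT K 4) := Module.finite_of_finrank_pos (by omega)
  exact ⟨hinj, (LinearMap.injective_iff_surjective_of_finrank_eq_finrank hfin).1 hinj⟩

end Character

section Character

variable {K : Type*} [Field K] [Finite K] {E : Type*} [Field E] [Algebra K E] [Fintype E] {ψ : MulChar E ℂ} {b : E}

theorem lCoeff_evalChar_eq_zero (hψ : ψ ≠ 1) (hE : Module.finrank K E = 4)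
    (hb : (minpoly K b).natDegree = 4) {n : ℕ} (hn : 4 ≤ n) :
    lCoeff (evalChar ψ b : K[X] →* ℂ) n = 0 := by
  have key : ∀ e : E, lCoeff (evalChar ψ b : K[X] →* ℂ) n =
      ∑ f ∈ monics K n, ψ (aeval b f + e) := by
    intro e
    obtain ⟨⟨h, hh⟩, rfl⟩ := (aeval_bijective_degreeLT hE hb).2 e
    rw [mem_degreeLT] at hh
    have hlt : ∀ f ∈ monics K n, h.degree < f.degree := fun f hf => by
      rw [mem_monics] at hf
      rw [degree_eq_natDegree hf.1.ne_zero, hf.2]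
      exact hh.trans_le (by exact_mod_cast hn)
    have hsub : ∀ f ∈ monics K n, ∀ g, g.degree = h.degree → f + g ∈ monics K n := by
      intro f hf g hg
      have := hlt f hf
      rw [← hg] at this
      rw [mem_monics] at hf ⊢
      exact ⟨hf.1.add_of_left this, by rw [natDegree_add_eq_left_of_degree_lt this, hf.2]⟩
    symm
    refine Finset.sum_bij' (fun f _ => f + h) (fun f _ => f - h) (fun f hf => hsub f hf _ rfl)
      (fun f hf => ?_) (fun f _ => by simp) (fun f _ => by simp) (fun f _ => by simp)
    rw [sub_eq_add_neg]
    exact hsub f hf _ (degree_neg h)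
  have h1 : ∑ _e : E, lCoeff (evalChar ψ b : K[X] →* ℂ) n = 0 := by
    rw [Finset.sum_congr rfl fun e _ => key e, Finset.sum_comm]
    refine Finset.sum_eq_zero fun f _ => ?_
    rw [← MulChar.sum_eq_zero_of_ne_one hψ]
    exact Fintype.sum_equiv (Equiv.addLeft (aeval b f)) _ _ fun e => rfl
  rw [Finset.sum_const, nsmul_eq_mul] at h1
  refine (mul_eq_zero.1 h1).resolve_left ?_
  simp

theorem sum_lCoeff_evalChar (hψ : ψ ≠ 1) (hψK : ∀ c : K, c ≠ 0 → ψ (algebraMap K E c) = 1)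
    (hE : Module.finrank K E = 4) (hb : (minpoly K b).natDegree = 4) :
    1 + lCoeff (evalChar ψ b : K[X] →* ℂ) 1 + lCoeff (evalChar ψ b : K[X] →* ℂ) 2 +
      lCoeff (evalChar ψ b : K[X] →* ℂ) 3 = 0 := by
  classical
  have := Fintype.ofFinite K
  let S : Finset K[X] := (finite_natDegree_le K 3).toFinset
  have hS : ∀ f, f ∈ S ↔ f.natDegree ≤ 3 := fun f => Set.Finite.mem_toFinset _
  have hS' : ∀ f, f ∈ S ↔ f ∈ degreeLT K 4 := fun f => by
    rw [hS, mem_degreeLT]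
    rcases eq_or_ne f 0 with rfl | hf
    · simp only [natDegree_zero, degree_zero, Nat.zero_le, true_iff]
      exact WithBot.bot_lt_coe 4
    · rw [degree_eq_natDegree hf]
      norm_cast
      omega
  have h0 : ∑ f ∈ S.filter (· ≠ 0), ψ (aeval b f) = 0 := by
    rw [← MulChar.sum_eq_zero_of_ne_one hψ, Finset.sum_filter_of_ne]
    · refine Finset.sum_bij (fun f _ => aeval b f) (fun _ _ => Finset.mem_univ _)
        (fun f hf g hg h => ?_) (fun e _ => ?_) (fun _ _ => rfl)
      · exact congrArg Subtype.val (@(aeval_bijective_degreeLT hE hb).1 ⟨f, (hS' f).1 hf⟩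
          ⟨g, (hS' g).1 hg⟩ h)
      · obtain ⟨⟨f, hf⟩, rfl⟩ := (aeval_bijective_degreeLT hE hb).2 e
        exact ⟨f, (hS' f).2 hf, rfl⟩
    · rintro f - hf rfl
      exact hf (by rw [map_zero, ψ.map_zero])
  have h1 : ∑ f ∈ S.filter (· ≠ 0), ψ (aeval b f) =
      ∑ x ∈ (Finset.univ : Finset Kˣ) ×ˢ S.filter Monic, ψ (aeval b x.2) := by
    symm
    refine Finset.sum_bij' (fun x _ => C (x.1 : K) * x.2)
      (fun f hf => (Units.mk0 f.leadingCoeff (by simpa using (Finset.mem_filter.1 hf).2),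
        C f.leadingCoeff⁻¹ * f)) ?_ ?_ ?_ ?_ ?_
    · rintro ⟨c, f⟩ hf
      simp only [Finset.mem_product, Finset.mem_filter, hS, Finset.mem_univ, true_and] at hf ⊢
      rw [natDegree_C_mul c.ne_zero]
      exact ⟨hf.1, mul_ne_zero (C_ne_zero.2 c.ne_zero) hf.2.ne_zero⟩
    · intro f hf
      simp only [Finset.mem_product, Finset.mem_filter, hS, Finset.mem_univ, true_and] at hf ⊢
      have hl := leadingCoeff_ne_zero.2 hf.2
      rw [natDegree_C_mul (inv_ne_zero hl)]
      exact ⟨hf.1, by rw [Monic, leadingCoeff_mul, leadingCoeff_C, inv_mul_cancel₀ hl]⟩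
    · rintro ⟨c, f⟩ hf
      simp only [Finset.mem_product, Finset.mem_filter, hS, Finset.mem_univ, true_and] at hf
      ext1
      · ext; simp [hf.2.leadingCoeff]
      · simp [hf.2.leadingCoeff, ← mul_assoc, ← C_mul]
    · intro f hf
      simp only [Finset.mem_filter, hS] at hf
      have hl := leadingCoeff_ne_zero.2 hf.2
      simp [← mul_assoc, ← C_mul, hl]
    · rintro ⟨c, f⟩ hf
      simp [hψK]
  have h2 : ∑ f ∈ S.filter Monic, ψ (aeval b f) =
      ∑ n ∈ Finset.range 4, lCoeff (evalChar ψ b : K[X] →* ℂ) n := by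
    rw [← Finset.sum_fiberwise_of_maps_to (g := natDegree) (t := Finset.range 4)]
    · refine Finset.sum_congr rfl fun n hn => Finset.sum_congr ?_ fun _ _ => rfl
      ext f
      simp only [Finset.mem_filter, hS, mem_monics, Finset.mem_range] at hn ⊢
      constructor
      · rintro ⟨⟨_, h⟩, h'⟩
        exact ⟨h, h'⟩
      · rintro ⟨h, h'⟩
        exact ⟨⟨by omega, h⟩, h'⟩
    · intro f hf
      simp only [Finset.mem_filter, hS, Finset.mem_range] at hf ⊢
      omega
  rw [h0, Finset.sum_product] at h1
  dsimp only at h1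
  rw [Finset.sum_const, h2, nsmul_eq_mul] at h1
  have h3 := (mul_eq_zero.1 h1.symm).resolve_left (by simp)
  simpa [Finset.sum_range_succ, lCoeff_zero] using h3

end Character

theorem lCoeff_evalChar_one {K : Type*} [Field K] [Fintype K] {E : Type*} [Field E] [Algebra K E]
    (ψ : MulChar E ℂ) (b : E) :
    lCoeff (evalChar ψ b : K[X] →* ℂ) 1 = ∑ a : K, ψ (b + algebraMap K E a) := by
  rw [lCoeff]
  symm
  refine Finset.sum_bij (fun a _ => X + C a) (fun a _ => ?_) (fun a _ a' _ h => ?_)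
    (fun f hf => ?_) (fun a _ => by simp)
  · rw [mem_monics]; exact ⟨monic_X_add_C a, natDegree_X_add_C a⟩
  · exact C_injective (add_left_cancel h)
  · rw [mem_monics] at hf
    refine ⟨f.coeff 0, Finset.mem_univ _, ?_⟩
    rw [eq_X_add_C_of_natDegree_le_one hf.2.le]
    have := hf.1.coeff_natDegree
    rw [hf.2] at this
    simp [this]

section Conjugates

variable {K : Type*} [Field K] [Finite K] {L : Type*} [Field L] [Algebra K L] [Finite L]

omit [Finite K] [Finite L] in
theorem minpoly_dvd_X_pow_sub_X_iff (x : L) (n : ℕ) :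
    minpoly K x ∣ X ^ Nat.card K ^ n - X ↔ x ^ Nat.card K ^ n = x := by
  rw [minpoly.dvd_iff]
  simp [sub_eq_zero]

theorem pow_card_pow_eq_self_iff (x : L) (n : ℕ) :
    x ^ Nat.card K ^ n = x ↔ (minpoly K x).natDegree ∣ n := by
  have : Algebra.IsIntegral K L := Algebra.IsIntegral.of_finite K L
  rw [(minpoly.irreducible (Algebra.IsIntegral.isIntegral x)).natDegree_dvd_iff_dvd_X_pow_card_pow_sub_X,
    minpoly_dvd_X_pow_sub_X_iff]

/-- The iterated Frobenius endomorphism relative to a finite base field. -/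
def frobPow (K : Type*) [Field K] [Finite K] (L : Type*) [Field L] [Algebra K L] (i : ℕ) : L →ₐ[K] L :=
  letI := Fintype.ofFinite K
  FiniteField.frobeniusAlgHom K L ^ i

omit [Finite L] in
@[simp] theorem frobPow_apply (i : ℕ) (x : L) : frobPow K L i x = x ^ Nat.card K ^ i := by
  let := Fintype.ofFinite K
  rw [frobPow, AlgHom.coe_pow, FiniteField.coe_frobeniusAlgHom, pow_iterate,
    Fintype.card_eq_nat_card]

theorem map_minpoly_eq_prod (x : L) : (minpoly K x).map (algebraMap K L) =
    ∏ i ∈ Finset.range (minpoly K x).natDegree, (X - C (x ^ Nat.card K ^ i)) := by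
  have : Algebra.IsIntegral K L := Algebra.IsIntegral.of_finite K L
  have hx := Algebra.IsIntegral.isIntegral (R := K) x
  have hinj : ∀ i j, i < j → j < (minpoly K x).natDegree →
      x ^ Nat.card K ^ i ≠ x ^ Nat.card K ^ j := by
    intro i j hij hj h
    obtain ⟨m, rfl⟩ := Nat.exists_eq_add_of_lt hij
    have h1 : x ^ Nat.card K ^ (m + 1) = x := by
      refine (frobPow K L i : L →+* L).injective ?_
      rw [RingHom.coe_coe]
      rw [frobPow_apply, frobPow_apply, ← pow_mul, ← pow_add, h]
      congr 2; omega
    rw [pow_card_pow_eq_self_iff] at h1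
    have := Nat.le_of_dvd (by omega) h1
    omega
  refine eq_of_monic_of_dvd_of_natDegree_le (monic_prod_of_monic _ _ fun i _ => monic_X_sub_C _)
    ((minpoly.monic hx).map _) ?_ ?_
  · refine Finset.prod_dvd_of_coprime (fun i hi j hj hij => ?_) fun i _ => ?_
    · refine isCoprime_X_sub_C_of_isUnit_sub (sub_ne_zero.2 ?_).isUnit
      simp only [Finset.coe_range, Set.mem_Iio] at hi hj
      rcases lt_or_gt_of_ne hij with h | h
      · exact hinj i j h hj
      · exact (hinj j i h hi).symm
    · rw [dvd_iff_isRoot, IsRoot.def, eval_map_algebraMap, ← frobPow_apply (K := K),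
        aeval_algHom_apply, minpoly.aeval, map_zero]
  · rw [natDegree_prod _ _ fun i _ => X_sub_C_ne_zero _]
    simp only [natDegree_X_sub_C, Finset.sum_const, Finset.card_range, smul_eq_mul, mul_one]
    exact natDegree_map_le

theorem Finset.prod_range_mul_of_periodic {M : Type*} [CommMonoid M] {f : ℕ → M} {n : ℕ}
    (hf : Function.Periodic f n) (m : ℕ) :
    ∏ i ∈ Finset.range (n * m), f i = (∏ i ∈ Finset.range n, f i) ^ m := by
  induction m with
  | zero => simp
  | succ m ih =>
    rw [Nat.mul_succ, Finset.prod_range_add, ih, pow_succ]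
    congr 1
    refine Finset.prod_congr rfl fun i _ => ?_
    rw [add_comm, mul_comm]
    exact hf.nat_mul m i

theorem aeval_minpoly_pow (x c : L) {k : ℕ} (hk : (minpoly K x).natDegree ∣ k) :
    aeval c (minpoly K x) ^ (k / (minpoly K x).natDegree) =
      ∏ i ∈ Finset.range k, (c - x ^ Nat.card K ^ i) := by
  have : Algebra.IsIntegral K L := Algebra.IsIntegral.of_finite K L
  have hx := Algebra.IsIntegral.isIntegral (R := K) x
  obtain ⟨m, rfl⟩ := hk
  rw [Nat.mul_div_cancel_left _ (minpoly.natDegree_pos hx), Finset.prod_range_mul_of_periodic,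
    ← eval_map_algebraMap, map_minpoly_eq_prod, eval_prod]
  · simp
  · intro i
    dsimp only
    rw [pow_add, mul_comm, pow_mul, (pow_card_pow_eq_self_iff x _).2 dvd_rfl]

open Classical in
theorem card_filter_minpoly_eq [Fintype L] {P : K[X]} (hP : P.Monic) (hi : Irreducible P)
    (hd : P.natDegree ∣ Module.finrank K L) :
    (Finset.univ.filter fun x : L => minpoly K x = P).card = P.natDegree := by
  have hcard : Fintype.card L = Nat.card K ^ Module.finrank K L := by
    rw [Fintype.card_eq_nat_card, Module.natCard_eq_pow_finrank (K := K)]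
  have hdvd := hi.natDegree_dvd_iff_dvd_X_pow_card_pow_sub_X.1 hd
  rw [← hcard] at hdvd
  have hsplit : (P.map (algebraMap K L)).Splits := by
    have := FiniteField.isSplittingField_sub L K
    exact Splits.of_dvd (IsSplittingField.splits L (X ^ Fintype.card L - X : K[X]))
      (map_ne_zero (FiniteField.X_pow_card_sub_X_ne_zero K Fintype.one_lt_card))
      (Polynomial.map_dvd _ hdvd)
  rw [← card_rootSet_eq_natDegree (PerfectField.separable_of_irreducible hi) hsplit,
    ← Set.toFinset_card]
  congr 1
  ext x
  simp only [Finset.mem_filter, Finset.mem_univ, true_and, Set.mem_toFinset, mem_rootSet]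
  constructor
  · rintro rfl
    exact ⟨hP.ne_zero, minpoly.aeval _ _⟩
  · rintro ⟨-, h⟩
    exact (minpoly.eq_of_irreducible_of_monic hi h hP).symm

theorem natDegree_minpoly_dvd_finrank (x : L) :
    (minpoly K x).natDegree ∣ Module.finrank K L := by
  let := Fintype.ofFinite L
  rw [← pow_card_pow_eq_self_iff, ← Module.natCard_eq_pow_finrank (K := K),
    ← Fintype.card_eq_nat_card, FiniteField.pow_card]

theorem sum_minpoly [Fintype L] (G : K[X] → ℂ) :
    ∑ x : L, G (minpoly K x) = ∑ P ∈ irreducibles K (Module.finrank K L),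
      if P.natDegree ∣ Module.finrank K L then P.natDegree * G P else 0 := by
  classical
  have : Algebra.IsIntegral K L := Algebra.IsIntegral.of_finite K L
  have : Module.Finite K L := Module.Finite.of_finite
  have hdvd : ∀ x : L, (minpoly K x).natDegree ∣ Module.finrank K L :=
    natDegree_minpoly_dvd_finrank
  rw [← Finset.sum_fiberwise_of_maps_to (g := minpoly K) (t := irreducibles K (Module.finrank K L))]
  · refine Finset.sum_congr rfl fun P hP => ?_
    rw [mem_irreducibles] at hP
    rw [Finset.sum_congr rfl fun x hx => by rw [(Finset.mem_filter.1 hx).2], Finset.sum_const,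
      nsmul_eq_mul]
    split_ifs with h
    · rw [card_filter_minpoly_eq hP.1 hP.2.1 h]
    · rw [Finset.filter_false_of_mem, Finset.card_empty, Nat.cast_zero, zero_mul]
      rintro x - rfl
      exact h (hdvd x)
  · intro x _
    have hx := Algebra.IsIntegral.isIntegral (R := K) x
    rw [mem_irreducibles]
    exact ⟨minpoly.monic hx, minpoly.irreducible hx, Nat.le_of_dvd Module.finrank_pos (hdvd x)⟩

theorem logCoeff_eq_sum [Fintype L] (Ψ : K[X] →* ℂ) {k : ℕ} (hk : Module.finrank K L = k) :
    logCoeff Ψ k = ∑ x : L, Ψ (minpoly K x) ^ (k / (minpoly K x).natDegree) := by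
  have : Module.Finite K L := Module.Finite.of_finite
  have hpos : 0 < k := hk ▸ Module.finrank_pos
  rw [sum_minpoly (fun P => Ψ P ^ (k / P.natDegree)), hk, logCoeff]
  refine Finset.sum_congr rfl fun P hP => ?_
  rw [mem_irreducibles] at hP
  have hP0 := hP.2.1.natDegree_pos
  split_ifs with h
  · obtain ⟨m, rfl⟩ := h
    rw [Nat.mul_div_cancel_left _ hP0]
    simp only [Nat.mul_right_inj hP0.ne', Finset.sum_ite_eq', Finset.mem_Icc]
    rw [if_pos ⟨Nat.pos_of_mul_pos_left hpos, Nat.le_mul_of_pos_left _ hP0⟩]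
  · exact Finset.sum_eq_zero fun j _ => if_neg fun hj => h ⟨j, hj.symm⟩

end Conjugates

section Weil

theorem norm_sum_mul_mulChar_le {E : Type*} [Field E] [Fintype E] {ψ : MulChar E ℂ} (hψ : ψ ≠ 1)
    (N : E → ℕ) {Q c D : ℕ} (hQ : ∑ ε, N ε = Q) (h0 : N 0 ≤ D)
    (hN : ∀ ε, (Fintype.card E - 1) * N ε ≤ Q + c) : ‖∑ ε, N ε * ψ ε‖ ≤ c + D := by
  classical
  set d := Fintype.card E - 1 with hd
  have hd0 : (0 : ℝ) < d := by exact_mod_cast Nat.sub_pos_of_lt Fintype.one_lt_card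
  set B : ℝ := (Q + c) / d with hB
  have h1 : ∑ ε, (N ε : ℂ) * ψ ε = ∑ ε ∈ Finset.univ.erase 0, ((N ε : ℂ) - B) * ψ ε := by
    have h2 := MulChar.sum_eq_zero_of_ne_one hψ
    rw [← Finset.add_sum_erase _ _ (Finset.mem_univ 0), MulChar.map_zero, zero_add] at h2
    rw [← Finset.add_sum_erase _ _ (Finset.mem_univ 0), MulChar.map_zero, mul_zero, zero_add]
    simp only [sub_mul, Finset.sum_sub_distrib, ← Finset.mul_sum, h2, mul_zero, sub_zero]
  have h3 : ∀ ε ∈ Finset.univ.erase (0 : E), ‖((N ε : ℂ) - B) * ψ ε‖ ≤ B - N ε := by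
    intro ε hε
    have hle : (N ε : ℝ) ≤ B := by
      rw [hB, le_div_iff₀ hd0, mul_comm]
      exact_mod_cast hN ε
    have hψ1 : ‖ψ ε‖ ≤ 1 := by
      have h := Complex.norm_eq_one_of_mem_rootsOfUnity
        (ψ.apply_mem_rootsOfUnity (Units.mk0 ε (Finset.ne_of_mem_erase hε)))
      exact h.le
    rw [norm_mul]
    have h4 : ‖(N ε : ℂ) - B‖ = B - N ε := by
      rw [← Complex.ofReal_natCast, ← Complex.ofReal_sub, Complex.norm_real, Real.norm_eq_abs,
        abs_of_nonpos (by linarith)]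
      ring
    rw [h4]
    nlinarith
  rw [h1]
  refine (norm_sum_le_of_le _ h3).trans ?_
  rw [Finset.sum_sub_distrib, Finset.sum_const, Finset.card_erase_of_mem (Finset.mem_univ _),
    Finset.card_univ, ← hd, nsmul_eq_mul, hB, mul_div_cancel₀ _ hd0.ne']
  have h5 : (N 0 : ℝ) + ∑ ε ∈ Finset.univ.erase (0 : E), (N ε : ℝ) = Q := by
    rw [Finset.add_sum_erase _ (fun ε => (N ε : ℝ)) (Finset.mem_univ 0)]
    exact_mod_cast hQ
  have h6 : (N 0 : ℝ) ≤ D := by exact_mod_cast h0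
  linarith

/-- The polynomial whose value at `b - x` is the relative norm of `b - x` for the fixed field of
the fourth power of the Frobenius. -/
def normPoly {L : Type*} [Field L] (q : ℕ) (b : L) : L[X] :=
  ∏ i ∈ Finset.range 3, (C b - (C b - X) ^ q ^ (i + 1))

theorem eval_X_mul_normPoly {L : Type*} [Field L] (q : ℕ) (b x : L) :
    (X * normPoly q b).eval (b - x) = ∏ i ∈ Finset.range 4, (b - x ^ q ^ i) := by
  rw [Finset.prod_range_succ']
  simp [normPoly, eval_prod, mul_comm]

theorem natDegree_X_mul_normPoly_le {L : Type*} [Field L] (q : ℕ) (b : L) :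
    (X * normPoly q b).natDegree ≤ 1 + q + q ^ 2 + q ^ 3 := by
  have h : ∀ i, (C b - (C b - X) ^ q ^ (i + 1)).natDegree ≤ q ^ (i + 1) := fun i => by
    refine (natDegree_sub_le _ _).trans (max_le (by simp) ?_)
    refine natDegree_pow_le.trans ?_
    have : (C b - X : L[X]).natDegree ≤ 1 := (natDegree_sub_le _ _).trans (by simp)
    nlinarith [Nat.zero_le (q ^ (i + 1))]
  refine natDegree_mul_le.trans ?_
  have := (natDegree_prod_le (Finset.range 3) fun i => C b - (C b - X) ^ q ^ (i + 1)).trans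
    (Finset.sum_le_sum fun i _ => h i)
  simp only [Finset.sum_range_succ, Finset.sum_range_zero] at this
  rw [natDegree_X]
  unfold normPoly
  norm_num at this ⊢
  linarith

theorem normPoly_coeff_zero_ne_zero {L : Type*} [Field L] {q : ℕ} {b : L}
    (hb : ∀ i ∈ Finset.range 3, b ^ q ^ (i + 1) ≠ b) : (normPoly q b).coeff 0 ≠ 0 := by
  rw [coeff_zero_eq_eval_zero, normPoly, eval_prod, Finset.prod_ne_zero_iff]
  intro i hi
  simpa [sub_eq_zero] using (hb i hi).symm

theorem prod_range_four_mul {L : Type*} [Field L] {K : Type*} [Field K] [Finite K] [Algebra K L]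
    {b : L} (hb : b ^ Nat.card K ^ 4 = b) (x : L) (j : ℕ) :
    ∏ i ∈ Finset.range (4 * j), (b - x ^ Nat.card K ^ i) =
      (∏ i ∈ Finset.range 4, (b - x ^ Nat.card K ^ i)) ^
        ((Nat.card K ^ (4 * j) - 1) / (Nat.card K ^ 4 - 1)) := by
  set q := Nat.card K with hq
  have hq1 : 1 < q := Finite.one_lt_card
  have hq4 : 2 ≤ q ^ 4 := by nlinarith [Nat.one_lt_pow (n := 4) (by norm_num) hq1]
  have hbm : ∀ m, b ^ q ^ (4 * m) = b := fun m => by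
    induction m with
    | zero => simp
    | succ m ih => rw [mul_add, mul_one, pow_add, pow_mul, ih, hb]
  rw [pow_mul q, ← Nat.geomSum_eq hq4, ← Finset.prod_pow_eq_pow_sum]
  induction j with
  | zero => simp
  | succ j ih =>
    rw [Nat.mul_succ, Finset.prod_range_add, ih, Finset.prod_range_succ _ j, ← pow_mul q]
    congr 1
    rw [hq, ← frobPow_apply, map_prod, ← hq]
    refine Finset.prod_congr rfl fun i _ => ?_
    rw [map_sub, frobPow_apply, frobPow_apply, ← hq, hbm, ← pow_mul, ← pow_add, add_comm]

theorem norm_logCoeff_evalChar_le {K E L : Type*} [Field K] [Finite K] [Field E] [Fintype E]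
    [Algebra K E] [Field L] [Fintype L] [Algebra K L] [Algebra E L] [IsScalarTower K E L]
    {ψ : MulChar E ℂ} (hψ : ψ ≠ 1) {b : E} (hE : Module.finrank K E = 4)
    (hb : (minpoly K b).natDegree = 4) {j : ℕ} (hL : Module.finrank K L = 4 * j) :
    ‖logCoeff (evalChar ψ b : K[X] →* ℂ) (4 * j)‖ ≤
      (stepanovConst (Nat.card K ^ 4 - 1)
        (1 + Nat.card K + Nat.card K ^ 2 + Nat.card K ^ 3) +
        (1 + Nat.card K + Nat.card K ^ 2 + Nat.card K ^ 3) : ℕ) * (Nat.card K : ℝ) ^ (2 * j) := by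
  classical
  set q := Nat.card K with hq
  have hq1 : 1 < q := Finite.one_lt_card
  set D := 1 + q + q ^ 2 + q ^ 3 with hD
  set c := stepanovConst (q ^ 4 - 1) D with hc
  have hcardE : Fintype.card E = q ^ 4 := by
    rw [Fintype.card_eq_nat_card, Module.natCard_eq_pow_finrank (K := K), hE]
  have hcardL : Fintype.card L = q ^ (4 * j) := by
    rw [Fintype.card_eq_nat_card, Module.natCard_eq_pow_finrank (K := K), hL]
  set bL := algebraMap E L b with hbL
  set e := (q ^ (4 * j) - 1) / (q ^ 4 - 1) with he
  have hbq : ∀ n, bL ^ q ^ n = bL ↔ 4 ∣ n := fun n => by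
    rw [hbL, ← map_pow, (algebraMap E L).injective.eq_iff, hq, pow_card_pow_eq_self_iff, hb]
  let w : L → E := fun x =>
    aeval b (minpoly K x) ^ (4 * j / (minpoly K x).natDegree)
  let y : L → L := fun x => ∏ i ∈ Finset.range 4, (bL - x ^ q ^ i)
  have hw : ∀ x, algebraMap E L (w x) = y x ^ e := fun x => by
    simp only [w, y]
    rw [map_pow, ← aeval_algebraMap_apply, aeval_minpoly_pow x _ (hL ▸ natDegree_minpoly_dvd_finrank x),
      prod_range_four_mul]
    rw [← hq]
    exact (hbq 4).2 dvd_rfl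
  have hdvd : q ^ 4 - 1 ∣ q ^ (4 * j) - 1 := by
    rw [pow_mul]; exact Nat.sub_one_dvd_pow_sub_one ..
  have hw' : ∀ ε, (Finset.univ.filter fun x => w x = ε).card =
      (Finset.univ.filter fun x : L => (X * normPoly q bL).eval x ^
        ((Fintype.card L - 1) / (q ^ 4 - 1)) = algebraMap E L ε).card := fun ε => by
    refine Finset.card_bij' (fun x _ => bL - x) (fun x _ => bL - x) ?_ ?_ (by simp) (by simp)
    · intro x hx
      simp only [Finset.mem_filter, Finset.mem_univ, true_and] at hx ⊢
      rw [eval_X_mul_normPoly, hcardL, ← hx, hw]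
    · intro x hx
      simp only [Finset.mem_filter, Finset.mem_univ, true_and] at hx ⊢
      apply (algebraMap E L).injective
      rw [hw, ← hx, hcardL]
      simp only [y]
      rw [← eval_X_mul_normPoly, sub_sub_cancel]
  have hg : (normPoly q bL).coeff 0 ≠ 0 := by
    refine normPoly_coeff_zero_ne_zero fun i hi => ?_
    rw [Ne, hbq]
    rw [Finset.mem_range] at hi
    omega
  have hstep : ∀ ε, (Fintype.card E - 1) * (Finset.univ.filter fun x => w x = ε).card ≤
      q ^ (4 * j) + c * q ^ (2 * j) := fun ε => by
    rw [hw', hcardE]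
    have := stepanov_bound (f := X * normPoly q bL) rfl hg (natDegree_X_mul_normPoly_le q bL)
      (d := q ^ 4 - 1) (R := q ^ (2 * j)) (Nat.sub_pos_of_lt (Nat.one_lt_pow (by norm_num) hq1))
      (by rw [hcardL]; exact hdvd) (by rw [hcardL, ← pow_mul]; congr 1; ring) (algebraMap E L ε)
    rw [hcardL] at this ⊢
    exact this
  have hzero : (Finset.univ.filter fun x => w x = 0).card ≤ D := by
    rw [hw']
    have hne : X * normPoly q bL ≠ 0 := mul_ne_zero X_ne_zero fun h => hg (by simp [h])
    refine le_trans (Finset.card_le_card (t := (X * normPoly q bL).roots.toFinset) fun x hx => ?_)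
      ((Multiset.toFinset_card_le _).trans ((card_roots' _).trans (natDegree_X_mul_normPoly_le q bL)))
    simp only [Finset.mem_filter, Finset.mem_univ, true_and, map_zero] at hx
    rw [Multiset.mem_toFinset, mem_roots hne]
    exact by_contra fun h => pow_ne_zero _ h hx
  have hsum : ∑ ε, (Finset.univ.filter fun x => w x = ε).card = q ^ (4 * j) := by
    rw [← hcardL, ← Finset.card_univ]
    exact (Finset.card_eq_sum_card_fiberwise fun _ _ => Finset.mem_univ _).symm
  have hmain := norm_sum_mul_mulChar_le hψ (fun ε => (Finset.univ.filter fun x => w x = ε).card)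
    hsum hzero hstep
  have hlog : logCoeff (evalChar ψ b : K[X] →* ℂ) (4 * j) =
      ∑ ε, ((Finset.univ.filter fun x => w x = ε).card : ℂ) * ψ ε := by
    rw [logCoeff_eq_sum (L := L) _ hL,
      ← Finset.sum_fiberwise_of_maps_to (g := w) (t := Finset.univ) fun _ _ => Finset.mem_univ _]
    refine Finset.sum_congr rfl fun ε _ => ?_
    rw [← nsmul_eq_mul, ← Finset.sum_const]
    refine Finset.sum_congr rfl fun x hx => ?_
    rw [← (Finset.mem_filter.1 hx).2, evalChar_apply, ← map_pow]
  rw [hlog]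
  refine hmain.trans ?_
  have h1 : (1 : ℝ) ≤ (q : ℝ) ^ (2 * j) := one_le_pow₀ (by exact_mod_cast hq1.le)
  push_cast
  nlinarith [(Nat.cast_nonneg D : (0 : ℝ) ≤ D)]

end Weil

section Weil

theorem exists_norm_logCoeff_evalChar_le {K E : Type*} [Field K] [Finite K] [Field E] [Fintype E]
    [Algebra K E] {ψ : MulChar E ℂ} (hψ : ψ ≠ 1) {b : E} (hE : Module.finrank K E = 4)
    (hb : (minpoly K b).natDegree = 4) : ∃ C : ℝ, ∀ j : ℕ, 1 ≤ j →
      ‖logCoeff (evalChar ψ b : K[X] →* ℂ) (4 * j)‖ ≤ C * (Nat.card K : ℝ) ^ (2 * j) := by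
  refine ⟨(stepanovConst (Nat.card K ^ 4 - 1)
    (1 + Nat.card K + Nat.card K ^ 2 + Nat.card K ^ 3) +
    (1 + Nat.card K + Nat.card K ^ 2 + Nat.card K ^ 3) : ℕ), fun j hj => ?_⟩
  obtain ⟨p, hp⟩ := CharP.exists E
  have : Fact p.Prime := ⟨CharP.char_is_prime E p⟩
  have : NeZero j := ⟨by omega⟩
  let L := FiniteField.Extension E p j
  let : Fintype L := Fintype.ofFinite L
  let : Algebra K L := ((algebraMap E L).comp (algebraMap K E)).toAlgebra
  have : IsScalarTower K E L := IsScalarTower.of_algebraMap_eq fun _ => rfl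
  refine norm_logCoeff_evalChar_le (L := L) hψ hE hb ?_
  have h := FiniteField.finrank_extension E p j
  rw [← Module.finrank_mul_finrank K E L, hE, h]

theorem norm_one_add_sum_mulChar_le {K E : Type*} [Field K] [Fintype K] [Field E] [Fintype E]
    [Algebra K E] {ψ : MulChar E ℂ} (hψ : ψ ≠ 1)
    (hψK : ∀ c : K, c ≠ 0 → ψ (algebraMap K E c) = 1) {b : E} (hE : Module.finrank K E = 4)
    (hb : (minpoly K b).natDegree = 4) :
    ‖1 + ∑ a : K, ψ (b + algebraMap K E a)‖ ≤ 2 * √(Fintype.card K) := by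
  obtain ⟨α, β, h1, h2⟩ := exists_logCoeff_eq (evalChar ψ b : K[X] →* ℂ)
    (fun n hn => lCoeff_evalChar_eq_zero hψ hE hb hn) (sum_lCoeff_evalChar hψ hψK hE hb)
  have hq : (1 : ℝ) ≤ Fintype.card K := by exact_mod_cast Fintype.card_pos
  have hR : 0 < √(Fintype.card K : ℝ) := Real.sqrt_pos.2 (by linarith)
  obtain ⟨C, hC⟩ : ∃ C : ℝ, ∀ j : ℕ, 1 ≤ j →
      ‖α ^ (4 * j) + β ^ (4 * j)‖ ≤ C * √(Fintype.card K : ℝ) ^ (4 * j) := by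
    obtain ⟨C, hC⟩ := exists_norm_logCoeff_evalChar_le hψ hE hb
    refine ⟨C + 1, fun j hj => ?_⟩
    have h3 := hC j hj
    have h4 : α ^ (4 * j) + β ^ (4 * j) = -logCoeff (evalChar ψ b : K[X] →* ℂ) (4 * j) - 1 := by
      rw [h2 _ (by omega)]; ring
    have h5 : √(Fintype.card K : ℝ) ^ (4 * j) = (Nat.card K : ℝ) ^ (2 * j) := by
      rw [show 4 * j = 2 * (2 * j) by ring, pow_mul, Real.sq_sqrt (by linarith),
        Fintype.card_eq_nat_card]
    have h6 : 1 ≤ (Nat.card K : ℝ) ^ (2 * j) := by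
      rw [← Fintype.card_eq_nat_card]; exact one_le_pow₀ hq
    rw [h4, h5, add_mul, one_mul]
    refine (norm_sub_le _ _).trans (add_le_add ?_ (by simpa using h6))
    rw [norm_neg]
    exact h3
  have hα := norm_le_of_norm_pow_add_pow_le hR (by norm_num) hC
  have hβ := norm_le_of_norm_pow_add_pow_le hR (by norm_num)
    (fun j hj => by rw [add_comm]; exact hC j hj : ∀ j : ℕ, 1 ≤ j →
      ‖β ^ (4 * j) + α ^ (4 * j)‖ ≤ C * √(Fintype.card K : ℝ) ^ (4 * j))
  rw [← lCoeff_evalChar_one, ← norm_neg, ← h1]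
  linarith [norm_add_le α β]

end Weil

section Sieve

variable {E : Type*} [Field E] [Fintype E]

theorem exists_mulChar_sum_pow {p : ℕ} (hp : p.Prime) (hpE : p ∣ Fintype.card E - 1) :
    ∃ χ : MulChar E ℂ, orderOf χ = p ∧ ∀ x : E, x ≠ 0 → ∑ k ∈ Finset.range p, (χ ^ k) x =
      open Classical in if x ^ ((Fintype.card E - 1) / p) = 1 then (p : ℂ) else 0 := by
  classical
  have : NeZero p := ⟨hp.ne_zero⟩
  obtain ⟨χ, hχ⟩ := MulChar.exists_mulChar_orderOf E hpE (Complex.isPrimitiveRoot_exp p hp.ne_zero)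
  refine ⟨χ, hχ, fun x hx => ?_⟩
  obtain ⟨g, hg⟩ := IsCyclic.exists_generator (α := Eˣ)
  have hgord : orderOf g = Fintype.card E - 1 := by
    rw [orderOf_eq_card_of_forall_mem_zpowers hg, Nat.card_eq_fintype_card, Fintype.card_units]
  have hχp : χ g ^ p = 1 := by
    rw [← MulChar.pow_apply_coe, ← hχ, pow_orderOf_eq_one, MulChar.one_apply_coe]
  have hχg : χ g ≠ 1 := fun h => by
    have : χ = 1 := (MulChar.eq_iff hg χ 1).2 (by rw [h, MulChar.one_apply_coe])
    rw [this, orderOf_one] at hχ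
    exact hp.one_lt.ne hχ
  have : Fact p.Prime := ⟨hp⟩
  have hχo : orderOf (χ g) = p := orderOf_eq_prime hχp hχg
  obtain ⟨i, hi⟩ := (mem_powers_iff_mem_zpowers (x := g) (y := Units.mk0 x hx)).2 (hg _)
  have hi : x = ((g ^ i : Eˣ) : E) := by
    have := congrArg (Units.val) hi
    simpa using this.symm
  have h1 : x ^ ((Fintype.card E - 1) / p) = 1 ↔ χ x = 1 := by
    have hχx : χ x = 1 ↔ p ∣ i := by
      rw [hi, Units.val_pow_eq_pow_val, map_pow, ← orderOf_dvd_iff_pow_eq_one, hχo]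
    have hxN : ∀ n : ℕ, x ^ n = 1 ↔ Fintype.card E - 1 ∣ i * n := fun n => by
      rw [hi, ← Units.val_pow_eq_pow_val, ← pow_mul, Units.val_eq_one,
        ← orderOf_dvd_iff_pow_eq_one, hgord]
    rw [hχx, hxN]
    obtain ⟨e, he⟩ := hpE
    have he0 : 0 < e := by
      have : 1 < Fintype.card E := Fintype.one_lt_card
      rcases Nat.eq_zero_or_pos e with rfl | h
      · omega
      · exact h
    rw [he, Nat.mul_div_cancel_left _ hp.pos]
    exact Nat.mul_dvd_mul_iff_right he0
  have h2 : ∀ k, (χ ^ k) x = χ x ^ k := fun k => MulChar.pow_apply_coe χ k (Units.mk0 x hx)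
  simp only [h1, h2]
  split_ifs with h
  · simp [h]
  · rw [geom_sum_eq h, ← h2 p, ← hχ, pow_orderOf_eq_one]
    simp [MulChar.one_apply (isUnit_iff_ne_zero.2 hx)]

/-- The indicator function of the elements which are not `p`-th powers. -/
def nonPower (p : ℕ) (x : E) : ℂ :=
  open Classical in if x ^ ((Fintype.card E - 1) / p) = 1 then 0 else 1

variable {ι : Type*} [Fintype ι] {v : ι → E} {P : Finset ℕ} {B : ℝ}

omit [Fintype E] in
theorem mul_pow_ne_one_of_coprime {p : ℕ} (hp : p.Prime) {χ φ : MulChar E ℂ} (hχ : orderOf χ = p)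
    {n : ℕ} (hn : ¬ p ∣ n) (hφ : φ ^ n = 1) {k : ℕ} (hk : ¬ p ∣ k) : φ * χ ^ k ≠ 1 := by
  intro h
  have h1 : χ ^ (k * n) = 1 := by
    have h2 := congrArg (· ^ n) h
    simpa [mul_pow, hφ, ← pow_mul] using h2
  rw [← orderOf_dvd_iff_pow_eq_one, hχ, hp.dvd_mul] at h1
  exact h1.elim hk hn

theorem prime_not_dvd_prod_sdiff (hP : ∀ p ∈ P, p.Prime) {T : Finset ℕ} {p : ℕ} (hpP : p ∈ P)
    (hpT : p ∈ T) : ¬ p ∣ ∏ r ∈ P \ T, r := by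
  rw [(hP p hpP).prime.dvd_finsetProd_iff]
  rintro ⟨r, hr, hpr⟩
  rw [Finset.mem_sdiff] at hr
  exact hr.2 (((Nat.prime_dvd_prime_iff_eq (hP p hpP) (hP r hr.1)).1 hpr) ▸ hpT)

theorem sum_mul_nonPower {p : ℕ} (hp : p.Prime) {χ : MulChar E ℂ}
    (hχ : ∀ x : E, x ≠ 0 → ∑ k ∈ Finset.range p, (χ ^ k) x =
      open Classical in if x ^ ((Fintype.card E - 1) / p) = 1 then (p : ℂ) else 0)
    (hv : ∀ i, v i ≠ 0) (F : ι → ℂ) :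
    ∑ i, F i * (1 - nonPower p (v i)) = (1 / p : ℝ) * ∑ i, F i +
      (1 / p : ℝ) * ∑ k ∈ Finset.Ico 1 p, ∑ i, (χ ^ k) (v i) * F i := by
  rw [Finset.sum_comm, ← mul_add, ← Finset.sum_add_distrib, Finset.mul_sum]
  refine Finset.sum_congr rfl fun i _ => ?_
  have hp0 : (p : ℂ) ≠ 0 := by exact_mod_cast hp.ne_zero
  have h := hχ (v i) (hv i)
  rw [Finset.range_eq_Ico, Finset.sum_eq_sum_Ico_succ_bot hp.pos, pow_zero,
    MulChar.one_apply (isUnit_iff_ne_zero.2 (hv i))] at h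
  rw [← Finset.sum_mul]
  have h2 : ∑ k ∈ Finset.Ico 1 p, (χ ^ k) (v i) = p * (1 - nonPower p (v i)) - 1 := by
    rw [nonPower]
    split_ifs at h ⊢ <;> linear_combination h
  rw [h2]
  push_cast
  field_simp
  ring

omit [Fintype E] in
theorem norm_sum_le_of_forall {p : ℕ} (hp : p.Prime) {χ : MulChar E ℂ} {F : ι → ℂ} {b : ℝ}
    (h : ∀ k ∈ Finset.Ico 1 p, ‖∑ i, (χ ^ k) (v i) * F i‖ ≤ b) :
    ‖((1 / p : ℝ) : ℂ) * ∑ k ∈ Finset.Ico 1 p, ∑ i, (χ ^ k) (v i) * F i‖ ≤ (1 - 1 / p) * b := by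
  have hp0 : (0 : ℝ) < p := by exact_mod_cast hp.pos
  rw [norm_mul, Complex.norm_real, Real.norm_of_nonneg (by positivity)]
  have h1 := norm_sum_le_of_le _ h
  rw [Finset.sum_const, Nat.card_Ico, nsmul_eq_mul, Nat.cast_sub hp.one_le, Nat.cast_one] at h1
  calc _ ≤ 1 / (p : ℝ) * ((p - 1) * b) := by gcongr
    _ = _ := by field_simp

theorem norm_sum_mulChar_mul_nonPower_le (hP : ∀ p ∈ P, p.Prime ∧ p ∣ Fintype.card E - 1)
    (hv : ∀ i, v i ≠ 0)
    (hB : ∀ ψ : MulChar E ℂ, ψ ≠ 1 → ψ ^ (∏ p ∈ P, p) = 1 → ‖∑ i, ψ (v i)‖ ≤ B)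
    {T : Finset ℕ} (hT : T ⊆ P) {φ : MulChar E ℂ} (hφ : φ ^ (∏ p ∈ P \ T, p) = 1) :
    (φ ≠ 1 → ‖∑ i, φ (v i) * ∏ p ∈ T, nonPower p (v i)‖ ≤
      B * (∏ p ∈ T, (1 - 1 / (p : ℝ))) * 2 ^ T.card) ∧
    (φ = 1 → ‖∑ i, φ (v i) * ∏ p ∈ T, nonPower p (v i) -
        ((Fintype.card ι * ∏ p ∈ T, (1 - 1 / (p : ℝ)) : ℝ) : ℂ)‖ ≤
      B * (∏ p ∈ T, (1 - 1 / (p : ℝ))) * (2 ^ T.card - 1)) := by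
  classical
  induction T using Finset.induction_on generalizing φ with
  | empty =>
    rw [Finset.sdiff_empty] at hφ
    simp only [Finset.prod_empty, mul_one, Finset.card_empty, pow_zero, sub_self, mul_zero]
    refine ⟨fun h => hB φ h hφ, ?_⟩
    rintro rfl
    simp [MulChar.one_apply (isUnit_iff_ne_zero.2 (hv _))]
  | insert p T hpT ih =>
    have hTP : T ⊆ P := (Finset.subset_insert p T).trans hT
    have hpP : p ∈ P := hT (Finset.mem_insert_self p T)
    obtain ⟨hp, hpE⟩ := hP p hpP
    obtain ⟨χ, hχo, hχ⟩ := exists_mulChar_sum_pow hp hpE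
    have hprod : ∏ r ∈ P \ T, r = p * ∏ r ∈ P \ insert p T, r := by
      rw [Finset.sdiff_insert, Finset.mul_prod_erase _ (fun r => r)]
      exact Finset.mem_sdiff.2 ⟨hpP, hpT⟩
    have hpn := prime_not_dvd_prod_sdiff (fun r hr => (hP r hr).1) hpP (Finset.mem_insert_self p T)
    have hφ' : φ ^ (∏ r ∈ P \ T, r) = 1 := by rw [hprod, mul_comm, pow_mul, hφ, one_pow]
    set θ := ∏ p ∈ T, (1 - 1 / (p : ℝ)) with hθ
    have hk : ∀ k ∈ Finset.Ico 1 p, ‖∑ i, (χ ^ k) (v i) *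
        (φ (v i) * ∏ p ∈ T, nonPower p (v i))‖ ≤ B * θ * 2 ^ T.card := by
      intro k hk
      rw [Finset.mem_Ico] at hk
      have hne := mul_pow_ne_one_of_coprime hp hχo hpn hφ
        (fun h => absurd (Nat.le_of_dvd hk.1 h) (not_le.2 hk.2))
      have hpow : (φ * χ ^ k) ^ (∏ r ∈ P \ T, r) = 1 := by
        rw [mul_pow, hφ', one_mul, hprod, ← pow_mul, mul_left_comm, pow_mul, ← hχo,
          pow_orderOf_eq_one, one_pow]
      refine le_trans (le_of_eq ?_) ((ih hTP hpow).1 hne)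
      congr 1
      refine Finset.sum_congr rfl fun i _ => ?_
      rw [MulChar.mul_apply]
      ring
    have hbound := norm_sum_le_of_forall hp hk
    have hsplit := sum_mul_nonPower hp hχ hv fun i => φ (v i) * ∏ p ∈ T, nonPower p (v i)
    set Y := ((1 / p : ℝ) : ℂ) * ∑ k ∈ Finset.Ico 1 p, ∑ i, (χ ^ k) (v i) *
        (φ (v i) * ∏ p ∈ T, nonPower p (v i)) with hY
    have hW : ∑ i, φ (v i) * ∏ r ∈ insert p T, nonPower r (v i) =
        ((1 - 1 / p : ℝ) : ℂ) * ∑ i, φ (v i) * ∏ r ∈ T, nonPower r (v i) - Y := by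
      have h1 : ∑ i, φ (v i) * ∏ r ∈ insert p T, nonPower r (v i) =
          ∑ i, φ (v i) * ∏ r ∈ T, nonPower r (v i) -
          ∑ i, (φ (v i) * ∏ r ∈ T, nonPower r (v i)) * (1 - nonPower p (v i)) := by
        rw [← Finset.sum_sub_distrib]
        refine Finset.sum_congr rfl fun i _ => ?_
        rw [Finset.prod_insert hpT]
        ring
      rw [h1, hsplit]
      push_cast
      ring
    have hc : (0 : ℝ) ≤ 1 - 1 / p := by
      have : (1 : ℝ) ≤ p := by exact_mod_cast hp.one_le
      rw [sub_nonneg, div_le_one (by linarith)]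
      exact this
    rw [hW, Finset.prod_insert hpT, Finset.card_insert_of_notMem hpT, ← hθ]
    constructor
    · intro h
      refine (norm_sub_le _ _).trans ?_
      rw [norm_mul, Complex.norm_real, Real.norm_of_nonneg hc]
      have := mul_le_mul_of_nonneg_left ((ih hTP hφ').1 h) hc
      rw [pow_succ]
      linarith
    · intro h
      have := mul_le_mul_of_nonneg_left ((ih hTP hφ').2 h) hc
      set S := ∑ i, φ (v i) * ∏ r ∈ T, nonPower r (v i)
      have h2 : ((1 - 1 / p : ℝ) : ℂ) * S - Y -
          ((Fintype.card ι * ((1 - 1 / p) * θ) : ℝ) : ℂ) =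
          ((1 - 1 / p : ℝ) : ℂ) * (S - ((Fintype.card ι * θ : ℝ) : ℂ)) - Y := by
        push_cast; ring
      rw [h2]
      refine (norm_sub_le _ _).trans ?_
      rw [norm_mul, Complex.norm_real, Real.norm_of_nonneg hc]
      rw [pow_succ]
      linarith

theorem exists_forall_pow_ne_one {T U : Finset ℕ} (hTU : Disjoint T U)
    (hP : ∀ p ∈ T ∪ U, p.Prime ∧ p ∣ Fintype.card E - 1) (hv : ∀ i, v i ≠ 0)
    (hB : ∀ ψ : MulChar E ℂ, ψ ≠ 1 → ψ ^ (∏ p ∈ T ∪ U, p) = 1 → ‖∑ i, ψ (v i)‖ ≤ B)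
    {δ : ℝ} (hδ : δ = 1 - ∑ r ∈ U, 1 / (r : ℝ)) (hδ0 : 0 ≤ δ)
    (h : B * (2 ^ T.card * (U.card - 1 + 2 * δ) - δ) < Fintype.card ι * δ) :
    ∃ i, ∀ p ∈ T ∪ U, v i ^ ((Fintype.card E - 1) / p) ≠ 1 := by
  classical
  by_contra! hcon
  have hTs : T ⊆ T ∪ U := Finset.subset_union_left
  set θ := ∏ p ∈ T, (1 - 1 / (p : ℝ)) with hθ
  have hθ0 : 0 < θ := Finset.prod_pos fun p hp => by
    have : (1 : ℝ) < p := by exact_mod_cast (hP p (hTs hp)).1.one_lt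
    rw [sub_pos, div_lt_one (by linarith)]
    exact this
  set good : ι → ℝ := fun i => ∏ p ∈ T, if v i ^ ((Fintype.card E - 1) / p) = 1 then 0 else 1
    with hgood
  have hgoodC : ∀ i, (good i : ℂ) = ∏ p ∈ T, nonPower p (v i) := fun i => by
    rw [hgood]
    push_cast
    refine Finset.prod_congr rfl fun p _ => ?_
    rw [nonPower]
    split_ifs <;> simp
  have hgood0 : ∀ i, 0 ≤ good i := fun i => Finset.prod_nonneg fun p _ => by split_ifs <;> simp
  set bad : ℕ → ι → ℝ := fun r i => if v i ^ ((Fintype.card E - 1) / r) = 1 then 1 else 0 with hbad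
  have hbadC : ∀ r i, (bad r i : ℂ) = 1 - nonPower r (v i) := fun r i => by
    rw [hbad, nonPower]
    dsimp only
    split_ifs <;> simp
  have hbad0 : ∀ r i, 0 ≤ bad r i := fun r i => by rw [hbad]; dsimp only; split_ifs <;> simp
  set A : ℝ := ∑ i, good i with hA
  have hA1 : Fintype.card ι * θ - B * θ * (2 ^ T.card - 1) ≤ A := by
    have h1 := (norm_sum_mulChar_mul_nonPower_le hP hv hB hTs (φ := 1) (one_pow _)).2 rfl
    rw [Finset.sum_congr rfl fun i _ => by
      rw [MulChar.one_apply (isUnit_iff_ne_zero.2 (hv i)), one_mul, ← hgoodC], ← Complex.ofReal_sum,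
      ← Complex.ofReal_sub, Complex.norm_real, Real.norm_eq_abs] at h1
    linarith [(abs_le.1 h1).1]
  have hr : ∀ r ∈ U, ∑ i, good i * bad r i ≤ 1 / r * A + (1 - 1 / r) * (B * θ * 2 ^ T.card) := by
    intro r hr
    have hrP : r ∈ T ∪ U := Finset.mem_union_right _ hr
    obtain ⟨hrp, hrE⟩ := hP r hrP
    obtain ⟨χ, hχo, hχ⟩ := exists_mulChar_sum_pow hrp hrE
    have hk : ∀ k ∈ Finset.Ico 1 r, ‖∑ i, (χ ^ k) (v i) * (good i : ℂ)‖ ≤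
        B * θ * 2 ^ T.card := by
      intro k hk
      rw [Finset.mem_Ico] at hk
      have hne : χ ^ k ≠ 1 := pow_ne_one_of_lt_orderOf (by omega) (hχo ▸ hk.2)
      have hdvd : r ∣ ∏ p ∈ (T ∪ U) \ T, p := Finset.dvd_prod_of_mem (fun p => p)
        (Finset.mem_sdiff.2 ⟨hrP, Finset.disjoint_right.1 hTU hr⟩)
      have hpow : (χ ^ k) ^ (∏ p ∈ (T ∪ U) \ T, p) = 1 := by
        have h1 : χ ^ (∏ p ∈ (T ∪ U) \ T, p) = 1 :=
          orderOf_dvd_iff_pow_eq_one.1 (by rw [hχo]; exact hdvd)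
        rw [pow_right_comm, h1, one_pow]
      have := (norm_sum_mulChar_mul_nonPower_le hP hv hB hTs hpow).1 hne
      simpa only [hgoodC] using this
    have hb := norm_sum_le_of_forall hrp hk
    have hs := sum_mul_nonPower hrp hχ hv fun i => (good i : ℂ)
    have hs' : ((∑ i, good i * bad r i - 1 / r * A : ℝ) : ℂ) =
        ((1 / r : ℝ) : ℂ) * ∑ k ∈ Finset.Ico 1 r, ∑ i, (χ ^ k) (v i) * (good i : ℂ) := by
      rw [← sub_eq_iff_eq_add'] at hs
      rw [← hs, hA]
      push_cast
      simp only [hbadC]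
    rw [← hs', Complex.norm_real, Real.norm_eq_abs] at hb
    linarith [(abs_le.1 hb).2]
  have hcover : A ≤ ∑ r ∈ U, ∑ i, good i * bad r i := by
    rw [Finset.sum_comm, hA]
    refine Finset.sum_le_sum fun i _ => ?_
    rw [← Finset.mul_sum]
    obtain ⟨p, hp, hpi⟩ := hcon i
    rcases Finset.mem_union.1 hp with hp | hp
    · rw [show good i = 0 from Finset.prod_eq_zero hp (if_pos hpi), zero_mul]
    · have h1 : 1 ≤ ∑ r ∈ U, bad r i := by
        refine le_trans (le_of_eq ?_)
          (Finset.single_le_sum (f := fun r => bad r i) (fun r _ => hbad0 r i) hp)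
        simp [hbad, hpi]
      nlinarith [hgood0 i]
  have hsum := Finset.sum_le_sum hr
  rw [Finset.sum_add_distrib, ← Finset.sum_mul, ← Finset.sum_mul, Finset.sum_sub_distrib,
    Finset.sum_const, nsmul_eq_mul, mul_one, show ∑ r ∈ U, 1 / (r : ℝ) = 1 - δ by rw [hδ]; ring]
    at hsum
  have h2 : A * δ ≤ (U.card - 1 + δ) * (B * θ * 2 ^ T.card) := by linarith
  have h3 := mul_le_mul_of_nonneg_right hA1 hδ0
  have h4 : θ * (Fintype.card ι * δ) ≤ θ * (B * (2 ^ T.card * (U.card - 1 + 2 * δ) - δ)) := by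
    linarith
  exact absurd (le_of_mul_le_mul_left h4 hθ0) (not_le.2 h)

end Sieve

section Existence

variable {K E : Type*} [Field K] [Fintype K] [Field E] [Fintype E] [Algebra K E]

omit [Fintype E] in
theorem mulChar_algebraMap_eq_one {ψ : MulChar E ℂ} {n : ℕ} (hψ : ψ ^ n = 1)
    (hn : n.Coprime (Fintype.card K - 1)) {c : K} (hc : c ≠ 0) : ψ (algebraMap K E c) = 1 := by
  have hc' : algebraMap K E c ≠ 0 := by simpa using hc
  have h1 : ψ (algebraMap K E c) ^ n = 1 := by
    have := MulChar.pow_apply_coe ψ n (Units.mk0 _ hc')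
    rw [hψ, MulChar.one_apply_coe] at this
    exact this.symm
  have h2 : ψ (algebraMap K E c) ^ (Fintype.card K - 1) = 1 := by
    rw [← map_pow, ← map_pow, FiniteField.pow_card_sub_one_eq_one c hc, map_one, map_one]
  have := Nat.dvd_gcd (orderOf_dvd_of_pow_eq_one h1) (orderOf_dvd_of_pow_eq_one h2)
  rwa [hn.gcd_eq_one, Nat.dvd_one, orderOf_eq_one_iff] at this

theorem exists_forall_add_pow_ne_one (hE : Module.finrank K E = 4) {b : E}
    (hb : (minpoly K b).natDegree = 4) {T U : Finset ℕ} (hTU : Disjoint T U)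
    (hne : (T ∪ U).Nonempty)
    (hP : ∀ p ∈ T ∪ U, p.Prime ∧ p ∣ Fintype.card E - 1 ∧ ¬ p ∣ Fintype.card K - 1)
    {δ : ℝ} (hδ : δ = 1 - ∑ r ∈ U, 1 / (r : ℝ)) (hδ0 : 0 ≤ δ)
    (h : 2 * √(Fintype.card K) * (2 ^ T.card * (U.card - 1 + 2 * δ) - δ) <
      (Fintype.card K + 1) * δ) :
    ∃ a : K, ∀ p ∈ T ∪ U, (b + algebraMap K E a) ^ ((Fintype.card E - 1) / p) ≠ 1 := by
  classical
  have hcop : (∏ p ∈ T ∪ U, p).Coprime (Fintype.card K - 1) := Nat.Coprime.prod_left fun p hp =>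
    ((hP p hp).1.coprime_iff_not_dvd).2 (hP p hp).2.2
  set v : Option K → E := fun o => o.elim 1 fun a => b + algebraMap K E a with hv
  have hv0 : ∀ i, v i ≠ 0 := by
    rintro (_ | a) h0
    · simp [hv] at h0
    · have hba : b = algebraMap K E (-a) := by
        rw [map_neg]
        exact eq_neg_of_add_eq_zero_left h0
      rw [hba, minpoly.eq_X_sub_C, natDegree_X_sub_C] at hb
      omega
  obtain ⟨i, hi⟩ := exists_forall_pow_ne_one (v := v) (B := 2 * √(Fintype.card K)) hTU
    (fun p hp => ⟨(hP p hp).1, (hP p hp).2.1⟩) hv0 (fun ψ hψ hψP => by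
      rw [Fintype.sum_option]
      simpa [hv] using norm_one_add_sum_mulChar_le hψ
        (fun c hc => mulChar_algebraMap_eq_one hψP hcop hc) hE hb) hδ hδ0
    (by rw [Fintype.card_option]; exact_mod_cast h)
  obtain ⟨p, hp⟩ := hne
  rcases i with _ | a
  · exact absurd (one_pow _) (hi p hp)
  · exact ⟨a, hi⟩

end Existence

section Normality

variable {E : Type*} [Field E] {q : ℕ}

theorem isKNormal_iff {n k : ℕ} {α : E} : IsKNormal q n k α ↔ ∃ d : E[X], d ∣ X ^ n - 1 ∧
    d ∣ gPoly q n α ∧ (∃ s t, d = s * (X ^ n - 1) + t * gPoly q n α) ∧ d.natDegree = k := by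
  let : DecidableEq E[X] := Classical.decEq _
  have h1 := @EuclideanDomain.gcd_dvd_left E[X] _ _ (X ^ n - 1) (gPoly q n α)
  have h2 := @EuclideanDomain.gcd_dvd_right E[X] _ _ (X ^ n - 1) (gPoly q n α)
  constructor
  · intro h
    exact ⟨_, h1, h2, ⟨_, _, by
      rw [EuclideanDomain.gcd_eq_gcd_ab, mul_comm, mul_comm (gPoly q n α)]⟩, h⟩
  · rintro ⟨d, hd1, hd2, ⟨s, t, hst⟩, hd⟩
    have hassoc := associated_of_dvd_dvd (EuclideanDomain.dvd_gcd hd1 hd2)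
      (hst ▸ dvd_add (h1.mul_left s) (h2.mul_left t))
    rw [IsKNormal, ← hd]
    exact (natDegree_eq_of_degree_eq (degree_eq_degree_of_associated hassoc)).symm

theorem gPoly_four {φ : E →+* E} (hφ : ∀ x, φ x = x ^ q) (α : E) : gPoly q 4 α =
    C α * X ^ 3 + C (φ α) * X ^ 2 + C (φ (φ α)) * X + C (φ (φ (φ α))) := by
  simp only [gPoly, Finset.sum_range_succ, Finset.sum_range_zero, hφ, ← pow_mul]
  simp only [pow_zero, pow_one, Nat.sub_zero, Nat.sub_self]
  ring_nf

theorem isKNormal_add {φ : E →+* E} (hφ : ∀ x, φ x = x ^ q) {i ζ u w : E} (hi : i ^ 2 = -1)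
    (hφi : φ i = i) (hi1 : i ≠ 1) (hζ : ζ ^ 4 = 1) (hφζ : φ ζ = ζ) (hu : φ u = ζ * u) (hu0 : u ≠ 0)
    (hw : φ w = ζ * i * w) (hw0 : w ≠ 0) : IsKNormal q 4 2 (u + w) := by
  have hζ0 : ζ ≠ 0 := by rintro rfl; simp at hζ
  set R : E[X] := C u * (X - C (ζ * i)) + C w * (X - C ζ) with hR
  have hg : gPoly q 4 (u + w) = (X + C ζ) * (X + C (ζ * i)) * R := by
    rw [gPoly_four hφ, hR]
    simp only [map_add, map_mul, hu, hw, hφi, hφζ]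
    have h2 : (C i : E[X]) ^ 2 = -1 := by rw [← C_pow, hi]; simp
    linear_combination
      (C u * C ζ ^ 2 * X + C u * C ζ ^ 3 + C w * C ζ ^ 2 * X + C w * C ζ ^ 3 * C i) * h2
  have hX : (X : E[X]) ^ 4 - 1 =
      (X + C ζ) * (X + C (ζ * i)) * ((X - C ζ) * (X - C (ζ * i))) := by
    have h2 : (C i : E[X]) ^ 2 = -1 := by rw [← C_pow, hi]; simp
    have h4 : (C ζ : E[X]) ^ 4 = 1 := by rw [← C_pow, hζ]; simp
    rw [C_mul]
    linear_combination h4 + (X ^ 2 * C ζ ^ 2 - C ζ ^ 4) * h2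
  have hne : (X + C ζ) * (X + C (ζ * i)) ≠ 0 := mul_ne_zero (X_add_C_ne_zero _) (X_add_C_ne_zero _)
  have hcop : IsCoprime ((X - C ζ) * (X - C (ζ * i))) R := by
    have key : ∀ c : E, R.eval c ≠ 0 → IsCoprime (X - C c) R := fun c hc =>
      (irreducible_X_sub_C c).coprime_iff_not_dvd.2 fun h => hc (dvd_iff_isRoot.1 h)
    refine IsCoprime.mul_left (key _ ?_) (key _ ?_)
    · simp only [hR, eval_add, eval_mul, eval_C, eval_sub, eval_X, sub_self, mul_zero, add_zero]
      refine mul_ne_zero hu0 ?_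
      rw [← mul_one_sub]
      exact mul_ne_zero hζ0 (sub_ne_zero.2 hi1.symm)
    · simp only [hR, eval_add, eval_mul, eval_C, eval_sub, eval_X, sub_self, mul_zero, zero_add]
      refine mul_ne_zero hw0 ?_
      rw [← mul_sub_one]
      exact mul_ne_zero hζ0 (sub_ne_zero.2 hi1)
  obtain ⟨s, t, hst⟩ := hcop
  refine isKNormal_iff.2 ⟨_, hX ▸ dvd_mul_right _ _, hg ▸ dvd_mul_right _ _, ⟨s, t, ?_⟩, ?_⟩
  · rw [hX, hg]
    linear_combination (-(X + C ζ) * (X + C (ζ * i))) * hst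
  · rw [natDegree_mul (X_add_C_ne_zero _) (X_add_C_ne_zero _), natDegree_X_add_C,
      natDegree_X_add_C]

theorem natDegree_X_sq_sub_one : (X ^ 2 - 1 : E[X]).natDegree = 2 := by
  simpa using natDegree_X_pow_sub_C (n := 2) (r := (1 : E))

theorem not_X_sq_sub_one_dvd_gPoly {φ : E →+* E} (hφ : ∀ x, φ x = x ^ q) {α : E}
    (hα : α + φ (φ α) ≠ 0) : ¬ (X ^ 2 - 1 : E[X]) ∣ gPoly q 4 α := by
  intro h
  have h1 : gPoly q 4 α = (X ^ 2 - 1) * (C α * X + C (φ α)) +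
      (C (α + φ (φ α)) * X + C (φ α + φ (φ (φ α)))) := by
    rw [gPoly_four hφ, C_add, C_add]
    ring
  rw [h1, dvd_add_right (dvd_mul_right _ _)] at h
  have h2 := eq_zero_of_dvd_of_natDegree_lt h (lt_of_le_of_lt natDegree_linear_le (by
    rw [natDegree_X_sq_sub_one]
    norm_num))
  have h3 := congrArg (coeff · 1) h2
  simp only [coeff_add, coeff_C_mul, coeff_X_one, coeff_C_succ, coeff_zero] at h3
  exact hα (by simpa using h3)

theorem not_isKNormal_of_even [CharP E 2] {φ : E →+* E} (hφ : ∀ x, φ x = x ^ q) {α : E}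
    (hα : α + φ (φ α) ≠ 0) : ¬ IsKNormal q 4 2 α := by
  intro h
  obtain ⟨d, hdX, hdg, -, h⟩ := isKNormal_iff.1 h
  have h2 : (X : E[X]) ^ 2 - 1 = (X - C 1) ^ 2 := by
    rw [sub_pow_char_of_commute (p := 2) (Commute.all _ _), C_1, one_pow]
  have h4 : (X : E[X]) ^ 4 - 1 = (X - C 1) ^ 4 := by
    rw [show (4 : ℕ) = 2 * 2 from rfl, pow_mul (X - C 1), ← h2, sub_pow_char_of_commute (p := 2) (Commute.all _ _), one_pow, pow_mul]
  rw [h4] at hdX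
  obtain ⟨i, -, hi⟩ := (dvd_prime_pow (prime_X_sub_C 1) 4).1 hdX
  have hi2 : i = 2 := by
    rw [natDegree_eq_of_degree_eq (degree_eq_degree_of_associated hi), natDegree_pow,
      natDegree_X_sub_C, mul_one] at h
    exact h
  refine not_X_sq_sub_one_dvd_gPoly hφ hα ?_
  rw [h2, ← hi2]
  exact hi.symm.dvd.trans hdg

theorem not_isKNormal_of_map_eq_neg {φ : E →+* E} (hφ : ∀ x, φ x = x ^ q) {α i : E}
    (hα : α + φ (φ α) ≠ 0) (hα' : φ (φ α) - α ≠ 0) (hφα : φ (φ (φ (φ α))) = α) (h20 : (2 : E) ≠ 0)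
    (hi : i ^ 2 = -1) (hφi : φ i = -i) : ¬ IsKNormal q 4 2 α := by
  intro h
  obtain ⟨d, hdX, hdg, -, h⟩ := isKNormal_iff.1 h
  have key : ∀ j : E, j ^ 2 = -1 → φ j = -j → IsCoprime d (X - C j) := by
    intro j hj hφj
    refine ((irreducible_X_sub_C j).coprime_iff_not_dvd.2 fun hdj => ?_).symm
    have h0 : (gPoly q 4 α).eval j = 0 :=
      dvd_iff_isRoot.1 (hdj.trans hdg)
    rw [gPoly_four hφ] at h0
    simp only [eval_add, eval_mul, eval_C, eval_pow, eval_X] at h0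
    have h1 : φ (φ (φ α) - α) = -j * (φ (φ α) - α) := by
      rw [map_sub]
      linear_combination h0 - (α * j + φ α) * hj
    have h2 := congrArg φ h1
    have h3 : φ (φ (φ (φ α) - α)) = α - φ (φ α) := by rw [map_sub, map_sub, hφα]
    rw [h3, map_mul, h1, map_neg, hφj, neg_neg] at h2
    refine hα' ((mul_eq_zero.1 (?_ : (2 : E) * _ = 0)).resolve_left h20)
    linear_combination -h2 + (φ (φ α) - α) * hj
  have hcop : IsCoprime d (X ^ 2 + 1) := by
    have h1 : (X ^ 2 + 1 : E[X]) = (X - C i) * (X - C (-i)) := by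
      have : (C i : E[X]) ^ 2 = -1 := by rw [← C_pow, hi]; simp
      rw [C_neg]
      linear_combination this
    rw [h1]
    exact (key i hi hφi).mul_right (key (-i) (by rw [neg_sq, hi]) (by rw [map_neg, hφi]))
  have hdvd : d ∣ X ^ 2 - 1 := by
    refine hcop.dvd_of_dvd_mul_right ?_
    rw [show (X ^ 2 - 1 : E[X]) * (X ^ 2 + 1) = X ^ 4 - 1 by ring]
    exact hdX
  refine not_X_sq_sub_one_dvd_gPoly hφ hα ?_
  have h0 : (X ^ 2 - 1 : E[X]) ≠ 0 := fun h0 => by simpa [h0] using natDegree_X_sq_sub_one (E := E)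
  exact (associated_of_dvd_of_natDegree_le hdvd h0 (by rw [natDegree_X_sq_sub_one, h])).symm.dvd.trans
    hdg

end Normality

section Reduction

variable {E : Type*} [Field E] [Fintype E] {q : ℕ}

theorem charP_of_card_eq_pow {p n : ℕ} (hp : p.Prime) (hE : Fintype.card E = p ^ n) : CharP E p := by
  obtain ⟨r, hr⟩ := CharP.exists E
  obtain ⟨k, hrp, hk⟩ := FiniteField.card E r
  have h : r ∣ p ^ n := by
    rw [← hE, hk]
    exact dvd_pow_self r k.ne_zero
  rwa [(Nat.prime_dvd_prime_iff_eq hrp hp).1 (hrp.dvd_of_dvd_pow h)] at hr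

theorem exists_ringHom_pow (hq : IsPrimePow q) (hE : Fintype.card E = q ^ 4) :
    ∃ φ : E →+* E, ∀ x, φ x = x ^ q := by
  obtain ⟨p, m, hp, -, rfl⟩ := hq
  have hp' : p.Prime := hp.nat_prime
  have : Fact p.Prime := ⟨hp'⟩
  have : CharP E p := charP_of_card_eq_pow hp' (by rw [hE, ← pow_mul])
  exact ⟨iterateFrobenius E p m, fun x => iterateFrobenius_def p m x⟩

theorem IsPrimitiveElem.pow_ne_one {α : E} (hα : IsPrimitiveElem α) {n : ℕ} (hn : 0 < n)
    (hnE : n < Fintype.card E - 1) : α ^ n ≠ 1 :=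
  pow_ne_one_of_lt_orderOf hn.ne' (lt_of_lt_of_eq hnE hα.symm)

theorem IsPrimitiveElem.pow_two_mul_ne {α : E} (hα : IsPrimitiveElem α) (hq : 2 ≤ q)
    (hE : Fintype.card E = q ^ 4) : α ^ (2 * q ^ 2) ≠ α ^ 2 := by
  intro h
  have hα0 : α ≠ 0 := by
    rintro rfl
    have h1 : orderOf (0 : E) = Fintype.card E - 1 := hα
    have h2 : 2 ^ 4 ≤ q ^ 4 := Nat.pow_le_pow_left hq 4
    rw [orderOf_zero] at h1
    omega
  have h4 : 2 ^ 2 ≤ q ^ 2 := Nat.pow_le_pow_left hq 2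
  refine hα.pow_ne_one (n := 2 * (q ^ 2 - 1)) (by omega) ?_ ?_
  · rw [hE]
    zify [show 1 ≤ q ^ 2 by omega, show 1 ≤ q ^ 4 from Nat.one_le_pow _ _ (by omega)]
    zify at h4
    nlinarith
  · refine mul_right_cancel₀ (pow_ne_zero 2 hα0) ?_
    rw [← pow_add, one_mul, ← h]
    congr 1
    omega

theorem mod_four_eq_one_of_isKNormal (hq : IsPrimePow q) (hE : Fintype.card E = q ^ 4) {α : E}
    (hα : IsPrimitiveElem α) (hα2 : IsKNormal q 4 2 α) : q % 4 = 1 := by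
  obtain ⟨φ, hφ⟩ := exists_ringHom_pow hq hE
  have hne := hα.pow_two_mul_ne hq.two_le hE
  have hφφ : φ (φ α) = α ^ q ^ 2 := by rw [hφ, hφ, ← pow_mul, sq]
  have h1 : α + φ (φ α) ≠ 0 := fun h => hne (by
    rw [mul_comm, pow_mul, ← hφφ, eq_neg_of_add_eq_zero_right h, neg_sq])
  have h2 : φ (φ α) - α ≠ 0 := fun h => hne (by
    rw [mul_comm, pow_mul, ← hφφ, eq_of_sub_eq_zero h])
  have hφ4 : φ (φ (φ (φ α))) = α := by
    simp only [hφ, ← pow_mul]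
    rw [show q * q * q * q = q ^ 4 by ring, ← hE, FiniteField.pow_card]
  by_contra hq1
  rcases Nat.even_or_odd q with hev | hodd
  · have : CharP E 2 := by
      obtain ⟨p, m, hp, hm, rfl⟩ := hq
      have hp2 : p = 2 := ((Nat.prime_dvd_prime_iff_eq Nat.prime_two hp.nat_prime).1
        (Nat.prime_two.dvd_of_dvd_pow hev.two_dvd)).symm
      subst hp2
      exact charP_of_card_eq_pow Nat.prime_two (by rw [hE, ← pow_mul])
    exact not_isKNormal_of_even hφ h1 hα2
  · have hq3 : q % 4 = 3 := by
      have := Nat.odd_iff.1 hodd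
      omega
    have hE4 : Fintype.card E % 4 = 1 := by rw [hE, Nat.pow_mod, hq3]
    obtain ⟨i, hi⟩ := FiniteField.isSquare_neg_one_iff.2 (show Fintype.card E % 4 ≠ 3 by omega)
    have hi2 : i ^ 2 = -1 := by rw [sq, hi]
    have h20 : (2 : E) ≠ 0 := Ring.two_ne_zero (fun h => by
      have := FiniteField.even_card_of_char_two h
      omega)
    refine not_isKNormal_of_map_eq_neg hφ h1 h2 hφ4 h20 hi2 ?_ hα2
    rw [hφ, show q = 2 * (2 * (q / 4) + 1) + 1 by omega, pow_succ, pow_mul, hi2, pow_succ, pow_mul]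
    simp

theorem exists_isPrimitiveElem_mul {M : ℕ} (hM : M ∣ Fintype.card E - 1) {x : E} (hx : x ≠ 0)
    (h : ∀ r : ℕ, r.Prime → r ∣ M → x ^ ((Fintype.card E - 1) / r) ≠ 1) :
    ∃ c : E, c ^ ((Fintype.card E - 1) / M) = 1 ∧ IsPrimitiveElem (c * x) := by
  classical
  have hN : 0 < Fintype.card E - 1 := Nat.sub_pos_of_lt Fintype.one_lt_card
  set N := Fintype.card E - 1 with hNdef
  have : NeZero N := ⟨hN.ne'⟩
  obtain ⟨g, hg⟩ := IsCyclic.exists_generator (α := Eˣ)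
  have hgord : orderOf g = N := by
    rw [orderOf_eq_card_of_forall_mem_zpowers hg, Nat.card_eq_fintype_card, Fintype.card_units]
  obtain ⟨e, he⟩ := (mem_powers_iff_mem_zpowers (x := g) (y := Units.mk0 x hx)).2 (hg _)
  have he : g ^ e = Units.mk0 x hx := he
  have hpow : ∀ n, x ^ n = ((g ^ (e * n) : Eˣ) : E) := fun n => by
    rw [pow_mul, he, Units.val_pow_eq_pow_val, Units.val_mk0]
  have hcop : e.Coprime M := Nat.Coprime.symm (Nat.coprime_of_dvd fun r hr hrM hre => by
    refine h r hr hrM ?_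
    rw [hpow, Units.val_eq_one, ← orderOf_dvd_iff_pow_eq_one, hgord]
    obtain ⟨k, hk⟩ := hrM.trans hM
    rw [hk, Nat.mul_div_cancel_left _ hr.pos]
    exact Nat.mul_dvd_mul_right hre k)
  obtain ⟨v, hv⟩ := ZMod.unitsMap_surjective hM (ZMod.unitOfCoprime e hcop)
  set f := (v : ZMod N).val with hf
  have hfN : f.Coprime N := ZMod.val_coe_unit_coprime v
  have hfe : f ≡ e [MOD M] := by
    have h1 := congrArg (fun u : (ZMod M)ˣ => (u : ZMod M)) hv
    simp only [ZMod.unitsMap_val, ZMod.coe_unitOfCoprime] at h1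
    rw [← ZMod.natCast_eq_natCast_iff, ← h1, ZMod.natCast_val]
  refine ⟨((g ^ f * (g ^ e)⁻¹ : Eˣ) : E), ?_, ?_⟩
  · rw [← Units.val_pow_eq_pow_val, Units.val_eq_one, mul_pow, inv_pow, mul_inv_eq_one, ← pow_mul,
      ← pow_mul, pow_eq_pow_iff_modEq, hgord]
    have := hfe.mul_right' (N / M)
    rwa [Nat.mul_div_cancel' hM] at this
  · have h1 : ((g ^ f * (g ^ e)⁻¹ : Eˣ) : E) * x = ((g ^ f : Eˣ) : E) := by
      rw [← Units.val_mk0 hx, ← he, ← Units.val_mul, inv_mul_cancel_right]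
    rw [h1, IsPrimitiveElem, orderOf_units, orderOf_pow, hgord, Nat.Coprime.gcd_eq_one hfN.symm,
      Nat.div_one]

theorem exists_prime_ne_two_dvd (hq1 : 1 < q) (hq4 : q % 4 = 1) :
    ∃ r : ℕ, r.Prime ∧ r ≠ 2 ∧ r ∣ (q + 1) * (q ^ 2 + 1) := by
  have h := Nat.minFac_dvd ((q + 1) / 2)
  refine ⟨((q + 1) / 2).minFac, Nat.minFac_prime (by omega), fun h2 => ?_, ?_⟩
  · rw [h2] at h
    omega
  · exact (h.trans (Nat.div_dvd_of_dvd (by omega))).mul_right _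

theorem exists_isPrimitiveElem_isKNormal (hq : IsPrimePow q) (hq4 : q % 4 = 1)
    (hE : Fintype.card E = q ^ 4) {i a b : E} (hi : i ^ 2 = -1) (hb0 : b ≠ 0) (hb : b ^ q = i * b)
    (ha : a ^ q = a)
    (h : ∀ r : ℕ, r.Prime → r ≠ 2 → r ∣ (q + 1) * (q ^ 2 + 1) →
      (b + a) ^ ((q ^ 4 - 1) / r) ≠ 1) :
    ∃ α : E, IsPrimitiveElem α ∧ IsKNormal q 4 2 α := by
  obtain ⟨φ, hφ⟩ := exists_ringHom_pow hq hE
  obtain ⟨k, hk⟩ : ∃ k, q = 4 * k + 1 := ⟨q / 4, by omega⟩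
  have hk0 : 0 < k := by have := hq.two_le; omega
  have hM : (q - 1) * ((q + 1) * (q ^ 2 + 1)) = q ^ 4 - 1 := by
    zify [hq.one_lt.le, Nat.one_le_pow 4 q hq.pos]
    ring
  set m := (2 * k + 1) * (8 * k ^ 2 + 4 * k + 1) with hm
  have hMm : (q + 1) * (q ^ 2 + 1) = 4 * m := by rw [hk, hm]; ring
  have hmodd : Odd m := Odd.mul ⟨k, rfl⟩ ⟨4 * k ^ 2 + 2 * k, by ring⟩
  have hi4 : i ^ 4 = 1 := by rw [show (4 : ℕ) = 2 * 2 from rfl, pow_mul, hi]; ring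
  have h20 : (2 : E) ≠ 0 := Ring.two_ne_zero (fun h => by
    have h1 := FiniteField.even_card_of_char_two h
    rw [hE, Nat.pow_mod, show q % 2 = 1 by omega] at h1
    omega)
  have hi1 : i ≠ 1 := by
    rintro rfl
    exact h20 (by linear_combination hi)
  have hφi : φ i = i := by rw [hφ, hk, pow_succ, pow_mul, hi4, one_pow, one_mul]
  have hφb : φ b = i * b := by rw [hφ, hb]
  have hφa : φ a = a := by rw [hφ, ha]
  have hi0 : i ≠ 0 := by rintro rfl; simp at hi4
  have hbq : b ^ (q - 1) = i := by
    refine mul_right_cancel₀ hb0 ?_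
    rw [← pow_succ, Nat.sub_add_cancel hq.one_lt.le, hb]
  have hb2 : b ^ ((q ^ 4 - 1) / 2) = -1 := by
    rw [← hM, hMm, show (q - 1) * (4 * m) = 2 * ((q - 1) * (2 * m)) by ring,
      Nat.mul_div_cancel_left _ two_pos, pow_mul, hbq, pow_mul, hi, hmodd.neg_one_pow]
  have hbr : ∀ r : ℕ, r.Prime → r ≠ 2 → r ∣ (q + 1) * (q ^ 2 + 1) →
      b ^ ((q ^ 4 - 1) / r) = 1 := by
    intro r hr hr2 hrM
    rw [hMm] at hrM
    have hr4 : r.Coprime 4 := by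
      rw [show 4 = 2 ^ 2 from rfl]
      exact ((Nat.coprime_primes hr Nat.prime_two).2 hr2).pow_right 2
    obtain ⟨l, hl⟩ := hr4.dvd_of_dvd_mul_left hrM
    rw [← hM, hMm, hl, show (q - 1) * (4 * (r * l)) = r * ((q - 1) * (4 * l)) by ring,
      Nat.mul_div_cancel_left _ hr.pos, pow_mul, hbq, pow_mul, hi4, one_pow]
  have ha0 : a ≠ 0 := by
    rintro rfl
    obtain ⟨r, hr, hr2, hrM⟩ := exists_prime_ne_two_dvd hq.one_lt hq4
    exact h r hr hr2 hrM (by rw [add_zero, hbr r hr hr2 hrM])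
  have hβ0 : b + a ≠ 0 := by
    intro h0
    have h1 := congrArg φ h0
    rw [map_add, hφa, hφb, map_zero] at h1
    refine mul_ne_zero ha0 (sub_ne_zero.2 hi1) ?_
    linear_combination i * h0 - h1
  have hMN : (q + 1) * (q ^ 2 + 1) ∣ Fintype.card E - 1 := by
    rw [hE, ← hM]; exact dvd_mul_left _ _
  have hNM : (Fintype.card E - 1) / ((q + 1) * (q ^ 2 + 1)) = q - 1 := by
    rw [hE, ← hM, Nat.mul_div_cancel _ (by positivity)]
  have hfix : ∀ c : E, c ^ (q - 1) = 1 → φ c = c := fun c hc => by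
    rw [hφ, ← Nat.sub_add_cancel hq.one_lt.le, pow_succ, hc, one_mul]
  by_cases h2 : (b + a) ^ ((q ^ 4 - 1) / 2) = 1
  · obtain ⟨c, hc, hprim⟩ := exists_isPrimitiveElem_mul hMN (mul_ne_zero hb0 hβ0) (fun r hr hrM => by
      rw [hE, mul_pow]
      by_cases hr2 : r = 2
      · rw [hr2, hb2, h2, mul_one]
        intro h3
        exact h20 (by linear_combination -h3)
      · rw [hbr r hr hr2 hrM, one_mul]
        exact h r hr hr2 hrM)
    rw [hNM] at hc
    have hc0 : c ≠ 0 := by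
      rintro rfl
      rw [zero_pow (by omega)] at hc
      exact zero_ne_one hc
    refine ⟨_, hprim, ?_⟩
    rw [show c * (b * (b + a)) = c * b * a + c * b * b by ring]
    refine isKNormal_add hφ hi hφi hi1 hi4 hφi ?_ (mul_ne_zero (mul_ne_zero hc0 hb0) ha0) ?_
      (mul_ne_zero (mul_ne_zero hc0 hb0) hb0)
    · rw [map_mul, map_mul, hφa, hφb, hfix c hc]; ring
    · rw [map_mul, map_mul, hφb, hfix c hc]; ring
  · obtain ⟨c, hc, hprim⟩ := exists_isPrimitiveElem_mul hMN hβ0 (fun r hr hrM => by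
      rw [hE]
      by_cases hr2 : r = 2
      · rwa [hr2]
      · exact h r hr hr2 hrM)
    rw [hNM] at hc
    have hc0 : c ≠ 0 := by
      rintro rfl
      rw [zero_pow (by omega)] at hc
      exact zero_ne_one hc
    refine ⟨_, hprim, ?_⟩
    rw [show c * (b + a) = c * a + c * b by ring]
    refine isKNormal_add hφ hi hφi hi1 (one_pow 4) (map_one φ) ?_ (mul_ne_zero hc0 ha0) ?_
      (mul_ne_zero hc0 hb0)
    · rw [map_mul, hφa, hfix c hc]; ring
    · rw [map_mul, hφb, hfix c hc]; ring

end Reduction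

section Sieving

variable {E : Type*} [Field E] [Fintype E] {q : ℕ}

theorem exists_pow_eq_mul (hq : IsPrimePow q) (hq4 : q % 4 = 1) (hE : Fintype.card E = q ^ 4) :
    ∃ b i : E, b ≠ 0 ∧ i ^ 2 = -1 ∧ b ^ q = i * b := by
  classical
  obtain ⟨k, hk⟩ : ∃ k, q = 4 * k + 1 := ⟨q / 4, by omega⟩
  have hk0 : 0 < k := by have := hq.two_le; omega
  obtain ⟨g, hg⟩ := IsCyclic.exists_generator (α := Eˣ)
  have hgord : orderOf g = q ^ 4 - 1 := by
    rw [orderOf_eq_card_of_forall_mem_zpowers hg, Nat.card_eq_fintype_card, Fintype.card_units, hE]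
  set m := (2 * k + 1) * (8 * k ^ 2 + 4 * k + 1) with hm
  have hm0 : 0 < m := by positivity
  have hN : q ^ 4 - 1 = m * (q - 1) * 4 := by
    rw [hk, hm, Nat.add_sub_cancel, Nat.sub_eq_iff_eq_add (Nat.one_le_pow _ _ (by omega))]
    ring
  have hq0 : 0 < q - 1 := by omega
  refine ⟨g ^ m, g ^ (m * (q - 1)), pow_ne_zero _ g.ne_zero, ?_, ?_⟩
  · have h4 : ((g : E) ^ (m * (q - 1) * 2)) ^ 2 = 1 := by
      rw [← pow_mul, mul_assoc _ 2 2, show 2 * 2 = 4 from rfl, ← Units.val_pow_eq_pow_val, Units.val_eq_one,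
        ← orderOf_dvd_iff_pow_eq_one, hgord, hN]
    rw [← pow_mul]
    refine (sq_eq_one_iff.1 h4).resolve_left ?_
    rw [← Units.val_pow_eq_pow_val, Units.val_eq_one]
    refine pow_ne_one_of_lt_orderOf (by positivity) ?_
    rw [hgord, hN]
    have : 0 < m * (q - 1) := by positivity
    omega
  · rw [← pow_mul, ← pow_add, ← Nat.mul_succ, Nat.succ_eq_add_one, Nat.sub_add_cancel (by omega)]

theorem exists_algebra_card_eq (hq : IsPrimePow q) (hE : Fintype.card E = q ^ 4) :
    ∃ (K : Type) (_ : Field K) (_ : Fintype K) (_ : Algebra K E), Fintype.card K = q := by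
  obtain ⟨p, m, hp, hm, rfl⟩ := hq
  have hp' : p.Prime := hp.nat_prime
  have : Fact p.Prime := ⟨hp'⟩
  have : CharP E p := charP_of_card_eq_pow hp' (by rw [hE, ← pow_mul])
  let _ : Algebra (ZMod p) E := ZMod.algebra E p
  have hfin : Module.finrank (ZMod p) (GaloisField p m) ∣ Module.finrank (ZMod p) E := by
    have h1 := Module.card_eq_pow_finrank (K := ZMod p) (V := E)
    rw [ZMod.card, hE, ← pow_mul] at h1
    rw [GaloisField.finrank p hm.ne', ← Nat.pow_right_injective hp'.two_le h1]
    exact dvd_mul_right _ _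
  obtain ⟨f⟩ := FiniteField.nonempty_algHom_of_finrank_dvd hfin
  let _ : Fintype (GaloisField p m) := Fintype.ofFinite _
  exact ⟨GaloisField p m, inferInstance, inferInstance, f.toRingHom.toAlgebra, by
    rw [← Nat.card_eq_fintype_card, GaloisField.card p m hm.ne']⟩

theorem exists_isPrimitiveElem_isKNormal_of_sieve (hq : IsPrimePow q) (hq4 : q % 4 = 1)
    (hE : Fintype.card E = q ^ 4) {T U : Finset ℕ} (hTU : Disjoint T U)
    (hP : T ∪ U = ((q + 1) * (q ^ 2 + 1)).primeFactors.erase 2)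
    {δ : ℝ} (hδ : δ = 1 - ∑ r ∈ U, 1 / (r : ℝ)) (hδ0 : 0 ≤ δ)
    (h : 2 * √q * (2 ^ T.card * (U.card - 1 + 2 * δ) - δ) < (q + 1) * δ) :
    ∃ α : E, IsPrimitiveElem α ∧ IsKNormal q 4 2 α := by
  obtain ⟨b, i, hb0, hi, hb⟩ := exists_pow_eq_mul hq hq4 hE
  obtain ⟨K, _, _, _, hK⟩ := exists_algebra_card_eq hq hE
  have hrank : Module.finrank K E = 4 := by
    have h1 := Module.card_eq_pow_finrank (K := K) (V := E)
    rw [hK, hE] at h1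
    exact (Nat.pow_right_injective hq.two_le h1).symm
  have hM0 : (q + 1) * (q ^ 2 + 1) ≠ 0 := by positivity
  have hmem : ∀ r, r ∈ T ∪ U ↔ r ≠ 2 ∧ r.Prime ∧ r ∣ (q + 1) * (q ^ 2 + 1) := fun r => by
    rw [hP, Finset.mem_erase, Nat.mem_primeFactors_of_ne_zero hM0]
  have hM : (q - 1) * ((q + 1) * (q ^ 2 + 1)) = q ^ 4 - 1 := by
    zify [hq.one_lt.le, Nat.one_le_pow 4 q hq.pos]
    ring
  have h20 : (2 : E) ≠ 0 := Ring.two_ne_zero (fun h => by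
    have h1 := FiniteField.even_card_of_char_two h
    rw [hE, Nat.pow_mod, show q % 2 = 1 by omega] at h1
    omega)
  have hdeg : (minpoly K b).natDegree = 4 := by
    have h1 := natDegree_minpoly_dvd_finrank (K := K) b
    have h2 : ¬ (minpoly K b).natDegree ∣ 2 := by
      rw [← pow_card_pow_eq_self_iff, Nat.card_eq_fintype_card, hK, sq, pow_mul, hb, mul_pow, hb]
      intro h2
      have hiq : i ^ q = i := by
        rw [show q = 2 * (2 * (q / 4)) + 1 by omega, pow_succ, pow_mul, hi, pow_mul]
        simp
      rw [hiq] at h2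
      refine mul_ne_zero h20 hb0 ?_
      linear_combination hi * b - h2
    rw [hrank] at h1
    have h4 : (minpoly K b).natDegree ≤ 4 := Nat.le_of_dvd (by norm_num) h1
    interval_cases (minpoly K b).natDegree <;> omega
  have hne : (T ∪ U).Nonempty := by
    obtain ⟨r, hr, hr2, hrM⟩ := exists_prime_ne_two_dvd hq.one_lt hq4
    exact ⟨r, (hmem r).2 ⟨hr2, hr, hrM⟩⟩
  obtain ⟨a, ha⟩ := exists_forall_add_pow_ne_one hrank hdeg hTU hne (fun p hp => by
    obtain ⟨hp2, hpp, hpM⟩ := (hmem p).1 hp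
    refine ⟨hpp, by rw [hE, ← hM]; exact hpM.mul_left _, fun hpq => hp2 ?_⟩
    rw [hK, ← Nat.modEq_iff_dvd' hq.one_lt.le] at hpq
    have h4 : 4 ≡ (q + 1) * (q ^ 2 + 1) [MOD p] :=
      ((hpq.add_right 1).mul ((hpq.pow 2).add_right 1))
    have h5 : p ∣ 2 ^ 2 := (h4.dvd_iff dvd_rfl).2 hpM
    exact (Nat.prime_dvd_prime_iff_eq hpp Nat.prime_two).1 (hpp.dvd_of_dvd_pow h5)) hδ hδ0
    (by rwa [hK])
  refine exists_isPrimitiveElem_isKNormal hq hq4 hE hi hb0 hb (a := algebraMap K E a) ?_ ?_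
  · rw [← map_pow, ← hK, FiniteField.pow_card]
  · intro r hr hr2 hrM
    rw [← hE]
    exact ha r ((hmem r).2 ⟨hr2, hr, hrM⟩)

end Sieving

section ListArithmetic

variable {R : Type*} [CommRing R]

/-- The value at `x` of the polynomial with coefficients `l`, in order of increasing degree. -/
def evalList (x : R) : List ℕ → R
  | [] => 0
  | c :: l => c + x * evalList x l

/-- Addition of coefficient lists modulo `p`. -/
def addList (p : ℕ) : List ℕ → List ℕ → List ℕ
  | [], v => v
  | u, [] => u
  | c :: u, d :: v => (c + d) % p :: addList p u v

/-- Multiplication of a coefficient list by a scalar modulo `p`. -/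
def smulList (p c : ℕ) : List ℕ → List ℕ
  | [] => []
  | d :: v => c * d % p :: smulList p c v

/-- Multiplication of a coefficient list by `X` modulo `p` and `X ^ r.length - r`. -/
def mulXList (p : ℕ) (r l : List ℕ) : List ℕ :=
  bif Nat.beq l.length r.length then addList p (0 :: l.dropLast) (smulList p (l.getLastD 0) r)
  else 0 :: l

/-- Multiplication of coefficient lists modulo `p` and `X ^ r.length - r`. -/
def mulList (p : ℕ) (r : List ℕ) : List ℕ → List ℕ → List ℕ
  | [], _ => []
  | c :: u, v => addList p (smulList p c v) (mulXList p r (mulList p r u v))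

/-- Powers of coefficient lists modulo `p` and `X ^ r.length - r`, by repeated squaring. -/
def powList (p : ℕ) (r : List ℕ) : ℕ → List ℕ → ℕ → List ℕ
  | 0, _, _ => [1]
  | k + 1, u, e => bif Nat.beq e 0 then [1] else
      bif Nat.beq (e % 2) 1 then mulList p r u (powList p r k (mulList p r u u) (e / 2))
      else powList p r k (mulList p r u u) (e / 2)

theorem natCast_mod_eq {p : ℕ} (hp : (p : R) = 0) (n : ℕ) : ((n % p : ℕ) : R) = n := by
  conv_rhs => rw [← Nat.mod_add_div n p]
  simp [hp]

theorem evalList_addList {p : ℕ} (hp : (p : R) = 0) (x : R) (u v : List ℕ) :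
    evalList x (addList p u v) = evalList x u + evalList x v := by
  induction u, v using addList.induct with
  | case1 v => simp [addList, evalList]
  | case2 u h => cases u <;> simp [addList, evalList]
  | case3 c u d v ih =>
    simp only [addList, evalList, natCast_mod_eq hp, ih]
    push_cast
    ring

theorem evalList_smulList {p : ℕ} (hp : (p : R) = 0) (x : R) (c : ℕ) (v : List ℕ) :
    evalList x (smulList p c v) = c * evalList x v := by
  induction v with
  | nil => simp [smulList, evalList]
  | cons d v ih =>
    simp only [smulList, evalList, natCast_mod_eq hp, ih]
    push_cast
    ring

theorem evalList_dropLast (x : R) {l : List ℕ} (hl : l ≠ []) :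
    evalList x l = evalList x l.dropLast + l.getLastD 0 * x ^ (l.length - 1) := by
  induction l with
  | nil => exact absurd rfl hl
  | cons c l ih =>
    cases l with
    | nil => simp [evalList]
    | cons d l =>
      have := ih (List.cons_ne_nil d l)
      rw [List.dropLast_cons_cons, show evalList x (c :: d :: l) = c + x * evalList x (d :: l) from rfl,
        this, show evalList x (c :: (d :: l).dropLast) = c + x * evalList x (d :: l).dropLast from rfl]
      simp only [List.getLastD_cons, List.length_cons, Nat.add_sub_cancel]
      ring

theorem evalList_mulXList {p : ℕ} (hp : (p : R) = 0) {x : R} {r : List ℕ} (hr : r ≠ [])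
    (hx : x ^ r.length = evalList x r) (l : List ℕ) :
    evalList x (mulXList p r l) = x * evalList x l := by
  rw [mulXList]
  cases h : Nat.beq l.length r.length with
  | false => simp [evalList]
  | true =>
    have hlen : l.length = r.length := Nat.eq_of_beq_eq_true h
    have hl : l ≠ [] := fun h0 => hr (List.length_eq_zero_iff.1 (by rw [← hlen, h0]; rfl))
    have hpos := List.length_pos_iff.2 hl
    rw [cond_true, evalList_addList hp, evalList_smulList hp, ← hx, evalList_dropLast x hl, evalList,
      ← hlen]
    conv_lhs => rw [← Nat.sub_add_cancel hpos]
    rw [pow_succ]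
    push_cast
    ring

theorem evalList_mulList {p : ℕ} (hp : (p : R) = 0) {x : R} {r : List ℕ} (hr : r ≠ [])
    (hx : x ^ r.length = evalList x r) (u v : List ℕ) :
    evalList x (mulList p r u v) = evalList x u * evalList x v := by
  induction u with
  | nil => simp [mulList, evalList]
  | cons c u ih =>
    rw [mulList, evalList_addList hp, evalList_smulList hp, evalList_mulXList hp hr hx, ih, evalList]
    ring

theorem evalList_powList {p : ℕ} (hp : (p : R) = 0) {x : R} {r : List ℕ} (hr : r ≠ [])
    (hx : x ^ r.length = evalList x r) {k e : ℕ} (he : e < 2 ^ k) (u : List ℕ) :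
    evalList x (powList p r k u e) = evalList x u ^ e := by
  induction k generalizing u e with
  | zero =>
    obtain rfl : e = 0 := by omega
    simp [powList, evalList]
  | succ k ih =>
    have he2 : e / 2 < 2 ^ k := by omega
    rw [powList]
    cases h0 : Nat.beq e 0 with
    | true => simp [Nat.eq_of_beq_eq_true h0, evalList]
    | false =>
      cases h1 : Nat.beq (e % 2) 1 with
      | true =>
        have := Nat.eq_of_beq_eq_true h1
        rw [cond_false, cond_true, evalList_mulList hp hr hx, ih he2, evalList_mulList hp hr hx,
          ← sq, ← pow_mul, ← pow_succ']
        congr 1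
        omega
      | false =>
        have := Nat.ne_of_beq_eq_false h1
        rw [cond_false, cond_false, ih he2, evalList_mulList hp hr hx, ← sq, ← pow_mul]
        congr 1
        omega

theorem map_evalList {S : Type*} [CommRing S] (f : R →+* S) (x : R) (l : List ℕ) :
    f (evalList x l) = evalList (f x) l := by
  induction l with
  | nil => simp [evalList]
  | cons c l ih => simp [evalList, ih]

/-- Whether two coefficient lists agree modulo `p`, where missing coefficients count as `0`. -/
def eqvList (p : ℕ) (u v : List ℕ) : Bool :=
  (addList p u (smulList p (p - 1) v)).all fun c => Nat.beq (c % p) 0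

theorem evalList_eq_of_eqvList {p : ℕ} (hp0 : 0 < p) (hp : (p : R) = 0) (x : R) {u v : List ℕ}
    (h : eqvList p u v = true) : evalList x u = evalList x v := by
  have h0 : ∀ l : List ℕ, (l.all fun c => Nat.beq (c % p) 0) = true → evalList x l = 0 := by
    intro l hl
    induction l with
    | nil => rfl
    | cons c l ih =>
      rw [List.all_cons, Bool.and_eq_true] at hl
      rw [evalList, ih hl.2, ← natCast_mod_eq hp, Nat.eq_of_beq_eq_true hl.1]
      simp
  have h1 := h0 _ h
  rw [evalList_addList hp, evalList_smulList hp, Nat.cast_pred hp0, hp] at h1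
  linear_combination h1

end ListArithmetic

section Root

variable {E : Type*} [Field E] [Fintype E]

omit [Fintype E] in
theorem degree_evalList_lt (l : List ℕ) : (evalList (X : E[X]) l).degree < l.length := by
  induction l with
  | nil => simp [evalList]
  | cons c l ih =>
    rw [evalList]
    refine (degree_add_le _ _).trans_lt (max_lt ?_ ?_)
    · exact (degree_natCast_le c).trans_lt (by exact_mod_cast Nat.succ_pos _)
    · rw [mul_comm, List.length_cons]
      by_cases h0 : evalList (X : E[X]) l = 0
      · rw [h0, zero_mul, degree_zero]
        exact WithBot.bot_lt_coe _
      · rw [degree_mul_X, Nat.cast_add_one]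
        exact WithBot.add_lt_add_right (by simp) ih

theorem exists_pow_eq_evalList {p : ℕ} (hp0 : 0 < p) (hp : (p : E) = 0) {r : List ℕ} (hr : r ≠ [])
    {k : ℕ} (hk : Fintype.card E < 2 ^ k)
    (h : eqvList p (powList p r k [0, 1] (Fintype.card E)) [0, 1] = true) :
    ∃ b : E, b ^ r.length = evalList b r := by
  set f : E[X] := X ^ r.length - evalList X r with hf
  have hdeg : f.degree = r.length := by
    rw [hf, degree_sub_eq_left_of_degree_lt] <;> rw [degree_X_pow]
    exact degree_evalList_lt r
  have hpR : (p : AdjoinRoot f) = 0 := by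
    rw [← map_natCast (AdjoinRoot.of f), hp, map_zero]
  have hroot : AdjoinRoot.root f ^ r.length = evalList (AdjoinRoot.root f) r := by
    have h1 : AdjoinRoot.mk f (X ^ r.length - evalList X r) = 0 := AdjoinRoot.mk_self
    rw [map_sub, map_pow, map_evalList, AdjoinRoot.mk_X] at h1
    exact sub_eq_zero.1 h1
  have h1 := evalList_eq_of_eqvList hp0 hpR (AdjoinRoot.root f) h
  rw [evalList_powList hpR hr hroot hk] at h1
  have h2 : f ∣ X ^ Fintype.card E - X := by
    rw [← AdjoinRoot.mk_eq_zero, map_sub, map_pow, AdjoinRoot.mk_X, sub_eq_zero]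
    simpa [evalList] using h1
  have h3 : (X ^ Fintype.card E - X : E[X]) ≠ 0 :=
    FiniteField.X_pow_card_sub_X_ne_zero E Fintype.one_lt_card
  have h4 : (X ^ Fintype.card E - X : E[X]).Splits := by
    rw [splits_iff_card_roots, FiniteField.roots_X_pow_card_sub_X,
      FiniteField.X_pow_card_sub_X_natDegree_eq E Fintype.one_lt_card, Finset.card_val,
      Finset.card_univ]
  obtain ⟨b, hb⟩ := (h4.of_dvd h3 h2).exists_eval_eq_zero (by
    rw [hdeg]
    exact_mod_cast (List.length_pos_iff.2 hr).ne')
  refine ⟨b, ?_⟩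
  rw [hf, eval_sub, eval_pow, eval_X, ← coe_evalRingHom, map_evalList, coe_evalRingHom, eval_X] at hb
  exact sub_eq_zero.1 hb

end Root

section Certificates

/-- Whether `b + a` satisfies the hypotheses of `exists_isPrimitiveElem_isKNormal` for `q = p ^ m`
and the odd primes in `rs`, where `b` is a root of `X ^ r.length - r` in the field of order
`q ^ 4`. -/
def checkShift (p m : ℕ) (r : List ℕ) (a : ℕ) (rs : List ℕ) : Bool :=
  Nat.ble ((p ^ m) ^ 4 + 1) (2 ^ 48) &&
  Nat.beq ((2 * rs.prod) ^ 6 % ((p ^ m + 1) * ((p ^ m) ^ 2 + 1))) 0 &&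
  eqvList p (powList p r 48 [0, 1] ((p ^ m) ^ 4)) [0, 1] &&
  eqvList p (powList p r 48 [0, 1] (2 * (p ^ m - 1))) [p - 1] &&
  eqvList p (powList p r 48 (rs.foldr (fun s l => mulList p r
    (addList p (powList p r 48 [a, 1] (((p ^ m) ^ 4 - 1) / s)) [p - 1]) l) [1])
    ((p ^ m) ^ 4 - 1)) [1]

theorem exists_of_checkShift {p m : ℕ} {r : List ℕ} {a : ℕ} {rs : List ℕ} (hp : p.Prime)
    (hm : 0 < m) (hq4 : p ^ m % 4 = 1) (hr : r ≠ []) (hrs : ∀ s ∈ rs, s.Prime)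
    (h : checkShift p m r a rs = true) {E : Type*} [Field E] [Fintype E]
    (hE : Fintype.card E = (p ^ m) ^ 4) : ∃ α : E, IsPrimitiveElem α ∧ IsKNormal (p ^ m) 4 2 α := by
  have hq : IsPrimePow (p ^ m) := ⟨p, m, hp.prime, hm, rfl⟩
  have : Fact p.Prime := ⟨hp⟩
  have : CharP E p := charP_of_card_eq_pow hp (by rw [hE, ← pow_mul])
  have hp0 : (p : E) = 0 := CharP.cast_eq_zero E p
  set q := p ^ m with hqdef
  simp only [checkShift, Bool.and_eq_true] at h
  obtain ⟨⟨⟨⟨h1, h2⟩, h3⟩, h4⟩, h5⟩ := h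
  have h1 : q ^ 4 < 2 ^ 48 := Nat.le_of_ble_eq_true h1
  have h2 : (q + 1) * (q ^ 2 + 1) ∣ (2 * rs.prod) ^ 6 :=
    Nat.dvd_of_mod_eq_zero (Nat.eq_of_beq_eq_true h2)
  have hpe : ∀ {e}, e ≤ q ^ 4 → e < 2 ^ 48 := fun he => he.trans_lt h1
  have hqq : q ≤ q ^ 4 := Nat.le_self_pow (by norm_num) q
  have hq1 : 1 < q := hq.one_lt
  obtain ⟨b, hb⟩ := exists_pow_eq_evalList hp.pos hp0 hr (by rw [hE]; exact h1) (by rw [hE]; exact h3)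
  have hneg : evalList b [p - 1] = -1 := by simp [evalList, Nat.cast_pred hp.pos]
  have h4 := evalList_eq_of_eqvList hp.pos hp0 b h4
  rw [evalList_powList hp0 hr hb (hpe ?_), hneg] at h4
  swap
  · have h7 : q ^ 3 * q = q ^ 4 := by ring
    have h8 : 2 ≤ q ^ 3 := le_trans hq1 (Nat.le_self_pow (by norm_num) q)
    nlinarith [Nat.sub_le q 1]
  have h5 := evalList_eq_of_eqvList hp.pos hp0 b h5
  rw [evalList_powList hp0 hr hb (hpe (Nat.sub_le _ _))] at h5
  have hN : q ^ 4 - 1 ≠ 0 := by omega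
  have hfold : ∀ l : List ℕ, evalList b (l.foldr (fun s l => mulList p r
      (addList p (powList p r 48 [a, 1] ((q ^ 4 - 1) / s)) [p - 1]) l) [1]) ≠ 0 →
      ∀ s ∈ l, (b + (a : E)) ^ ((q ^ 4 - 1) / s) ≠ 1 := by
    intro l
    induction l with
    | nil => simp
    | cons s l ih =>
      intro h0 t ht
      rw [List.foldr_cons, evalList_mulList hp0 hr hb, evalList_addList hp0,
        evalList_powList hp0 hr hb (hpe ((Nat.div_le_self _ _).trans (Nat.sub_le _ _))), hneg] at h0
      rcases List.mem_cons.1 ht with rfl | ht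
      · intro h8
        refine left_ne_zero_of_mul h0 ?_
        rw [← h8]
        simp [evalList, add_comm]
      · exact ih (right_ne_zero_of_mul h0) t ht
  have hW := hfold rs (fun h0 => by
    rw [h0, zero_pow hN] at h5
    simp [evalList] at h5)
  have hb2 : (b ^ (q - 1)) ^ 2 = -1 := by
    rw [← pow_mul, mul_comm]
    simpa [evalList] using h4
  refine exists_isPrimitiveElem_isKNormal hq hq4 hE hb2 (b := b) (a := a) ?_ ?_ ?_ ?_
  · rintro rfl
    rw [zero_pow (by omega)] at hb2
    simp at hb2
  · rw [← pow_succ, Nat.sub_add_cancel hq1.le]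
  · obtain ⟨φ, hφ⟩ := exists_ringHom_pow hq hE
    rw [← hφ, map_natCast]
  · intro s hs hs2 hsM
    have h9 := (Nat.Prime.dvd_mul hs).1 (hs.dvd_of_dvd_pow (hsM.trans h2))
    rcases h9 with h9 | h9
    · exact absurd ((Nat.prime_dvd_prime_iff_eq hs Nat.prime_two).1 h9) hs2
    · obtain ⟨t, ht, hst⟩ := (Prime.dvd_prod_iff hs.prime).1 h9
      rw [(Nat.prime_dvd_prime_iff_eq hs (hrs t ht)).1 hst]
      exact hW t ht

end Certificates

section Exceptional

set_option maxHeartbeats 2000000 in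
set_option maxRecDepth 100000 in
/-- The prime powers for which the sieve with primes below `101` is not conclusive. -/
theorem exists_of_mem_exceptional {q : ℕ} (h : q ∈ [5, 9, 13, 17, 29, 37, 41, 53, 73, 89, 109, 113,
    125, 137, 149, 173, 197, 233, 293, 317, 353, 389, 509, 593, 797, 857, 1217, 2309])
    {E : Type*} [Field E] [Fintype E] (hE : Fintype.card E = q ^ 4) :
    ∃ α : E, IsPrimitiveElem α ∧ IsKNormal q 4 2 α := by
  have key : ∀ {p m : ℕ} (r : List ℕ) (a : ℕ) (rs : List ℕ), (p.Prime ∧ 0 < m ∧ p ^ m % 4 = 1 ∧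
      0 < r.length ∧ (∀ s ∈ rs, s.Prime)) → checkShift p m r a rs = true → q = p ^ m →
      ∃ α : E, IsPrimitiveElem α ∧ IsKNormal q 4 2 α := by
    rintro p m r a rs ⟨h1, h2, h3, h4, h5⟩ h6 rfl
    exact exists_of_checkShift h1 h2 h3 (List.ne_nil_of_length_pos h4) h5 h6 hE
  simp only [List.mem_cons, List.not_mem_nil, or_false] at h
  rcases h with h | h | h | h | h | h | h | h | h | h | h | h | h | h | h | h | h | h | h | h | h |
    h | h | h | h | h | h | h
  · exact key (p := 5) (m := 1) [2, 0, 0, 0] 1 [3, 13] (by norm_num)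
      (by decide +kernel) (by rw [h]; norm_num)
  · exact key (p := 3) (m := 2) [1, 0, 0, 0, 1, 0, 0, 0] 1 [5, 41] (by norm_num)
      (by decide +kernel) (by rw [h]; norm_num)
  · exact key (p := 13) (m := 1) [2, 0, 0, 0] 1 [5, 7, 17] (by norm_num)
      (by decide +kernel) (by rw [h]; norm_num)
  · exact key (p := 17) (m := 1) [3, 0, 0, 0] 1 [3, 5, 29] (by norm_num)
      (by decide +kernel) (by rw [h]; norm_num)
  · exact key (p := 29) (m := 1) [2, 0, 0, 0] 2 [3, 5, 421] (by norm_num)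
      (by decide +kernel) (by rw [h]; norm_num)
  · exact key (p := 37) (m := 1) [2, 0, 0, 0] 1 [5, 19, 137] (by norm_num)
      (by decide +kernel) (by rw [h]; norm_num)
  · exact key (p := 41) (m := 1) [3, 0, 0, 0] 2 [3, 7, 29] (by norm_num)
      (by decide +kernel) (by rw [h]; norm_num)
  · exact key (p := 53) (m := 1) [2, 0, 0, 0] 1 [3, 5, 281] (by norm_num)
      (by decide +kernel) (by rw [h]; norm_num)
  · exact key (p := 73) (m := 1) [5, 0, 0, 0] 1 [5, 13, 37, 41] (by norm_num)
      (by decide +kernel) (by rw [h]; norm_num)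
  · exact key (p := 89) (m := 1) [3, 0, 0, 0] 1 [3, 5, 17, 233] (by norm_num)
      (by decide +kernel) (by rw [h]; norm_num)
  · exact key (p := 109) (m := 1) [2, 0, 0, 0] 1 [5, 11, 13, 457] (by norm_num)
      (by decide +kernel) (by rw [h]; norm_num)
  · exact key (p := 113) (m := 1) [3, 0, 0, 0] 1 [3, 5, 19, 1277] (by norm_num)
      (by decide +kernel) (by rw [h]; norm_num)
  · exact key (p := 5) (m := 3) [2, 0, 0, 0, 0, 0, 0, 0, 1, 0, 0, 0] 1 [3, 7, 13, 601] (by norm_num)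
      (by decide +kernel) (by rw [h]; norm_num)
  · exact key (p := 137) (m := 1) [3, 0, 0, 0] 3 [3, 5, 23, 1877] (by norm_num)
      (by decide +kernel) (by rw [h]; norm_num)
  · exact key (p := 149) (m := 1) [2, 0, 0, 0] 1 [3, 5, 17, 653] (by norm_num)
      (by decide +kernel) (by rw [h]; norm_num)
  · exact key (p := 173) (m := 1) [2, 0, 0, 0] 1 [3, 5, 29, 41, 73] (by norm_num)
      (by decide +kernel) (by rw [h]; norm_num)
  · exact key (p := 197) (m := 1) [2, 0, 0, 0] 5 [3, 5, 11, 3881] (by norm_num)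
      (by decide +kernel) (by rw [h]; norm_num)
  · exact key (p := 233) (m := 1) [3, 0, 0, 0] 2 [3, 5, 13, 61, 89] (by norm_num)
      (by decide +kernel) (by rw [h]; norm_num)
  · exact key (p := 293) (m := 1) [2, 0, 0, 0] 3 [3, 5, 7, 17, 101] (by norm_num)
      (by decide +kernel) (by rw [h]; norm_num)
  · exact key (p := 317) (m := 1) [2, 0, 0, 0] 4 [3, 5, 13, 53, 773] (by norm_num)
      (by decide +kernel) (by rw [h]; norm_num)
  · exact key (p := 353) (m := 1) [3, 0, 0, 0] 2 [3, 5, 17, 59, 733] (by norm_num)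
      (by decide +kernel) (by rw [h]; norm_num)
  · exact key (p := 389) (m := 1) [2, 0, 0, 0] 5 [3, 5, 13, 29, 2609] (by norm_num)
      (by decide +kernel) (by rw [h]; norm_num)
  · exact key (p := 509) (m := 1) [2, 0, 0, 0] 1 [3, 5, 17, 281, 461] (by norm_num)
      (by decide +kernel) (by rw [h]; norm_num)
  · exact key (p := 593) (m := 1) [3, 0, 0, 0] 1 [3, 5, 11, 13, 541] (by norm_num)
      (by decide +kernel) (by rw [h]; norm_num)
  · exact key (p := 797) (m := 1) [2, 0, 0, 0] 1 [3, 5, 7, 19, 63521] (by norm_num)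
      (by decide +kernel) (by rw [h]; norm_num)
  · exact key (p := 857) (m := 1) [3, 0, 0, 0] 1 [3, 5, 11, 13, 37, 397] (by norm_num)
      (by decide +kernel) (by rw [h]; norm_num)
  · exact key (p := 1217) (m := 1) [3, 0, 0, 0] 1 [3, 5, 7, 13, 29, 11393] (by norm_num)
      (by decide +kernel) (by rw [h]; norm_num)
  · exact key (p := 2309) (m := 1) [2, 0, 0, 0] 1 [3, 5, 7, 11, 13, 53, 73] (by norm_num)
      (by decide +kernel) (by rw [h]; norm_num)

end Exceptional

section Criterion

theorem exists_isPrimitiveElem_isKNormal_of_card_le {q : ℕ} (hq : IsPrimePow q) (hq4 : q % 4 = 1)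
    {E : Type*} [Field E] [Fintype E] (hE : Fintype.card E = q ^ 4) {T U : Finset ℕ}
    (hTU : Disjoint T U) (hP : T ∪ U = ((q + 1) * (q ^ 2 + 1)).primeFactors.erase 2)
    {t s : ℕ} {σ : ℝ} (ht : T.card ≤ t) (hs : U.card ≤ s) (hs1 : 1 ≤ s)
    (hσ : ∑ r ∈ U, 1 / (r : ℝ) ≤ σ) (hσ1 : σ < 1)
    (h : 2 ^ (t + 1) * ((s - 1) + 2 * (1 - σ)) ≤ (√q + 2) * (1 - σ)) :
    ∃ α : E, IsPrimitiveElem α ∧ IsKNormal q 4 2 α := by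
  set δ : ℝ := 1 - ∑ r ∈ U, 1 / (r : ℝ) with hδ
  have hδσ : 1 - σ ≤ δ := by rw [hδ]; linarith
  have hσ0 : 0 < 1 - σ := by linarith
  have hδ0 : 0 < δ := hσ0.trans_le hδσ
  have hq0 : (0 : ℝ) < q := by exact_mod_cast hq.pos
  have hsq : 0 < √(q : ℝ) := Real.sqrt_pos.2 hq0
  have hqq : √(q : ℝ) ^ 2 = q := Real.sq_sqrt hq0.le
  have hs' : (0 : ℝ) ≤ s - 1 := by
    have : (1 : ℝ) ≤ s := by exact_mod_cast hs1
    linarith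
  have hs'' : (U.card : ℝ) ≤ s := by exact_mod_cast hs
  have hpow : (2 : ℝ) ^ T.card ≤ 2 ^ t := pow_le_pow_right₀ (by norm_num) ht
  refine exists_isPrimitiveElem_isKNormal_of_sieve hq hq4 hE hTU hP hδ hδ0.le ?_
  have h1 : (2 : ℝ) ^ (t + 1) * ((s - 1) + 2 * δ) ≤ (√q + 2) * δ := by
    have h2 : (2 : ℝ) ^ (t + 1) * ((s - 1) + 2 * (1 - σ)) * δ ≤ (√q + 2) * (1 - σ) * δ :=
      mul_le_mul_of_nonneg_right h hδ0.le
    have h3 : (2 : ℝ) ^ (t + 1) * ((s - 1) * (1 - σ)) ≤ 2 ^ (t + 1) * ((s - 1) * δ) := by gcongr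
    refine le_of_mul_le_mul_left (a := 1 - σ) ?_ hσ0
    nlinarith
  have h4 : (2 : ℝ) ^ T.card * (U.card - 1 + 2 * δ) ≤ 2 ^ t * ((s - 1) + 2 * δ) := by
    calc (2 : ℝ) ^ T.card * (U.card - 1 + 2 * δ) ≤ 2 ^ T.card * (s - 1 + 2 * δ) := by gcongr
      _ ≤ _ := by gcongr
  have h5 : 2 * √(q : ℝ) * (2 ^ T.card * (U.card - 1 + 2 * δ) - δ) ≤
      √q * ((√q + 2) * δ - 2 * δ) := by
    have : 2 * (2 ^ T.card * (U.card - 1 + 2 * δ) - δ) ≤ (√q + 2) * δ - 2 * δ := by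
      rw [pow_succ] at h1
      linarith
    calc _ = √(q : ℝ) * (2 * (2 ^ T.card * (U.card - 1 + 2 * δ) - δ)) := by ring
      _ ≤ _ := by gcongr
  refine h5.trans_lt ?_
  rw [show √(q : ℝ) * ((√q + 2) * δ - 2 * δ) = √(q : ℝ) ^ 2 * δ by ring, hqq]
  linarith

theorem le_mul_sqrt_of_sq_le {q a b : ℕ} (h : a ^ 2 ≤ q * b ^ 2) : (a : ℝ) ≤ b * √q := by
  have h' : (a : ℝ) ^ 2 ≤ q * b ^ 2 := by exact_mod_cast h
  refine (sq_le_sq₀ (by positivity) (by positivity)).1 ?_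
  rwa [mul_pow, Real.sq_sqrt (by positivity), mul_comm]

/-- Any product of distinct odd prime factors of `(q + 1) * (q ^ 2 + 1)` is at most a quarter
of it. -/
theorem four_mul_prod_le {q : ℕ} (hq4 : q % 4 = 1) {V : Finset ℕ}
    (hV : V ⊆ ((q + 1) * (q ^ 2 + 1)).primeFactors.erase 2) :
    4 * ∏ r ∈ V, r ≤ (q + 1) * (q ^ 2 + 1) := by
  set M := (q + 1) * (q ^ 2 + 1) with hM
  have h4 : 4 ∣ M := by
    obtain ⟨k, rfl⟩ : ∃ k, q = 4 * k + 1 := ⟨q / 4, by omega⟩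
    exact ⟨(2 * k + 1) * (8 * k ^ 2 + 4 * k + 1), by rw [hM]; ring⟩
  have hd : ∏ r ∈ V, r ∣ M :=
    (Finset.prod_dvd_prod_of_subset _ _ _ (hV.trans (Finset.erase_subset _ _))).trans
      (Nat.prod_primeFactors_dvd M)
  refine Nat.le_of_dvd (by positivity) (Nat.Coprime.mul_dvd_of_dvd_of_dvd ?_ h4 hd)
  refine Nat.Coprime.prod_right fun r hr => ?_
  have hr' := Finset.mem_erase.1 (hV hr)
  exact Nat.Coprime.pow_left 2 ((Nat.coprime_primes Nat.prime_two
    (Nat.prime_of_mem_primeFactors hr'.2)).2 hr'.1.symm)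

end Criterion

section Scan

/-- An integral form of the numerical hypothesis of `exists_isPrimitiveElem_isKNormal_of_card_le`,
with the reciprocal sum at most `N / 10 ^ 9`. -/
def sieveBound (q t s N : ℕ) : Bool :=
  Nat.ble (N + 1) (10 ^ 9) &&
  Nat.ble ((2 ^ (t + 1) * ((s - 1) * 10 ^ 9 + 2 * (10 ^ 9 - N)) - 2 * (10 ^ 9 - N)) ^ 2)
    (q * (10 ^ 9 - N) ^ 2)

/-- Whether the sieve succeeds for `q` when `l` lists the odd prime factors below `y` of
`M = (q + 1) * (q ^ 2 + 1)`. -/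
def sieveTest (y q M : ℕ) (l : List ℕ) : Bool :=
  (List.range 12).any fun k => Nat.ble (M + 1) (4 * l.prod * y ^ (k + 1)) &&
    (List.range 5).any fun t => sieveBound q t (max 1 ((l.drop t).length + k))
      (((l.drop t).map fun p => 10 ^ 9 / p + 1).sum + k * (10 ^ 9 / y + 1))

/-- Whether the sieve succeeds for `q` when `l` lists the odd primes below `y`. -/
def sieveCheck (y : ℕ) (l : List ℕ) (q : ℕ) : Bool :=
  sieveTest y q ((q + 1) * (q ^ 2 + 1))
    (l.filter fun p => Nat.beq ((q + 1) * (q ^ 2 + 1) % p) 0)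

theorem one_div_le_div_add_one (D p : ℕ) (hD : 0 < D) :
    1 / (p : ℝ) ≤ ((D / p + 1 : ℕ) : ℝ) / D := by
  have hD' : (0 : ℝ) < D := by exact_mod_cast hD
  rw [le_div_iff₀ hD', one_div_mul_eq_div]
  have := Nat.lt_floor_add_one ((D : ℝ) / p)
  rw [Nat.floor_div_eq_div] at this
  exact_mod_cast this.le

theorem sum_one_div_le_list_sum (l : List ℕ) (hl : l.Nodup) {D : ℕ} (hD : 0 < D) :
    ∑ r ∈ l.toFinset, 1 / (r : ℝ) ≤ ((l.map fun p => D / p + 1).sum : ℕ) / (D : ℝ) := by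
  rw [List.sum_toFinset _ hl]
  induction l with
  | nil => simp
  | cons a m ih =>
    rw [List.map_cons, List.sum_cons, List.map_cons, List.sum_cons, Nat.cast_add, add_div]
    exact add_le_add (one_div_le_div_add_one D a hD) (ih (List.nodup_cons.1 hl).2)

theorem sqrt_bound_of_sieveBound {q t s N : ℕ} (hs : 1 ≤ s) (h : sieveBound q t s N = true) :
    (N : ℝ) / (10 ^ 9 : ℕ) < 1 ∧ (2 : ℝ) ^ (t + 1) * ((s - 1) + 2 * (1 - N / (10 ^ 9 : ℕ))) ≤
      (√q + 2) * (1 - N / (10 ^ 9 : ℕ)) := by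
  simp only [sieveBound, Bool.and_eq_true] at h
  obtain ⟨h1, h2⟩ := h
  have h1 : N + 1 ≤ 10 ^ 9 := Nat.le_of_ble_eq_true h1
  have h2 := le_mul_sqrt_of_sq_le (Nat.le_of_ble_eq_true h2)
  generalize 10 ^ 9 = D at h1 h2
  have hD : (0 : ℝ) < D := by exact_mod_cast (by omega : 0 < D)
  obtain ⟨e, rfl⟩ : ∃ e, D = N + e := ⟨D - N, by omega⟩
  obtain ⟨s, rfl⟩ : ∃ s', s = s' + 1 := ⟨s - 1, by omega⟩
  have he : 0 < e := by omega
  have he' : (0 : ℝ) < e := by exact_mod_cast he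
  have h3 : (1 : ℝ) - N / ((N + e : ℕ) : ℝ) = e / ((N + e : ℕ) : ℝ) := by
    rw [eq_div_iff hD.ne', sub_mul, div_mul_cancel₀ _ hD.ne']
    push_cast
    ring
  refine ⟨?_, ?_⟩
  · rw [div_lt_one hD]
    push_cast
    linarith
  · rw [h3]
    rw [Nat.add_sub_cancel_left, Nat.add_sub_cancel] at h2
    have h4 : 2 * e ≤ 2 ^ (t + 1) * (s * (N + e) + 2 * e) := by
      calc 2 * e ≤ s * (N + e) + 2 * e := Nat.le_add_left _ _
        _ ≤ _ := Nat.le_mul_of_pos_left _ (by positivity)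
    rw [Nat.cast_sub h4] at h2
    refine le_of_mul_le_mul_right (a := ((N + e : ℕ) : ℝ)) ?_ hD
    have h5 : (2 : ℝ) ^ (t + 1) * (((s + 1 : ℕ) : ℝ) - 1 + 2 * (e / ((N + e : ℕ) : ℝ))) *
        ((N + e : ℕ) : ℝ) = 2 ^ (t + 1) * (s * ((N + e : ℕ) : ℝ) + 2 * e) := by
      field_simp
      push_cast
      ring
    rw [h5, mul_assoc, div_mul_cancel₀ _ hD.ne']
    push_cast at h2 ⊢
    linarith

theorem exists_of_sieveCheck {y : ℕ} (hy : 0 < y) {l : List ℕ} (hl : l.Nodup)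
    (hly : ∀ p, p ∈ l ↔ p < y ∧ p.Prime ∧ p ≠ 2) {q : ℕ} (hq : IsPrimePow q) (hq4 : q % 4 = 1)
    (h : sieveCheck y l q = true) {E : Type*} [Field E] [Fintype E]
    (hE : Fintype.card E = q ^ 4) : ∃ α : E, IsPrimitiveElem α ∧ IsKNormal q 4 2 α := by
  set M := (q + 1) * (q ^ 2 + 1) with hM
  have hM0 : M ≠ 0 := by positivity
  set f := l.filter fun p => Nat.beq (M % p) 0 with hf
  have hfn : f.Nodup := hl.filter _
  have hmem : ∀ p, p ∈ f ↔ p < y ∧ p ∈ M.primeFactors.erase 2 := by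
    intro p
    rw [hf, List.mem_filter, hly, Finset.mem_erase, Nat.mem_primeFactors, Nat.beq_eq,
      ← Nat.dvd_iff_mod_eq_zero]
    tauto
  have h : sieveTest y q M f = true := h
  simp only [sieveTest, List.any_eq_true, Bool.and_eq_true, List.mem_range] at h
  obtain ⟨k, -, h1, t, -, h2⟩ := h
  have h1 : M < 4 * f.prod * y ^ (k + 1) := Nat.le_of_ble_eq_true h1
  set P := M.primeFactors.erase 2 with hP
  set W := P.filter (y ≤ ·) with hW
  have hfW : Disjoint f.toFinset W := by
    rw [Finset.disjoint_left]
    intro p hp hp'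
    rw [List.mem_toFinset, hmem] at hp
    exact absurd (Finset.mem_filter.1 hp').2 (by omega)
  have hfW' : f.toFinset ∪ W = P := by
    ext p
    rw [Finset.mem_union, List.mem_toFinset, hmem, hW, Finset.mem_filter]
    have := le_or_gt y p
    tauto
  have hprod : ∏ r ∈ f.toFinset, r = f.prod := by
    rw [List.prod_toFinset _ hfn, List.map_id']
  have hWk : W.card ≤ k := by
    by_contra! hk
    have h3 := four_mul_prod_le hq4 (le_refl P)
    rw [← hfW', Finset.prod_union hfW, hprod, ← mul_assoc] at h3
    have h4 : y ^ (k + 1) ≤ ∏ r ∈ W, r := by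
      calc y ^ (k + 1) ≤ y ^ W.card := Nat.pow_le_pow_right hy hk
        _ ≤ _ := Finset.pow_card_le_prod _ _ _ fun r hr => (Finset.mem_filter.1 hr).2
    have := Nat.mul_le_mul_left (4 * f.prod) h4
    omega
  have hsplit : (f.take t).toFinset ∪ (f.drop t).toFinset = f.toFinset := by
    rw [← List.toFinset_append, List.take_append_drop]
  have hdisj : Disjoint (f.take t).toFinset (f.drop t).toFinset := by
    rw [List.disjoint_toFinset_iff_disjoint]
    exact List.disjoint_take_drop hfn le_rfl
  have hdn : (f.drop t).Nodup := hfn.sublist (List.drop_sublist _ _)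
  have hdW : Disjoint (f.drop t).toFinset W :=
    hfW.mono_left (hsplit ▸ Finset.subset_union_right)
  obtain ⟨h3, h4⟩ := sqrt_bound_of_sieveBound (le_max_left _ _) h2
  refine exists_isPrimitiveElem_isKNormal_of_card_le hq hq4 hE (T := (f.take t).toFinset)
    (U := (f.drop t).toFinset ∪ W) ?_ ?_ (t := t) ?_ ?_ (le_max_left _ _) ?_ h3 h4
  · exact Finset.disjoint_union_right.2
      ⟨hdisj, hfW.mono_left (hsplit ▸ Finset.subset_union_left)⟩
  · rw [← Finset.union_assoc, hsplit, hfW']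
  · exact (List.toFinset_card_le _).trans (List.length_take_le _ _)
  · refine (Finset.card_union_le _ _).trans (le_max_of_le_right ?_)
    exact Nat.add_le_add (List.toFinset_card_le _) hWk
  · rw [Finset.sum_union hdW]
    generalize hDe : 10 ^ 9 = D
    have hD : 0 < D := by omega
    rw [Nat.cast_add, add_div]
    refine add_le_add ?_ ?_
    · exact sum_one_div_le_list_sum _ hdn hD
    · calc ∑ r ∈ W, 1 / (r : ℝ) ≤ ∑ r ∈ W, ((D / y + 1 : ℕ) : ℝ) / D := by
            refine Finset.sum_le_sum fun r hr => (one_div_le_div_add_one D r hD).trans ?_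
            gcongr
            exact (Finset.mem_filter.1 hr).2
        _ = W.card * (((D / y + 1 : ℕ) : ℝ) / D) := by rw [Finset.sum_const, nsmul_eq_mul]
        _ ≤ k * (((D / y + 1 : ℕ) : ℝ) / D) := by gcongr
        _ = _ := by push_cast; ring

end Scan

section ScanRange

set_option maxRecDepth 100000 in
theorem sieveCheck_of_lt {i : ℕ} (hi : i < 1250) :
    sieveCheck 101 [3, 5, 7, 11, 13, 17, 19, 23, 29, 31, 37, 41, 43, 47, 53, 59, 61, 67, 71, 73, 79,
      83, 89, 97] (4 * i + 1) = true ∨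
    4 * i + 1 ∈ [5, 9, 13, 17, 29, 37, 41, 53, 73, 89, 109, 113, 125, 137, 149, 173, 197, 233, 293,
      317, 353, 389, 509, 593, 797, 857, 1217, 2309] ∨
    4 * i + 1 ∈ [1, 21, 33, 57, 65, 77, 153, 209, 237, 329, 377, 413, 437, 473, 497, 629, 713, 1253,
      1517] := by
  have key : ((List.range 1250).all fun i => decide (sieveCheck 101 [3, 5, 7, 11, 13, 17, 19, 23,
      29, 31, 37, 41, 43, 47, 53, 59, 61, 67, 71, 73, 79, 83, 89, 97] (4 * i + 1) = true ∨
    4 * i + 1 ∈ [5, 9, 13, 17, 29, 37, 41, 53, 73, 89, 109, 113, 125, 137, 149, 173, 197, 233, 293,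
      317, 353, 389, 509, 593, 797, 857, 1217, 2309] ∨
    4 * i + 1 ∈ [1, 21, 33, 57, 65, 77, 153, 209, 237, 329, 377, 413, 437, 473, 497, 629, 713, 1253,
      1517])) = true := by
    decide +kernel
  exact of_decide_eq_true (List.all_eq_true.1 key i (List.mem_range.2 hi))

set_option maxRecDepth 100000 in
theorem sieveCheck_of_lt_of_le {i : ℕ} (hi : i < 7493) :
    sieveCheck 29 [3, 5, 7, 11, 13, 17, 19, 23] (4 * (i + 1250) + 1) = true := by
  have key : ((List.range 7493).all fun i =>
      sieveCheck 29 [3, 5, 7, 11, 13, 17, 19, 23] (4 * (i + 1250) + 1)) = true := by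
    decide +kernel
  exact List.all_eq_true.1 key i (List.mem_range.2 hi)

theorem not_isPrimePow_mul {a b : ℕ} (ha : 1 < a) (hb : 1 < b) (hab : a.Coprime b) :
    ¬ IsPrimePow (a * b) := by
  intro h
  rcases (hab.isPrimePow_dvd_mul h).1 dvd_rfl with h1 | h1
  · exact absurd (Nat.le_of_dvd (by omega) h1) (by nlinarith)
  · exact absurd (Nat.le_of_dvd (by omega) h1) (by nlinarith)

theorem not_isPrimePow_of_mem {q : ℕ} (h : q ∈ [1, 21, 33, 57, 65, 77, 153, 209, 237, 329, 377, 413,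
    437, 473, 497, 629, 713, 1253, 1517]) : ¬ IsPrimePow q := by
  have key : ∀ a b, 1 < a ∧ 1 < b ∧ a.Coprime b → q = a * b → ¬ IsPrimePow q := by
    rintro a b ⟨ha, hb, hab⟩ rfl
    exact not_isPrimePow_mul ha hb hab
  simp only [List.mem_cons, List.not_mem_nil, or_false] at h
  rcases h with h | h | h | h | h | h | h | h | h | h | h | h | h | h | h | h | h | h | h
  · exact h ▸ not_isPrimePow_one
  · exact key 3 7 (by norm_num) h
  · exact key 3 11 (by norm_num) h
  · exact key 3 19 (by norm_num) h
  · exact key 5 13 (by norm_num) h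
  · exact key 7 11 (by norm_num) h
  · exact key 9 17 (by norm_num) h
  · exact key 11 19 (by norm_num) h
  · exact key 3 79 (by norm_num) h
  · exact key 7 47 (by norm_num) h
  · exact key 13 29 (by norm_num) h
  · exact key 7 59 (by norm_num) h
  · exact key 19 23 (by norm_num) h
  · exact key 11 43 (by norm_num) h
  · exact key 7 71 (by norm_num) h
  · exact key 17 37 (by norm_num) h
  · exact key 23 31 (by norm_num) h
  · exact key 7 179 (by norm_num) h
  · exact key 37 41 (by norm_num) h

theorem exists_of_lt {q : ℕ} (hq : IsPrimePow q) (hq4 : q % 4 = 1) (hlt : q < 34970)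
    {E : Type*} [Field E] [Fintype E] (hE : Fintype.card E = q ^ 4) :
    ∃ α : E, IsPrimitiveElem α ∧ IsKNormal q 4 2 α := by
  rcases lt_or_ge q 5000 with h | h
  · obtain ⟨i, rfl⟩ : ∃ i, q = 4 * i + 1 := ⟨q / 4, by omega⟩
    rcases sieveCheck_of_lt (show i < 1250 by omega) with h1 | h1 | h1
    · refine exists_of_sieveCheck (by norm_num) (by decide) (fun p => ?_) hq hq4 h1 hE
      have key : ∀ p < 101, p ∈ [3, 5, 7, 11, 13, 17, 19, 23, 29, 31, 37, 41, 43, 47, 53, 59, 61,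
          67, 71, 73, 79, 83, 89, 97] ↔ p.Prime ∧ p ≠ 2 := by
        decide +kernel
      by_cases hp : p < 101
      · simp only [key p hp, hp, true_and]
      · refine iff_of_false (fun h2 => hp ?_) fun h2 => hp h2.1
        simp only [List.mem_cons, List.not_mem_nil, or_false] at h2
        omega
    · exact exists_of_mem_exceptional h1 hE
    · exact absurd hq (not_isPrimePow_of_mem h1)
  · obtain ⟨i, rfl⟩ : ∃ i, q = 4 * (i + 1250) + 1 := ⟨q / 4 - 1250, by omega⟩
    refine exists_of_sieveCheck (by norm_num) (by decide) (fun p => ?_) hq hq4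
      (sieveCheck_of_lt_of_le (show i < 7493 by omega)) hE
    have key : ∀ p < 29, p ∈ [3, 5, 7, 11, 13, 17, 19, 23] ↔ p.Prime ∧ p ≠ 2 := by
      decide +kernel
    by_cases hp : p < 29
    · simp only [key p hp, hp, true_and]
    · refine iff_of_false (fun h2 => hp ?_) fun h2 => hp h2.1
      simp only [List.mem_cons, List.not_mem_nil, or_false] at h2
      omega

end ScanRange

section LargeFields

/-- If `L` contains every element of `V` below `z` and nothing above `z`, then the geometric mean
of `V` compares with that of `L`, both measured against `z`. -/
theorem pow_card_mul_prod_le {V L : Finset ℕ} {z : ℕ} (hV : ∀ r ∈ V, r ∉ L → z ≤ r)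
    (hL : ∀ r ∈ L, r ≤ z) : z ^ V.card * ∏ r ∈ L, r ≤ (∏ r ∈ V, r) * z ^ L.card := by
  have h1 : z ^ (V \ L).card ≤ ∏ r ∈ V \ L, r := Finset.pow_card_le_prod _ _ _ fun r hr =>
    hV r (Finset.mem_sdiff.1 hr).1 (Finset.mem_sdiff.1 hr).2
  have h2 : ∏ r ∈ L \ V, r ≤ z ^ (L \ V).card := Finset.prod_le_pow_card _ _ _ fun r hr =>
    hL r (Finset.mem_sdiff.1 hr).1
  rw [← Finset.prod_inter_mul_prod_sdiff V L, ← Finset.prod_inter_mul_prod_sdiff L V,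
    ← Finset.card_inter_add_card_sdiff V L, ← Finset.card_inter_add_card_sdiff L V,
    Finset.inter_comm L V, pow_add, pow_add]
  calc _ = z ^ (V ∩ L).card * (∏ r ∈ V ∩ L, r) * (z ^ (V \ L).card * ∏ r ∈ L \ V, r) := by ring
    _ ≤ z ^ (V ∩ L).card * (∏ r ∈ V ∩ L, r) * ((∏ r ∈ V \ L, r) * z ^ (L \ V).card) := by gcongr
    _ = _ := by ring

theorem card_le_card_of_prod_lt {V L : Finset ℕ} {z : ℕ} (hz : 0 < z)
    (hV : ∀ r ∈ V, r ∉ L → z ≤ r) (hL : ∀ r ∈ L, r ≤ z) (h : ∏ r ∈ V, r < z * ∏ r ∈ L, r) :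
    V.card ≤ L.card := by
  by_contra! hlt
  refine absurd (pow_card_mul_prod_le hV hL) (not_le.2 ?_)
  calc (∏ r ∈ V, r) * z ^ L.card < (z * ∏ r ∈ L, r) * z ^ L.card := by gcongr
    _ = z ^ (L.card + 1) * ∏ r ∈ L, r := by ring
    _ ≤ _ := by gcongr; exact hlt

theorem sum_one_div_le_sum_one_div {V L : Finset ℕ} {z : ℕ} (hV : ∀ r ∈ V, r ∉ L → z ≤ r)
    (hL : ∀ r ∈ L, 0 < r ∧ r ≤ z) (h : V.card ≤ L.card) :
    ∑ r ∈ V, 1 / (r : ℝ) ≤ ∑ r ∈ L, 1 / (r : ℝ) := by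
  rw [← Finset.sum_inter_add_sum_sdiff V L, ← Finset.sum_inter_add_sum_sdiff L V,
    Finset.inter_comm L V]
  refine add_le_add le_rfl ?_
  have hcard : (V \ L).card ≤ (L \ V).card := by
    have h1 := Finset.card_inter_add_card_sdiff V L
    have h2 := Finset.card_inter_add_card_sdiff L V
    rw [Finset.inter_comm] at h2
    omega
  rcases Nat.eq_zero_or_pos z with rfl | hz
  · have hL0 : L = ∅ := Finset.eq_empty_of_forall_notMem fun r hr => by
      have := hL r hr
      omega
    subst hL0
    simp_all
  calc ∑ r ∈ V \ L, 1 / (r : ℝ) ≤ ∑ r ∈ V \ L, 1 / (z : ℝ) := by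
        refine Finset.sum_le_sum fun r hr => ?_
        have := hV r (Finset.mem_sdiff.1 hr).1 (Finset.mem_sdiff.1 hr).2
        gcongr
    _ = (V \ L).card * (1 / (z : ℝ)) := by rw [Finset.sum_const, nsmul_eq_mul]
    _ ≤ (L \ V).card * (1 / (z : ℝ)) := by gcongr
    _ = ∑ r ∈ L \ V, 1 / (z : ℝ) := by rw [Finset.sum_const, nsmul_eq_mul]
    _ ≤ _ := by
        refine Finset.sum_le_sum fun r hr => ?_
        obtain ⟨h1, h2⟩ := hL r (Finset.mem_sdiff.1 hr).1
        gcongr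

theorem sieveBound_mono {q q' t s N : ℕ} (h : q ≤ q') (hq : sieveBound q t s N = true) :
    sieveBound q' t s N = true := by
  simp only [sieveBound, Bool.and_eq_true] at hq ⊢
  exact ⟨hq.1, Nat.ble_eq_true_of_le ((Nat.le_of_ble_eq_true hq.2).trans
    (Nat.mul_le_mul_right _ h))⟩

theorem exists_of_le_of_prod_lt {z : ℕ} {l₀ l : List ℕ} (hz : 0 < z) (hl : l.Nodup)
    (hl0 : l ≠ []) (hly : ∀ p, p ∈ l₀ ++ l ∨ z ≤ p ∨ ¬ p.Prime ∨ p = 2)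
    (hlz : ∀ p ∈ l, 0 < p ∧ p ≤ z) {q₀ q : ℕ} (hq : IsPrimePow q)
    (hq4 : q % 4 = 1) (hq₀ : q₀ ≤ q)
    (h : sieveBound q₀ l₀.length l.length (l.map fun p => 10 ^ 9 / p + 1).sum = true)
    (hM : (q + 1) * (q ^ 2 + 1) < 4 * (z * l.prod)) {E : Type*} [Field E] [Fintype E]
    (hE : Fintype.card E = q ^ 4) : ∃ α : E, IsPrimitiveElem α ∧ IsKNormal q 4 2 α := by
  set P := ((q + 1) * (q ^ 2 + 1)).primeFactors.erase 2 with hP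
  have hlcard : l.toFinset.card = l.length := List.toFinset_card_of_nodup hl
  have hl1 : 1 ≤ l.length := List.length_pos_iff.2 hl0
  have hlz' : ∀ r ∈ l.toFinset, 0 < r ∧ r ≤ z := fun r hr => hlz r (List.mem_toFinset.1 hr)
  have hV : ∀ r ∈ P \ l₀.toFinset, r ∉ l.toFinset → z ≤ r := by
    intro r hr hrl
    rw [Finset.mem_sdiff, hP, Finset.mem_erase, Nat.mem_primeFactors, List.mem_toFinset] at hr
    rw [List.mem_toFinset] at hrl
    have := hly r
    rw [List.mem_append] at this
    tauto
  have hlprod : ∏ r ∈ l.toFinset, r = l.prod := by rw [List.prod_toFinset _ hl, List.map_id']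
  have hcard : (P \ l₀.toFinset).card ≤ l.toFinset.card := by
    refine card_le_card_of_prod_lt hz hV (fun r hr => (hlz' r hr).2) ?_
    have := four_mul_prod_le hq4 (V := P \ l₀.toFinset) Finset.sdiff_subset
    rw [hlprod]
    omega
  obtain ⟨h3, h4⟩ := sqrt_bound_of_sieveBound hl1 (sieveBound_mono hq₀ h)
  exact exists_isPrimitiveElem_isKNormal_of_card_le hq hq4 hE (T := P ∩ l₀.toFinset)
    (U := P \ l₀.toFinset) (Finset.disjoint_sdiff.mono_left Finset.inter_subset_right)
    (by rw [Finset.union_comm, Finset.sdiff_union_inter])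
    ((Finset.card_le_card Finset.inter_subset_right).trans (List.toFinset_card_le _))
    (hcard.trans hlcard.le) hl1 ((sum_one_div_le_sum_one_div hV hlz' hcard).trans
      (sum_one_div_le_list_sum l hl (by norm_num))) h3 h4

theorem exists_of_pow_le {l : List ℕ} (hl : l.Nodup)
    (hly : ∀ p, p ∈ l ∨ 256 ≤ p ∨ ¬ p.Prime ∨ p = 2) (hlz : ∀ p ∈ l, 0 < p ∧ p ≤ 256) {q : ℕ}
    (hq : IsPrimePow q) (hq4 : q % 4 = 1) (h : 65536 * 256 ^ l.length ≤ 2 * l.prod * q)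
    {E : Type*} [Field E] [Fintype E] (hE : Fintype.card E = q ^ 4) :
    ∃ α : E, IsPrimitiveElem α ∧ IsKNormal q 4 2 α := by
  set P := ((q + 1) * (q ^ 2 + 1)).primeFactors.erase 2 with hP
  have hV : ∀ r ∈ P, r ∉ l.toFinset → 256 ≤ r := by
    intro r hr hrl
    rw [hP, Finset.mem_erase, Nat.mem_primeFactors] at hr
    rw [List.mem_toFinset] at hrl
    have := hly r
    tauto
  have h1 := pow_card_mul_prod_le hV fun r hr => (hlz r (List.mem_toFinset.1 hr)).2
  rw [List.prod_toFinset _ hl, List.map_id', List.toFinset_card_of_nodup hl] at h1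
  have h2 : 4 * ∏ r ∈ P, r ≤ 2 * q ^ 3 := by
    refine (four_mul_prod_le hq4 le_rfl).trans ?_
    have : 5 ≤ q := by have := hq.two_le; omega
    nlinarith [Nat.mul_le_mul this this, Nat.mul_le_mul_right (q ^ 2) this]
  have hl0 : 0 < l.prod := List.prod_pos fun p hp => (hlz p hp).1
  have h3 : (2 ^ (P.card + 2)) ^ 2 ≤ q := by
    refine (Nat.pow_le_pow_iff_left (n := 4) (by norm_num)).1 ?_
    refine le_of_mul_le_mul_left ?_ (Nat.mul_pos two_pos hl0)
    calc 2 * l.prod * ((2 ^ (P.card + 2)) ^ 2) ^ 4 = 2 * 65536 * (256 ^ P.card * l.prod) := by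
          rw [show 256 = 2 ^ 8 from rfl, show 65536 = 2 ^ 16 from rfl, ← pow_mul 2 8]
          ring
      _ ≤ 2 * 65536 * ((∏ r ∈ P, r) * 256 ^ l.length) := by gcongr
      _ = (4 * ∏ r ∈ P, r) * 32768 * 256 ^ l.length := by ring
      _ ≤ (2 * q ^ 3) * 32768 * 256 ^ l.length := by gcongr
      _ = q ^ 3 * (65536 * 256 ^ l.length) := by ring
      _ ≤ q ^ 3 * (2 * l.prod * q) := by gcongr
      _ = _ := by ring
  have h4 := le_mul_sqrt_of_sq_le (a := 2 ^ (P.card + 2)) (b := 1) (by simpa using h3)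
  push_cast at h4
  refine exists_isPrimitiveElem_isKNormal_of_card_le hq hq4 hE (T := P) (U := ∅)
    (Finset.disjoint_empty_right _) (Finset.union_empty _) le_rfl (s := 1) (by simp) le_rfl
    (σ := 0) (by simp) one_pos ?_
  rw [pow_succ] at h4
  norm_num
  linarith

theorem forall_of_forall_lt {z : ℕ} {l : List ℕ}
    (h : ∀ p < z, p ∈ l ∨ ¬ p.Prime ∨ p = 2) (p : ℕ) : p ∈ l ∨ z ≤ p ∨ ¬ p.Prime ∨ p = 2 := by
  have := h p
  have := lt_or_ge p z
  tauto

theorem prod_lt_of_le {q q₁ N : ℕ} (h : q ≤ q₁) (hN : (q₁ + 1) * (q₁ ^ 2 + 1) < N) :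
    (q + 1) * (q ^ 2 + 1) < N :=
  lt_of_le_of_lt (by gcongr) hN

theorem exists_of_le {q : ℕ} (hq : IsPrimePow q) (hq4 : q % 4 = 1) (hle : 34970 ≤ q)
    {E : Type*} [Field E] [Fintype E] (hE : Fintype.card E = q ^ 4) :
    ∃ α : E, IsPrimitiveElem α ∧ IsKNormal q 4 2 α := by
  rcases lt_or_ge q 120000 with h1 | h1
  · exact exists_of_le_of_prod_lt (z := 43) (l₀ := [3, 5]) (l := [7, 11, 13, 17, 19, 23, 29, 31, 37, 41])
      (by norm_num) (by decide +kernel) (by simp) (forall_of_forall_lt (by decide +kernel))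
      (by decide +kernel) hq hq4 hle (by decide +kernel) (prod_lt_of_le h1.le (by norm_num)) hE
  rcases lt_or_ge q 25000000 with h2 | h2
  · exact exists_of_le_of_prod_lt (z := 61) (l₀ := [3, 5]) (l := [7, 11, 13, 17, 19, 23, 29, 31, 37, 41, 43, 47, 53, 59])
      (by norm_num) (by decide +kernel) (by simp) (forall_of_forall_lt (by decide +kernel))
      (by decide +kernel) hq hq4 h1 (by decide +kernel) (prod_lt_of_le h2.le (by norm_num)) hE
  rcases lt_or_ge q (10 ^ 35) with h3 | h3
  · exact exists_of_le_of_prod_lt (z := 269) (l₀ := [3, 5, 7]) (l := [11, 13, 17, 19, 23, 29, 31, 37, 41, 43, 47, 53, 59, 61, 67, 71, 73, 79, 83, 89, 97, 101,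
      103, 107, 109, 113, 127, 131, 137, 139, 149, 151, 157, 163, 167, 173, 179, 181, 191,
      193, 197, 199, 211, 223, 227, 229, 233, 239, 241, 251, 257, 263])
      (by norm_num) (by decide +kernel) (by simp) (forall_of_forall_lt (by decide +kernel))
      (by decide +kernel) hq hq4 h2 (by decide +kernel) (prod_lt_of_le h3.le (by norm_num)) hE
  · exact exists_of_pow_le (l := [3, 5, 7, 11, 13, 17, 19, 23, 29, 31, 37, 41, 43, 47, 53, 59, 61, 67, 71, 73, 79, 83, 89,
      97, 101, 103, 107, 109, 113, 127, 131, 137, 139, 149, 151, 157, 163, 167, 173, 179,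
      181, 191, 193, 197, 199, 211, 223, 227, 229, 233, 239, 241, 251])
      (by decide +kernel) (forall_of_forall_lt (by decide +kernel)) (by decide +kernel) hq hq4
      (le_trans (by norm_num) (Nat.mul_le_mul_left _ h3)) hE

end LargeFields

/-- For a prime power `q`, there exists a primitive `2`-normal element in `F_{q^4}`
over `F_q` if and only if `q ≡ 1 (mod 4)`. -/
theorem primitive_two_normal_n4 (q : ℕ) (hq : IsPrimePow q)
    (E : Type*) [Field E] [Fintype E] (hE : Fintype.card E = q ^ 4) :
    (∃ α : E, IsPrimitiveElem α ∧ IsKNormal q 4 2 α) ↔ q % 4 = 1 := by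
  refine ⟨fun ⟨α, hα, hα2⟩ => mod_four_eq_one_of_isKNormal hq hE hα hα2, fun hq4 => ?_⟩
  rcases lt_or_ge q 34970 with h | h
  · exact exists_of_lt hq hq4 h hE
  · exact exists_of_le hq hq4 h hE

end
end

section
/- Let q be a prime power with q ≡ 1 or −1 (mod 5), let b ∈ F_q be a root of x² + x − 1, let α be a normal element of F_{q^5} over F_q, and set f = x² − b·x + 1. Then L_f(α) + a is a 2-normal element of F_{q^5} over F_q for every a ∈ F_q with exactly one exception; that is, there is a unique a₀ ∈ F_q such that L_f(α) + a is 2-normal for all a ∈ F_q with a ≠ a₀. -/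
open Polynomial

noncomputable section

/-- The linearized `q`-associate of `f = Σ a_i x^i ∈ F_q[x]`, evaluated at `α`:
`L_f(α) = Σ a_i α^{q^i}`. -/
def Lf {F E : Type*} [Field F] [Field E] [Algebra F E] (q : ℕ) (f : Polynomial F) (α : E) : E :=
  ∑ i ∈ Finset.range (f.natDegree + 1), algebraMap F E (f.coeff i) * α ^ q ^ i

theorem isKNormal_zero_iff_isCoprime {E : Type*} [Field E] {q n : ℕ} (hn : 0 < n) (α : E) :
    IsKNormal q n 0 α ↔ IsCoprime ((X : E[X]) ^ n - 1) (gPoly q n α) := by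
  let _ : DecidableEq E[X] := Classical.decEq _
  rw [IsKNormal, ← EuclideanDomain.gcd_isUnit_iff]
  have h0 : (X : E[X]) ^ n - 1 ≠ 0 := X_pow_sub_C_ne_zero hn 1
  constructor
  · intro h
    rw [isUnit_iff_degree_eq_zero, degree_eq_natDegree fun h' => h0
      (EuclideanDomain.gcd_eq_zero_iff.1 h').1]
    exact congrArg (Nat.cast : ℕ → WithBot ℕ) h
  · intro h
    exact natDegree_eq_zero_of_isUnit h

theorem isKNormal_of_forall_dvd {E : Type*} [Field E] {q n k : ℕ} {α : E} {d : E[X]}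
    (hd : d.natDegree = k) (h₁ : d ∣ X ^ n - 1) (h₂ : d ∣ gPoly q n α)
    (h : ∀ e : E[X], e ∣ X ^ n - 1 → e ∣ gPoly q n α → e ∣ d) :
    IsKNormal q n k α := by
  let _ : DecidableEq E[X] := Classical.decEq _
  rw [← hd]
  apply natDegree_eq_of_degree_eq
  refine degree_eq_degree_of_associated (associated_of_dvd_dvd ?_ ?_)
  · exact h _ (EuclideanDomain.gcd_dvd_left _ _) (EuclideanDomain.gcd_dvd_right _ _)
  · exact EuclideanDomain.dvd_gcd h₁ h₂

theorem IsKNormal.natDegree_le_of_dvd {E : Type*} [Field E] {q n k : ℕ} {α : E} {d : E[X]}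
    (hn : 0 < n) (hα : IsKNormal q n k α) (h₁ : d ∣ X ^ n - 1) (h₂ : d ∣ gPoly q n α) :
    d.natDegree ≤ k := by
  let _ : DecidableEq E[X] := Classical.decEq _
  rw [← hα]
  refine Polynomial.natDegree_le_of_dvd (EuclideanDomain.dvd_gcd h₁ h₂) fun h' => ?_
  exact X_pow_sub_C_ne_zero hn (1 : E) (EuclideanDomain.gcd_eq_zero_iff.1 h').1

/-- Modulo `x⁵ - 1`, the polynomial of `α^{q²} - b α^q + α + a` is
`(x² - b x + 1) (g_α + a (x² + (1 + b) x + 1))`. -/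
theorem gPoly_quadratic_translate {E : Type*} [Field E] {q : ℕ}
    (hadd : ∀ x y : E, (x + y) ^ q = x ^ q + y ^ q)
    {α a b : E} (hα : α ^ q ^ 5 = α) (ha : a ^ q = a) (hb : (-b) ^ q = -b)
    (hb2 : b ^ 2 + b - 1 = 0) :
    gPoly q 5 (α ^ q ^ 2 + -b * α ^ q + α + a) =
      (X ^ 2 - C b * X + 1) * (gPoly q 5 α + C a * (X ^ 2 + (1 + C b) * X + 1)) -
        (X ^ 5 - 1) * (C (α ^ q) + X * C α - C b * C α) := by
  have hstep : ∀ x y z : E, (x + -b * y + z + a) ^ q = x ^ q + -b * y ^ q + z ^ q + a := by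
    intro x y z
    rw [hadd, hadd, hadd, mul_pow, ha, hb]
  have hsucc : ∀ (x : E) (i : ℕ), x ^ q ^ (i + 1) = (x ^ q ^ i) ^ q := by
    intro x i
    rw [pow_succ, pow_mul]
  have hC : (C b : E[X]) ^ 2 + C b - 1 = 0 := by
    rw [← C_pow, ← C_add, ← C_1, ← C_sub, hb2, C_0]
  simp only [hsucc, pow_one] at hα
  simp only [gPoly, Finset.sum_range_succ, Finset.sum_range_zero, hsucc, pow_zero, pow_one,
    hstep, hα, C_add, C_mul, C_neg]
  linear_combination (C a * X ^ 2) * hC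

/-- Let `q ≡ ±1 (mod 5)` be a prime power, `b ∈ F_q` a root of `x² + x - 1`, `α` a normal
element of `F_{q^5}` over `F_q`, and `f = x² - b·x + 1`.  Then there is a unique `a₀ ∈ F_q`
such that `L_f(α) + a` is `2`-normal for every `a ∈ F_q` with `a ≠ a₀`. -/
theorem two_normal_translates (q : ℕ) (hq : IsPrimePow q) (h5 : q % 5 = 1 ∨ q % 5 = 4)
    (F E : Type*) [Field F] [Fintype F] [Field E] [Fintype E] [Algebra F E]
    (hF : Fintype.card F = q) (hE : Fintype.card E = q ^ 5)
    (b : F) (hb : b ^ 2 + b - 1 = 0)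
    (α : E) (hα : IsKNormal q 5 0 α) :
    ∃! a₀ : F, ∀ a : F, a ≠ a₀ →
      IsKNormal q 5 2 (Lf q ((X : Polynomial F) ^ 2 - C b * X + 1) α + algebraMap F E a) := by
  subst hF
  set q := Fintype.card F with hq_def
  have hadd : ∀ x y : E, (x + y) ^ q = x ^ q + y ^ q := fun x y =>
    map_add (FiniteField.frobeniusAlgHom F E) x y
  have hfix : ∀ x : F, (algebraMap F E x) ^ q = algebraMap F E x := fun x => by
    rw [← map_pow, FiniteField.pow_card]
  have hα5 : α ^ q ^ 5 = α := by rw [← hE, FiniteField.pow_card]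
  have hrank : Module.finrank F E = 5 := by
    have h := Module.card_eq_pow_finrank (K := F) (V := E)
    rw [hE] at h
    exact (Nat.pow_right_injective hq.two_le h).symm
  have htr : algebraMap F E (Algebra.trace F E α) = (gPoly q 5 α).eval 1 := by
    rw [FiniteField.algebraMap_trace_eq_sum_pow, hrank]
    simp [gPoly, eval_finsetSum, hq_def, Nat.card_eq_fintype_card]
  have h3 : 3 + b ≠ 0 := by
    intro h
    have h5F : ((5 : ℕ) : F) = 0 := by
      push_cast
      linear_combination hb - (b - 2) * h
    have hqF : ((q : ℕ) : F) = 0 := FiniteField.cast_card_eq_zero F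
    have hcop : Nat.Coprime 5 q := by
      rw [Nat.Prime.coprime_iff_not_dvd (by norm_num)]
      omega
    have h1 := Nat.isCoprime_iff_coprime.2 hcop
    obtain ⟨u, v, huv⟩ := h1
    have := congrArg (Int.cast : ℤ → F) huv
    push_cast at this h5F
    rw [h5F, hqF] at this
    simp at this
  set β : E := algebraMap F E b with hβ
  have hβ2 : β ^ 2 + β - 1 = 0 := by
    simpa using congrArg (algebraMap F E) hb
  set f : E[X] := X ^ 2 - C β * X + 1 with hf
  set f' : E[X] := X ^ 2 + (1 + C β) * X + 1 with hf'
  have hfdeg : f.natDegree = 2 := by rw [hf]; compute_degree!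
  have hfne : f ≠ 0 := by
    rintro h
    simp [h] at hfdeg
  have hfac : (X : E[X]) ^ 5 - 1 = f * ((X - C 1) * f') := by
    have hC : (C β : E[X]) ^ 2 + C β - 1 = 0 := by
      rw [← C_pow, ← C_add, ← C_1, ← C_sub, hβ2, C_0]
    rw [hf, hf', C_1]
    linear_combination (X ^ 2 * (X - 1)) * hC
  have hL : ∀ a : F, Lf q ((X : F[X]) ^ 2 - C b * X + 1) α + algebraMap F E a =
      α ^ q ^ 2 + -β * α ^ q + α + algebraMap F E a := by
    intro a
    have hdeg : ((X : F[X]) ^ 2 - C b * X + 1).natDegree = 2 := by compute_degree!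
    simp [Lf, hdeg, Finset.sum_range_succ, coeff_X, coeff_one, hβ]
    ring
  have hg : ∀ a : F, gPoly q 5 (α ^ q ^ 2 + -β * α ^ q + α + algebraMap F E a) =
      f * (gPoly q 5 α + C (algebraMap F E a) * f') -
        (X ^ 5 - 1) * (C (α ^ q) + X * C α - C β * C α) := fun a =>
    gPoly_quadratic_translate hadd hα5 (hfix a) (by rw [hβ, ← map_neg, hfix]) hβ2
  have hcop : IsCoprime f' (gPoly q 5 α) :=
    ((isKNormal_zero_iff_isCoprime (by norm_num) α).1 hα).of_isCoprime_of_dvd_left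
      ⟨f * (X - C 1), by rw [hfac]; ring⟩
  have heval : ∀ a : F, (gPoly q 5 α + C (algebraMap F E a) * f').eval 1 =
      algebraMap F E (Algebra.trace F E α + a * (3 + b)) := by
    intro a
    have h : f'.eval 1 = 3 + β := by
      rw [hf']
      simp
      ring
    rw [eval_add, eval_mul, eval_C, ← htr, h]
    simp only [map_add, map_mul, map_ofNat, hβ]
  refine ⟨-Algebra.trace F E α / (3 + b), fun a ha => ?_, fun a₁ ha₁ => ?_⟩
  · rw [hL]
    have hne : Algebra.trace F E α + a * (3 + b) ≠ 0 := by
      intro h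
      apply ha
      rw [eq_div_iff h3]
      linear_combination h
    have hcop1 : IsCoprime (X - C 1) (gPoly q 5 α + C (algebraMap F E a) * f') := by
      rw [(irreducible_X_sub_C (1 : E)).coprime_iff_not_dvd, dvd_iff_isRoot, IsRoot, heval]
      exact (_root_.map_ne_zero _).2 hne
    have hcop2 : IsCoprime f' (gPoly q 5 α + C (algebraMap F E a) * f') := by
      rw [mul_comm]
      exact hcop.add_mul_left_right _
    refine isKNormal_of_forall_dvd hfdeg (hfac ▸ dvd_mul_right _ _) ?_ fun e he₁ he₂ => ?_
    · rw [hg]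
      exact dvd_sub (dvd_mul_right _ _) (Dvd.dvd.mul_right (hfac ▸ dvd_mul_right _ _) _)
    · rw [hg] at he₂
      have he₃ := (dvd_sub_left (he₁.mul_right _)).1 he₂
      rw [hfac] at he₁
      obtain ⟨u, v, huv⟩ := hcop1.mul_left hcop2
      rw [← mul_one f, ← huv, mul_add, mul_left_comm, mul_left_comm f v]
      exact dvd_add (he₁.mul_left _) (he₃.mul_left _)
  · by_contra hne
    have h2 := ha₁ _ (Ne.symm hne)
    rw [hL] at h2
    have hdvd : f * (X - C 1) ∣ (X : E[X]) ^ 5 - 1 := by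
      rw [hfac, ← mul_assoc]
      exact dvd_mul_right _ _
    have hle := h2.natDegree_le_of_dvd (by norm_num) hdvd (by
      rw [hg]
      refine dvd_sub (mul_dvd_mul_left _ ?_) (hdvd.mul_right _)
      rw [dvd_iff_isRoot, IsRoot, heval, div_mul_cancel₀ _ h3, add_neg_cancel, map_zero])
    rw [natDegree_mul hfne (X_sub_C_ne_zero 1), hfdeg, natDegree_X_sub_C] at hle
    omega

end
end
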